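/- arXiv:1703.10790 — 4 statements merged into one kernel-verified Lean document; each statement's English description precedes it below -/
import Mathlib

section
/- Let d ≥ 1 and fix β ∈ [1,2). Let ν be a symmetric Lévy measure on ℝ^d and let (p_t)_{t≥0} be the marginal laws of the symmetric Lévy process with triplet (0, 0, ν), i.e. with characteristic exponent ψ(ξ) = ∫ (1 − cos⟨ξ,y⟩) ν(dy). Assume: (a) V(t) := ν({y : ‖y‖ > 1/t}) is regularly varying at infinity of index α ∈ (β, 2); (b) there is a nonzero Borel measure η on ℝ^d \ {0} with ∫ min(1, ‖y‖²) η(dy) < ∞ such that for every Borel set G ⊂ ℝ^d whose closure does not contain 0 and with η(∂G) = 0, lim_{s→0+} ν(sG)/ν({y : ‖y‖ > s}) = η(G). Let g be a bounded Borel function and μ a finite Borel measure on ℝ^d, set r = g ∗ μ̌, and assume there is a function R_β on S^{d−1} with lim_{t→0+} sup_{θ∈S^{d−1}} |t^{−β}(r(tθ) + r(−tθ) − 2r(0)) − R_β(θ)| = 0, and that |r(x) + r(−x) − 2r(0)| ≤ L‖x‖^β for all x ∈ ℝ^d and some L > 0. Let p_η : ℝ^d → [0,∞) be integrable with ∫_{ℝ^d}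 e^{i⟨ξ,x⟩} p_η(x) dx = e^{−∫(1 − cos⟨ξ,y⟩) η(dy)} for all ξ ∈ ℝ^d. Then lim_{t→0+} [V^−(1/t)]^β (H_g^μ(t) − H_g^μ(0)) = (1/2) ∫_{ℝ^d} R_β(x/‖x‖) ‖x‖^β p_η(x) dx. -/
open MeasureTheory Filter
open scoped Topology RealInnerProductSpace ENNReal Pointwise

/-! ### Regularly varying monotone functions -/

section RegularVariation

variable {V : ℝ → ℝ}

lemma exists_forall_le_mul_rpow_of_tendsto_div (hpos : ∀ t, 0 < t → 0 < V t)
    (hmono : ∀ s t, 0 < s → s ≤ t → V s ≤ V t) {α b : ℝ} (hα : 0 < α)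
    (hreg : Tendsto (fun s => V (2 * s) / V s) atTop (𝓝 (2 ^ α))) (hb : α < b) :
    ∃ C : ℝ, 0 < C ∧ ∃ s₀ : ℝ, 0 < s₀ ∧ ∀ s, s₀ ≤ s → ∀ l : ℝ, 1 ≤ l →
      V (l * s) ≤ C * l ^ b * V s := by
  have hlt : (2 : ℝ) ^ α < 2 ^ b := Real.rpow_lt_rpow_of_exponent_lt (by norm_num) hb
  obtain ⟨s₁, hs₁⟩ := eventually_atTop.1 (hreg.eventually (gt_mem_nhds hlt))
  refine ⟨2 ^ b, by positivity, max s₁ 1, by positivity, fun s hs l hl => ?_⟩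
  have hs0 : 0 < s := lt_of_lt_of_le (by positivity) hs
  have step : ∀ n : ℕ, V (2 ^ n * s) ≤ (2 ^ b) ^ n * V s := by
    intro n
    induction n with
    | zero => simp
    | succ n ih =>
      have h1 : (1 : ℝ) ≤ 2 ^ n := one_le_pow₀ (by norm_num)
      have h2 : s₁ ≤ 2 ^ n * s := by
        have := le_max_left s₁ 1
        nlinarith
      have h3 := hs₁ _ h2
      have h4 : 0 < V (2 ^ n * s) := hpos _ (by positivity)
      rw [div_lt_iff₀ h4] at h3
      calc V (2 ^ (n + 1) * s) = V (2 * (2 ^ n * s)) := by ring_nf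
        _ ≤ 2 ^ b * V (2 ^ n * s) := h3.le
        _ ≤ 2 ^ b * ((2 ^ b) ^ n * V s) := by gcongr
        _ = _ := by ring
  obtain ⟨n, hn1, hn2⟩ := exists_nat_pow_near hl (by norm_num : (1 : ℝ) < 2)
  have hVs := hpos s hs0
  have h5 : ((2 : ℝ) ^ b) ^ n ≤ l ^ b := by
    rw [← Real.rpow_natCast, ← Real.rpow_mul (by norm_num), mul_comm, Real.rpow_mul (by norm_num),
      Real.rpow_natCast]
    exact Real.rpow_le_rpow (by positivity) hn1 (by linarith)
  calc V (l * s) ≤ V (2 ^ (n + 1) * s) := hmono _ _ (by positivity) (by gcongr)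
    _ ≤ (2 ^ b) ^ (n + 1) * V s := step _
    _ = 2 ^ b * (2 ^ b) ^ n * V s := by ring
    _ ≤ 2 ^ b * l ^ b * V s := by gcongr

lemma exists_forall_mul_rpow_le_of_tendsto_div (hpos : ∀ t, 0 < t → 0 < V t)
    (hmono : ∀ s t, 0 < s → s ≤ t → V s ≤ V t) {α a : ℝ} (ha0 : 0 < a)
    (hreg : Tendsto (fun s => V (2 * s) / V s) atTop (𝓝 (2 ^ α))) (ha : a < α) :
    ∃ C : ℝ, 0 < C ∧ ∃ s₀ : ℝ, 0 < s₀ ∧ ∀ s, s₀ ≤ s → ∀ l : ℝ, 1 ≤ l →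
      l ^ a * V s ≤ C * V (l * s) := by
  have hlt : (2 : ℝ) ^ a < 2 ^ α := Real.rpow_lt_rpow_of_exponent_lt (by norm_num) ha
  obtain ⟨s₁, hs₁⟩ := eventually_atTop.1 (hreg.eventually (lt_mem_nhds hlt))
  refine ⟨2 ^ a, by positivity, max s₁ 1, by positivity, fun s hs l hl => ?_⟩
  have hs0 : 0 < s := lt_of_lt_of_le (by positivity) hs
  have step : ∀ n : ℕ, (2 ^ a) ^ n * V s ≤ V (2 ^ n * s) := by
    intro n
    induction n with
    | zero => simp
    | succ n ih =>
      have h1 : (1 : ℝ) ≤ 2 ^ n := one_le_pow₀ (by norm_num)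
      have h2 : s₁ ≤ 2 ^ n * s := by
        have := le_max_left s₁ 1
        nlinarith
      have h3 := hs₁ _ h2
      have h4 : 0 < V (2 ^ n * s) := hpos _ (by positivity)
      rw [lt_div_iff₀ h4] at h3
      calc (2 ^ a) ^ (n + 1) * V s = 2 ^ a * ((2 ^ a) ^ n * V s) := by ring
        _ ≤ 2 ^ a * V (2 ^ n * s) := by gcongr
        _ ≤ V (2 * (2 ^ n * s)) := h3.le
        _ = _ := by ring_nf
  obtain ⟨n, hn1, hn2⟩ := exists_nat_pow_near hl (by norm_num : (1 : ℝ) < 2)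
  have hVs := hpos s hs0
  have h5 : l ^ a ≤ ((2 : ℝ) ^ a) ^ (n + 1) := by
    rw [← Real.rpow_natCast, ← Real.rpow_mul (by norm_num), mul_comm, Real.rpow_mul (by norm_num),
      Real.rpow_natCast]
    exact Real.rpow_le_rpow (by positivity) hn2.le (by linarith)
  calc l ^ a * V s ≤ (2 ^ a) ^ (n + 1) * V s := by gcongr
    _ = 2 ^ a * ((2 ^ a) ^ n * V s) := by ring
    _ ≤ 2 ^ a * V (2 ^ n * s) := by gcongr; exact step n
    _ ≤ 2 ^ a * V (l * s) := by gcongr; exact hmono _ _ (by positivity) (by gcongr)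

lemma tendsto_atTop_of_tendsto_div (hpos : ∀ t, 0 < t → 0 < V t)
    (hmono : ∀ s t, 0 < s → s ≤ t → V s ≤ V t) {α : ℝ} (hα : 0 < α)
    (hreg : Tendsto (fun s => V (2 * s) / V s) atTop (𝓝 (2 ^ α))) :
    Tendsto V atTop atTop := by
  obtain ⟨C, hC, s₀, hs₀, h⟩ := exists_forall_mul_rpow_le_of_tendsto_div hpos hmono (half_pos hα)
    hreg (half_lt_self hα)
  have h1 : Tendsto (fun t : ℝ => C⁻¹ * V s₀ * (t / s₀) ^ (α / 2)) atTop atTop := by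
    refine Tendsto.const_mul_atTop (by have := hpos s₀ hs₀; positivity) ?_
    exact (tendsto_rpow_atTop (half_pos hα)).comp (tendsto_id.atTop_div_const hs₀)
  refine tendsto_atTop_mono' _ ?_ h1
  filter_upwards [eventually_ge_atTop s₀] with t ht
  have h2 := h s₀ le_rfl (t / s₀) ((one_le_div hs₀).2 ht)
  rw [div_mul_cancel₀ _ hs₀.ne'] at h2
  rw [mul_assoc, inv_mul_le_iff₀ hC]
  linarith

lemma le_generalizedInverse_of_lt {Vinv : ℝ → ℝ}
    (hVinv : ∀ u, Vinv u = sInf {x : ℝ | 0 ≤ x ∧ u ≤ V x})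
    (hmono : ∀ s t, 0 < s → s ≤ t → V s ≤ V t) (htop : Tendsto V atTop atTop)
    {u M : ℝ} (h0 : V 0 < u) (hM : V M < u) : M ≤ Vinv u := by
  rw [hVinv]
  refine le_csInf ?_ ?_
  · obtain ⟨x, hx1, hx2⟩ := ((htop.eventually_ge_atTop u).and (eventually_ge_atTop 0)).exists
    exact ⟨x, hx2, hx1⟩
  · rintro x ⟨hx0, hx⟩
    by_contra! hlt
    rcases hx0.eq_or_lt with rfl | hx0
    · linarith
    · linarith [hmono x M hx0 hlt.le]

lemma tendsto_generalizedInverse_inv {Vinv : ℝ → ℝ}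
    (hVinv : ∀ u, Vinv u = sInf {x : ℝ | 0 ≤ x ∧ u ≤ V x})
    (hmono : ∀ s t, 0 < s → s ≤ t → V s ≤ V t) (htop : Tendsto V atTop atTop) :
    Tendsto (fun t => Vinv (1 / t)) (𝓝[>] 0) atTop := by
  refine tendsto_atTop.2 fun M => ?_
  have h : Tendsto (fun t : ℝ => 1 / t) (𝓝[>] 0) atTop := by
    simpa using tendsto_inv_nhdsGT_zero (𝕜 := ℝ)
  filter_upwards [h.eventually_gt_atTop (V 0), h.eventually_gt_atTop (V M)] with t h0 hM
  exact le_generalizedInverse_of_lt hVinv hmono htop h0 hM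

lemma tendsto_mul_comp_generalizedInverse {Vinv : ℝ → ℝ}
    (hVinv : ∀ u, Vinv u = sInf {x : ℝ | 0 ≤ x ∧ u ≤ V x})
    (hpos : ∀ t, 0 < t → 0 < V t)
    (hmono : ∀ s t, 0 < s → s ≤ t → V s ≤ V t) (htop : Tendsto V atTop atTop)
    {α : ℝ} (hreg : ∀ l : ℝ, 0 < l → Tendsto (fun s => V (l * s) / V s) atTop (𝓝 (l ^ α))) :
    Tendsto (fun t => t * V (Vinv (1 / t))) (𝓝[>] 0) (𝓝 1) := by
  have hc := tendsto_generalizedInverse_inv hVinv hmono htop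
  have hpow : Tendsto (fun l : ℝ => (l ^ α)⁻¹) (𝓝 1) (𝓝 1) := by
    have : ContinuousAt (fun l : ℝ => (l ^ α)⁻¹) 1 :=
      (Real.continuousAt_rpow_const _ _ (Or.inl one_ne_zero)).inv₀ (by simp)
    simpa [ContinuousAt] using this
  have key : ∀ l : ℝ, 0 < l → Tendsto (fun t => (V (l * Vinv (1 / t)) / V (Vinv (1 / t)))⁻¹)
      (𝓝[>] 0) (𝓝 ((l ^ α)⁻¹)) := fun l hl =>
    ((hreg l hl).comp hc).inv₀ (by positivity)
  refine tendsto_order.2 ⟨fun u hu => ?_, fun u hu => ?_⟩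
  · obtain ⟨l, hl, hl1⟩ := (((hpow.eventually (lt_mem_nhds hu)).filter_mono
      nhdsWithin_le_nhds).and (self_mem_nhdsWithin : Set.Ioi (1 : ℝ) ∈ 𝓝[>] 1)).exists
    have hl0 : (0 : ℝ) < l := zero_lt_one.trans hl1
    filter_upwards [(key l hl0).eventually (lt_mem_nhds hl), hc.eventually_gt_atTop 0,
      self_mem_nhdsWithin] with t ht hct (ht0 : 0 < t)
    have hV := hpos _ hct
    have hVl := hpos _ (mul_pos hl0 hct)
    refine ht.trans_le ?_
    have h1 : Vinv (1 / t) < l * Vinv (1 / t) := by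
      have : (1 : ℝ) < l := hl1
      nlinarith
    have h2 : 1 / t ≤ V (l * Vinv (1 / t)) := by
      by_contra! hlt
      nth_rewrite 1 [hVinv] at h1
      have hne : {x : ℝ | 0 ≤ x ∧ 1 / t ≤ V x}.Nonempty := by
        obtain ⟨x, hx1, hx2⟩ :=
          ((htop.eventually_ge_atTop (1 / t)).and (eventually_ge_atTop 0)).exists
        exact ⟨x, hx2, hx1⟩
      obtain ⟨x, ⟨hx0, hx⟩, hxl⟩ := exists_lt_of_csInf_lt hne h1
      rcases hx0.eq_or_lt with rfl | hx0
      · have : sInf {x : ℝ | 0 ≤ x ∧ 1 / t ≤ V x} ≤ 0 :=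
          csInf_le ⟨0, fun y hy => hy.1⟩ ⟨le_rfl, hx⟩
        rw [← hVinv] at this
        linarith
      · linarith [hmono x _ hx0 hxl.le]
    rw [div_le_iff₀ ht0] at h2
    rw [inv_div, div_le_iff₀ hVl]
    nlinarith
  · obtain ⟨l, ⟨hl, hl0⟩, hl1⟩ := ((((hpow.eventually (gt_mem_nhds hu)).and
      (lt_mem_nhds one_pos)).filter_mono nhdsWithin_le_nhds).and
      (self_mem_nhdsWithin : Set.Iio (1 : ℝ) ∈ 𝓝[<] 1)).exists
    filter_upwards [(key l hl0).eventually (gt_mem_nhds hl), hc.eventually_gt_atTop 0,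
      self_mem_nhdsWithin] with t ht hct (ht0 : 0 < t)
    have hV := hpos _ hct
    have hVl := hpos _ (mul_pos hl0 hct)
    refine lt_of_le_of_lt ?_ ht
    have h1 : l * Vinv (1 / t) < Vinv (1 / t) := by
      have : l < (1 : ℝ) := hl1
      nlinarith
    have h2 : V (l * Vinv (1 / t)) < 1 / t := by
      by_contra! hle
      have : Vinv (1 / t) ≤ l * Vinv (1 / t) := by
        nth_rewrite 1 [hVinv]
        exact csInf_le ⟨0, fun y hy => hy.1⟩ ⟨by positivity, hle⟩
      linarith
    rw [lt_div_iff₀ ht0] at h2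
    rw [inv_div, le_div_iff₀ hVl]
    nlinarith

end RegularVariation

/-! ### Convergence of measures away from the origin -/

section VagueConvergence

lemma tendsto_lintegral_of_le_of_isOpen_le_liminf {Ω : Type*} [TopologicalSpace Ω]
    [MeasurableSpace Ω] [OpensMeasurableSpace Ω] {m : Measure Ω} {M : ℕ → Measure Ω}
    (hopen : ∀ G, IsOpen G → m G ≤ liminf (fun n => M n G) atTop)
    {f g : Ω → ℝ} (hf : Continuous f) (hg : Continuous g) (hf0 : 0 ≤ f) (hfg : f ≤ g)
    (hgfin : ∫⁻ x, ENNReal.ofReal (g x) ∂m ≠ ⊤)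
    (hglim : Tendsto (fun n => ∫⁻ x, ENNReal.ofReal (g x) ∂(M n)) atTop
      (𝓝 (∫⁻ x, ENNReal.ofReal (g x) ∂m))) :
    Tendsto (fun n => ∫⁻ x, ENNReal.ofReal (f x) ∂(M n)) atTop
      (𝓝 (∫⁻ x, ENNReal.ofReal (f x) ∂m)) := by
  have hsplit : ∀ k : Measure Ω, ∫⁻ x, ENNReal.ofReal (g x) ∂k =
      ∫⁻ x, ENNReal.ofReal (f x) ∂k + ∫⁻ x, ENNReal.ofReal (g x - f x) ∂k := by
    intro k
    rw [← lintegral_add_left (by fun_prop)]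
    refine lintegral_congr fun x => ?_
    rw [← ENNReal.ofReal_add (hf0 x) (sub_nonneg.2 (hfg x))]
    simp
  have hF := lintegral_le_liminf_lintegral_of_forall_isOpen_measure_le_liminf_measure hf hf0 hopen
  have hB := lintegral_le_liminf_lintegral_of_forall_isOpen_measure_le_liminf_measure
    (f := fun x => g x - f x) (hg.sub hf) (fun x => sub_nonneg.2 (hfg x)) hopen
  simp_rw [hsplit] at hglim
  rw [hsplit] at hgfin
  set F := ∫⁻ x, ENNReal.ofReal (f x) ∂m
  set B := ∫⁻ x, ENNReal.ofReal (g x - f x) ∂m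
  have hFt : F ≠ ⊤ := fun h => hgfin (by simp [h])
  have hBt : B ≠ ⊤ := fun h => hgfin (by simp [h])
  refine tendsto_order.2 ⟨fun u hu => eventually_lt_of_lt_liminf (hu.trans_le hF), fun u hu => ?_⟩
  obtain ⟨v, hFv, hvu⟩ := exists_between hu
  have hvt : v ≠ ⊤ := (hvu.trans_le le_top).ne
  have hpos : v - F ≠ 0 := (tsub_pos_of_lt hFv).ne'
  have h1 : ∀ᶠ n in atTop, B - (v - F) ≤ ∫⁻ x, ENNReal.ofReal (g x - f x) ∂(M n) := by
    rcases eq_or_ne B 0 with hB0 | hB0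
    · simp [hB0]
    · exact (eventually_lt_of_lt_liminf ((ENNReal.sub_lt_self hBt hB0 hpos).trans_le hB)).mono
        fun n hn => hn.le
  have h2 : F + B < u + (B - (v - F)) := by
    calc F + B ≤ F + ((v - F) + (B - (v - F))) := by gcongr; exact le_add_tsub
      _ = v + (B - (v - F)) := by rw [← add_assoc, add_tsub_cancel_of_le hFv.le]
      _ < _ := ENNReal.add_lt_add_right (ne_top_of_le_ne_top hBt tsub_le_self) hvu
  filter_upwards [h1, hglim.eventually (gt_mem_nhds h2)] with n hn1 hn2
  by_contra! hle
  exact absurd (hn2.trans_le (add_le_add hle hn1)) (lt_irrefl _)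

variable {E : Type*} [NormedAddCommGroup E] [MeasurableSpace E] [BorelSpace E]

lemma measure_le_liminf_of_tendsto_away_from_zero {η : Measure E} [SFinite η] (hη0 : η {0} = 0)
    {M : ℕ → Measure E}
    (hlim : ∀ G : Set E, MeasurableSet G → (0 : E) ∉ closure G → η (frontier G) = 0 →
      Tendsto (fun n => M n G) atTop (𝓝 (η G)))
    (G : Set E) (hG : IsOpen G) : η G ≤ liminf (fun n => M n G) atTop := by
  set U : Set E := G \ {0} with hU
  have hUo : IsOpen U := hG.sdiff isClosed_singleton
  have hne : (Uᶜ).Nonempty := ⟨0, by simp [hU]⟩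
  have hηU : η G = η U := (measure_sdiff_null hη0).symm
  set φ : E → ℝ := fun x => Metric.infDist x Uᶜ with hφ
  have hφc : Continuous φ := Metric.continuous_infDist_pt _
  have hcount := Measure.countable_meas_level_set_pos (μ := η) hφc.measurable
  obtain ⟨u, hu_anti, hu_mem, hu_lim⟩ :=
    (Set.Countable.dense_compl ℝ hcount).exists_seq_strictAnti_tendsto (0 : ℝ)
  have hUeq : (⋃ n, {x | u n < φ x}) = U := by
    ext x
    simp only [Set.mem_iUnion, Set.mem_ofPred_eq]
    constructor
    · rintro ⟨n, hn⟩
      by_contra hx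
      have : φ x = 0 := Metric.infDist_zero_of_mem hx
      have h0 : 0 < u n := (hu_mem n).1
      linarith
    · intro hx
      have hpos : 0 < φ x := by
        rw [← Metric.infDist_pos_iff_notMem_closure hne, hUo.isClosed_compl.closure_eq]
        simpa using hx
      exact (hu_lim.eventually (gt_mem_nhds hpos)).exists
  have hmono : Monotone fun n => {x | u n < φ x} := fun i j hij x hx =>
    lt_of_le_of_lt (hu_anti.antitone hij) hx
  have hconv : Tendsto (fun n => η {x | u n < φ x}) atTop (𝓝 (η U)) := by
    rw [← hUeq]; exact tendsto_measure_iUnion_atTop hmono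
  rw [hηU]
  refine le_of_tendsto' hconv fun k => ?_
  have h0 : 0 < u k := (hu_mem k).1
  have hk := hlim {x | u k < φ x} (measurableSet_lt measurable_const hφc.measurable) ?_ ?_
  · rw [← hk.liminf_eq]
    refine liminf_le_liminf (Eventually.of_forall fun n => measure_mono fun x hx => ?_)
    have : x ∈ U := hUeq ▸ Set.mem_iUnion.2 ⟨k, hx⟩
    exact this.1
  · intro hcl
    have h1 : (0 : E) ∈ {x | u k ≤ φ x} :=
      closure_lt_subset_le continuous_const hφc hcl
    have h2 : φ 0 = 0 := Metric.infDist_zero_of_mem (by simp [hU])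
    have h3 : u k ≤ φ 0 := h1
    linarith
  · refine measure_mono_null (frontier_lt_subset_eq continuous_const hφc) ?_
    have := (hu_mem k).2
    simp only [Set.mem_compl_iff, Set.mem_ofPred_eq, not_lt, nonpos_iff_eq_zero] at this
    simpa only [eq_comm] using this

lemma sigmaFinite_of_lintegral_min_norm_sq {η : Measure E} (hη0 : η {0} = 0)
    (hη : ∫⁻ y, ENNReal.ofReal (min 1 (‖y‖ ^ 2)) ∂η < ⊤) : SigmaFinite η := by
  set w : E → ℝ≥0∞ := fun y => ENNReal.ofReal (min 1 (‖y‖ ^ 2)) with hw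
  have hwm : Measurable w := by fun_prop
  have hne : ∀ᵐ y ∂η, w y ≠ 0 := by
    rw [ae_iff]
    refine measure_mono_null (fun y hy => ?_) hη0
    by_contra hy0
    have h1 : 0 < ‖y‖ := norm_pos_iff.2 hy0
    simp only [hw, ne_eq, ENNReal.ofReal_eq_zero, not_le, Set.mem_ofPred_eq, not_lt] at hy
    have : 0 < min 1 (‖y‖ ^ 2) := lt_min one_pos (by positivity)
    linarith
  have : IsFiniteMeasure (η.withDensity w) := isFiniteMeasure_withDensity hη.ne
  rw [← withDensity_inv_same hwm hne (ae_of_all _ fun _ => ENNReal.ofReal_ne_top)]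
  refine SigmaFinite.withDensity_of_ne_top ?_
  have : (η.withDensity w) {0} = 0 := by
    exact withDensity_absolutelyContinuous _ _ hη0
  rw [ae_iff]
  refine measure_mono_null (fun y hy => ?_) this
  by_contra hy0
  have h1 : 0 < ‖y‖ := norm_pos_iff.2 hy0
  have : 0 < min 1 (‖y‖ ^ 2) := lt_min one_pos (by positivity)
  simp only [hw, ne_eq, ENNReal.inv_eq_top, ENNReal.ofReal_eq_zero, not_le, Set.mem_ofPred_eq,
    not_lt] at hy
  linarith

lemma lintegral_min_norm_one_rpow (m : Measure E) {γ : ℝ} (hγ : 0 < γ) :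
    ∫⁻ y, ENNReal.ofReal (min ‖y‖ 1 ^ γ) ∂m =
      ENNReal.ofReal γ * ∫⁻ u in Set.Ioo (0 : ℝ) 1,
        m {y | u < ‖y‖} * ENNReal.ofReal (u ^ (γ - 1)) := by
  rw [lintegral_rpow_eq_lintegral_meas_lt_mul m
    (ae_of_all _ fun y => le_min (norm_nonneg _) zero_le_one) (by fun_prop) hγ]
  congr 1
  have h1 : ∀ u : ℝ, m {y : E | u < min ‖y‖ 1} * ENNReal.ofReal (u ^ (γ - 1)) =
      (Set.Iio (1 : ℝ)).indicator
        (fun u => m {y | u < ‖y‖} * ENNReal.ofReal (u ^ (γ - 1))) u := by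
    intro u
    by_cases hu : u < 1 <;> simp [hu]
  simp_rw [h1]
  rw [setLIntegral_indicator measurableSet_Iio, Set.inter_comm, Set.Ioi_inter_Iio]

end VagueConvergence

/-! ### Characteristic exponents -/

section Exponent

variable {E : Type*} [NormedAddCommGroup E] [InnerProductSpace ℝ E]

lemma one_sub_cos_inner_le (ξ y : E) {s γ : ℝ} (hs : ‖ξ‖ ≤ s) (hγ0 : 0 < γ) (hγ : γ ≤ 2) :
    1 - Real.cos ⟪ξ, y⟫ ≤ 2 * min (s * ‖y‖) 1 ^ γ := by
  have hs0 : 0 ≤ s := (norm_nonneg _).trans hs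
  rcases le_total (s * ‖y‖) 1 with h | h
  · rw [min_eq_left h]
    have h1 : |⟪ξ, y⟫| ≤ s * ‖y‖ := (abs_real_inner_le_norm ξ y).trans (by gcongr)
    have h2 := Real.one_sub_sq_div_two_le_cos (x := ⟪ξ, y⟫)
    have h3 : ⟪ξ, y⟫ ^ 2 ≤ (s * ‖y‖) ^ 2 := by
      rw [← sq_abs]
      gcongr
    have h4 : (s * ‖y‖) ^ 2 ≤ (s * ‖y‖) ^ γ := by
      rcases (mul_nonneg hs0 (norm_nonneg y)).eq_or_lt with h0 | h0
      · rw [← h0, Real.zero_rpow hγ0.ne']; norm_num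
      · rw [← Real.rpow_two]
        exact Real.rpow_le_rpow_of_exponent_ge h0 h hγ
    nlinarith [sq_nonneg (s * ‖y‖)]
  · rw [min_eq_right h, Real.one_rpow]
    linarith [Real.neg_one_le_cos ⟪ξ, y⟫]

lemma one_sub_cos_add_le (a b : ℝ) :
    1 - Real.cos (a + b) ≤ 2 * (1 - Real.cos a) + 2 * (1 - Real.cos b) := by
  have h : ∀ x : ℝ, 1 - Real.cos x = 2 * Real.sin (x / 2) ^ 2 := by
    intro x
    have := Real.cos_sq' (x / 2)
    have h2 := Real.cos_two_mul (x / 2)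
    rw [mul_div_cancel₀ x two_ne_zero] at h2
    linarith
  rw [h, h, h, add_div, Real.sin_add]
  have h1 := Real.sin_sq_add_cos_sq (a / 2)
  have h2 := Real.sin_sq_add_cos_sq (b / 2)
  have h3 : (Real.sin (a / 2) * Real.cos (b / 2)) ^ 2 ≤ Real.sin (a / 2) ^ 2 := by
    rw [mul_pow]; nlinarith [sq_nonneg (Real.sin (a / 2)), sq_nonneg (Real.sin (b / 2))]
  have h4 : (Real.cos (a / 2) * Real.sin (b / 2)) ^ 2 ≤ Real.sin (b / 2) ^ 2 := by
    rw [mul_pow]; nlinarith [sq_nonneg (Real.sin (a / 2)), sq_nonneg (Real.sin (b / 2))]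
  nlinarith [sq_nonneg (Real.sin (a / 2) * Real.cos (b / 2) - Real.cos (a / 2) * Real.sin (b / 2))]

variable [MeasurableSpace E]

/-- The characteristic exponent of the symmetric pure-jump Lévy process with Lévy measure `ν`. -/
noncomputable def levyExponent (ν : Measure E) (ξ : E) : ℝ := ∫ y, (1 - Real.cos ⟪ξ, y⟫) ∂ν

/-- The image of `ν` under dilation by `s`, normalized to give mass `1` to `{1 < ‖y‖}`. -/
noncomputable def rescaledMeasure (ν : Measure E) (s : ℝ) : Measure E :=
  (ν {y | s⁻¹ < ‖y‖})⁻¹ • ν.map (fun y => s • y)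

lemma levyExponent_nonneg (ν : Measure E) (ξ : E) : 0 ≤ levyExponent ν ξ :=
  integral_nonneg fun _ => sub_nonneg.2 (Real.cos_le_one _)

lemma levyExponent_neg (ν : Measure E) (ξ : E) : levyExponent ν (-ξ) = levyExponent ν ξ := by
  simp [levyExponent]

variable [BorelSpace E]

lemma integrable_one_sub_cos_inner {ν : Measure E}
    (hν : ∫⁻ y, ENNReal.ofReal (min 1 (‖y‖ ^ 2)) ∂ν < ⊤) (ξ : E) :
    Integrable (fun y => 1 - Real.cos ⟪ξ, y⟫) ν := by
  have h1 : Integrable (fun y : E => min 1 (‖y‖ ^ 2)) ν := by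
    refine ⟨by fun_prop, ?_⟩
    rw [hasFiniteIntegral_iff_ofReal (ae_of_all _ fun y => le_min zero_le_one (by positivity))]
    exact hν
  refine (h1.const_mul (2 * (1 + ‖ξ‖) ^ 2)).mono' (by fun_prop) (ae_of_all _ fun y => ?_)
  rw [Real.norm_of_nonneg (by linarith [Real.cos_le_one ⟪ξ, y⟫])]
  refine (one_sub_cos_inner_le ξ y (s := 1 + ‖ξ‖) (by linarith) two_pos le_rfl).trans ?_
  rw [mul_assoc, Real.rpow_two]
  refine mul_le_mul_of_nonneg_left ?_ zero_le_two
  have hn := norm_nonneg ξ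
  have hy := norm_nonneg y
  rcases le_total 1 (‖y‖ ^ 2) with h | h
  · rw [min_eq_left h]
    have h2 : 0 ≤ min ((1 + ‖ξ‖) * ‖y‖) 1 := le_min (by positivity) zero_le_one
    have h3 : min ((1 + ‖ξ‖) * ‖y‖) 1 ≤ 1 := min_le_right _ _
    nlinarith
  · rw [min_eq_right h, ← mul_pow]
    exact pow_le_pow_left₀ (le_min (by positivity) zero_le_one) (min_le_left _ _) 2

lemma levyExponent_add_le {ν : Measure E}
    (hν : ∫⁻ y, ENNReal.ofReal (min 1 (‖y‖ ^ 2)) ∂ν < ⊤) (ξ ζ : E) :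
    levyExponent ν (ξ + ζ) ≤ 2 * levyExponent ν ξ + 2 * levyExponent ν ζ := by
  have h := fun x => integrable_one_sub_cos_inner hν x
  unfold levyExponent
  rw [← integral_const_mul, ← integral_const_mul, ← integral_add ((h ξ).const_mul 2)
    ((h ζ).const_mul 2)]
  refine integral_mono (h _) (((h ξ).const_mul 2).add ((h ζ).const_mul 2)) fun y => ?_
  simp only [inner_add_left]
  exact one_sub_cos_add_le _ _

lemma lintegral_rescaledMeasure (ν : Measure E) (s : ℝ) {f : E → ℝ≥0∞} (hf : Measurable f) :
    ∫⁻ z, f z ∂(rescaledMeasure ν s) = (ν {y | s⁻¹ < ‖y‖})⁻¹ * ∫⁻ y, f (s • y) ∂ν := by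
  rw [rescaledMeasure, lintegral_smul_measure, lintegral_map hf (by fun_prop), smul_eq_mul]

lemma rescaledMeasure_apply (ν : Measure E) {s : ℝ} (hs : 0 < s) {G : Set E}
    (hG : MeasurableSet G) :
    rescaledMeasure ν s G = ν (s⁻¹ • G) / ν {y | s⁻¹ < ‖y‖} := by
  rw [rescaledMeasure, Measure.smul_apply, Measure.map_apply (by fun_prop) hG, smul_eq_mul,
    Set.preimage_smul₀ hs.ne', mul_comm, ENNReal.div_eq_inv_mul, mul_comm]

variable {ν : Measure E} {V : ℝ → ℝ}

lemma rescaledMeasure_lt_norm (hV : ∀ t, 0 < t → ν {y | t⁻¹ < ‖y‖} = ENNReal.ofReal (V t))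
    (hpos : ∀ t, 0 < t → 0 < V t) {s u : ℝ} (hs : 0 < s) (hu : 0 < u) :
    rescaledMeasure ν s {y | u < ‖y‖} = ENNReal.ofReal (V (u⁻¹ * s) / V s) := by
  rw [rescaledMeasure, Measure.smul_apply, Measure.map_apply (by fun_prop)
    (measurableSet_lt measurable_const measurable_norm), smul_eq_mul]
  have : (fun y : E => s • y) ⁻¹' {y | u < ‖y‖} = {y | (u⁻¹ * s)⁻¹ < ‖y‖} := by
    ext y
    simp only [Set.mem_preimage, Set.mem_ofPred_eq, norm_smul, Real.norm_of_nonneg hs.le, mul_inv,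
      inv_inv]
    rw [← div_eq_mul_inv, div_lt_iff₀ hs, mul_comm]
  rw [this, hV s hs, hV (u⁻¹ * s) (by positivity), ENNReal.ofReal_div_of_pos (hpos s hs),
    ENNReal.div_eq_inv_mul]

lemma lintegral_one_sub_cos_rescaledMeasure
    (hν : ∫⁻ y, ENNReal.ofReal (min 1 (‖y‖ ^ 2)) ∂ν < ⊤)
    (hV : ∀ t, 0 < t → ν {y | t⁻¹ < ‖y‖} = ENNReal.ofReal (V t))
    (hpos : ∀ t, 0 < t → 0 < V t) {s : ℝ} (hs : 0 < s) (ξ : E) :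
    ∫⁻ z, ENNReal.ofReal (1 - Real.cos ⟪ξ, z⟫) ∂(rescaledMeasure ν s) =
      ENNReal.ofReal (levyExponent ν (s • ξ) / V s) := by
  rw [lintegral_rescaledMeasure _ _ (by fun_prop), hV s hs, ENNReal.ofReal_div_of_pos (hpos s hs),
    ENNReal.div_eq_inv_mul, levyExponent, ofReal_integral_eq_lintegral_ofReal
      (integrable_one_sub_cos_inner hν _)
      (ae_of_all _ fun y => sub_nonneg.2 (Real.cos_le_one _))]
  simp_rw [inner_smul_left, inner_smul_right]
  rfl

lemma levyExponent_le_of_lintegral_le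
    (hν : ∫⁻ y, ENNReal.ofReal (min 1 (‖y‖ ^ 2)) ∂ν < ⊤)
    (hV : ∀ t, 0 < t → ν {y | t⁻¹ < ‖y‖} = ENNReal.ofReal (V t))
    (hpos : ∀ t, 0 < t → 0 < V t) {γ : ℝ} (hγ0 : 0 < γ) (hγ : γ ≤ 2) {M : ℝ} (hM : 0 ≤ M)
    {s : ℝ} (hs : 0 < s)
    (hb : ∫⁻ z, ENNReal.ofReal (min ‖z‖ 1 ^ γ) ∂(rescaledMeasure ν s) ≤ ENNReal.ofReal M)
    {ξ : E} (hξ : ‖ξ‖ ≤ s) : levyExponent ν ξ ≤ 2 * M * V s := by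
  have hVs := hpos s hs
  have h1 := lintegral_one_sub_cos_rescaledMeasure hν hV hpos hs (s⁻¹ • ξ)
  rw [smul_inv_smul₀ hs.ne'] at h1
  have h2 : ENNReal.ofReal (levyExponent ν ξ / V s) ≤ ENNReal.ofReal (2 * M) := by
    rw [← h1, ENNReal.ofReal_mul zero_le_two]
    refine le_trans ?_ (mul_le_mul_right hb _)
    rw [← lintegral_const_mul _ (by fun_prop)]
    refine lintegral_mono fun z => ?_
    rw [← ENNReal.ofReal_mul zero_le_two]
    refine ENNReal.ofReal_le_ofReal ?_
    have := one_sub_cos_inner_le (s⁻¹ • ξ) z (s := 1) ?_ hγ0 hγ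
    · simpa using this
    · rw [norm_smul, norm_inv, Real.norm_of_nonneg hs.le, inv_mul_le_iff₀ hs]
      linarith
  rwa [ENNReal.ofReal_le_ofReal_iff (by positivity), div_le_iff₀ hVs] at h2

lemma lintegral_Ioo_rpow_lt_top {C e : ℝ} (he : -1 < e) :
    ∫⁻ u in Set.Ioo (0 : ℝ) 1, ENNReal.ofReal (C * u ^ e) < ⊤ := by
  have h : IntegrableOn (fun u : ℝ => C * u ^ e) (Set.Ioo 0 1) := by
    have h1 := (intervalIntegral.intervalIntegrable_rpow' (a := 0) (b := 1) he).const_mul C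
    rw [intervalIntegrable_iff_integrableOn_Ioo_of_le zero_le_one] at h1
    exact h1
  exact h.lintegral_lt_top

lemma rescaledMeasure_mul_le (hV : ∀ t, 0 < t → ν {y | t⁻¹ < ‖y‖} = ENNReal.ofReal (V t))
    (hpos : ∀ t, 0 < t → 0 < V t) {C b s₀ γ : ℝ} (hs₀ : 0 < s₀)
    (hC : ∀ s, s₀ ≤ s → ∀ l : ℝ, 1 ≤ l → V (l * s) ≤ C * l ^ b * V s)
    {s u : ℝ} (hs : s₀ ≤ s) (hu : u ∈ Set.Ioo (0 : ℝ) 1) :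
    rescaledMeasure ν s {y | u < ‖y‖} * ENNReal.ofReal (u ^ (γ - 1)) ≤
      ENNReal.ofReal (C * u ^ (γ - 1 - b)) := by
  have hs0 : 0 < s := hs₀.trans_le hs
  have hu0 : 0 < u := hu.1
  have hVs := hpos s hs0
  have hVu := hpos (u⁻¹ * s) (by positivity)
  rw [rescaledMeasure_lt_norm hV hpos hs0 hu0, ← ENNReal.ofReal_mul (by positivity)]
  refine ENNReal.ofReal_le_ofReal ?_
  have h := hC s hs u⁻¹ (by rw [one_le_inv₀ hu0]; exact hu.2.le)
  rw [← div_le_iff₀ hVs] at h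
  calc V (u⁻¹ * s) / V s * u ^ (γ - 1) ≤ C * u⁻¹ ^ b * u ^ (γ - 1) := by gcongr
    _ = C * u ^ (γ - 1 - b) := by
      rw [Real.inv_rpow hu0.le, ← Real.rpow_neg hu0.le, mul_assoc, ← Real.rpow_add hu0]
      ring_nf

lemma exists_lintegral_rescaledMeasure_le
    (hV : ∀ t, 0 < t → ν {y | t⁻¹ < ‖y‖} = ENNReal.ofReal (V t))
    (hpos : ∀ t, 0 < t → 0 < V t) {C b s₀ γ : ℝ} (hs₀ : 0 < s₀)
    (hC : ∀ s, s₀ ≤ s → ∀ l : ℝ, 1 ≤ l → V (l * s) ≤ C * l ^ b * V s)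
    (hγ0 : 0 < γ) (hbγ : b < γ) :
    ∃ M : ℝ, 0 < M ∧ ∀ s, s₀ ≤ s →
      ∫⁻ z, ENNReal.ofReal (min ‖z‖ 1 ^ γ) ∂(rescaledMeasure ν s) ≤ ENNReal.ofReal M := by
  have hfin := lintegral_Ioo_rpow_lt_top (C := C) (e := γ - 1 - b) (by linarith)
  set A := ENNReal.ofReal γ * ∫⁻ u in Set.Ioo (0 : ℝ) 1, ENNReal.ofReal (C * u ^ (γ - 1 - b))
  have hA : A ≠ ⊤ := ENNReal.mul_ne_top ENNReal.ofReal_ne_top hfin.ne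
  refine ⟨A.toReal + 1, by positivity, fun s hs => ?_⟩
  have h1 : A ≤ ENNReal.ofReal (A.toReal + 1) := by
    rw [← ENNReal.ofReal_toReal hA]
    refine ENNReal.ofReal_le_ofReal ?_
    rw [ENNReal.toReal_ofReal ENNReal.toReal_nonneg]
    linarith
  refine le_trans ?_ h1
  rw [lintegral_min_norm_one_rpow _ hγ0]
  refine mul_le_mul_right (setLIntegral_mono' measurableSet_Ioo fun u hu => ?_) _
  exact rescaledMeasure_mul_le hV hpos hs₀ hC hs hu

lemma tendsto_levyExponent_div {η : Measure E} (hη0 : η {0} = 0)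
    (hν : ∫⁻ y, ENNReal.ofReal (min 1 (‖y‖ ^ 2)) ∂ν < ⊤)
    (hη : ∫⁻ y, ENNReal.ofReal (min 1 (‖y‖ ^ 2)) ∂η < ⊤)
    (hηlim : ∀ G : Set E, MeasurableSet G → (0 : E) ∉ closure G → η (frontier G) = 0 →
      Tendsto (fun s : ℝ => ν (s • G) / ν {y | s < ‖y‖}) (𝓝[>] 0) (𝓝 (η G)))
    (hV : ∀ t, 0 < t → ν {y | t⁻¹ < ‖y‖} = ENNReal.ofReal (V t))
    (hpos : ∀ t, 0 < t → 0 < V t) {C b s₀ γ : ℝ} (hs₀ : 0 < s₀)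
    (hC : ∀ s, s₀ ≤ s → ∀ l : ℝ, 1 ≤ l → V (l * s) ≤ C * l ^ b * V s)
    (hγ0 : 0 < γ) (hγ : γ ≤ 2) (hbγ : b < γ) (ξ : E) :
    Tendsto (fun s => levyExponent ν (s • ξ) / V s) atTop (𝓝 (levyExponent η ξ)) := by
  have := sigmaFinite_of_lintegral_min_norm_sq hη0 hη
  refine tendsto_of_seq_tendsto fun s hs => ?_
  have hs' : Tendsto (fun n => (s n)⁻¹) atTop (𝓝[>] 0) := tendsto_inv_atTop_nhdsGT_zero.comp hs
  have hlim : ∀ G : Set E, MeasurableSet G → (0 : E) ∉ closure G → η (frontier G) = 0 →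
      Tendsto (fun n => rescaledMeasure ν (s n) G) atTop (𝓝 (η G)) := by
    intro G hG h0 hfr
    refine ((hηlim G hG h0 hfr).comp hs').congr' ?_
    filter_upwards [hs.eventually_gt_atTop 0] with n hn
    exact (rescaledMeasure_apply ν hn hG).symm
  have hopen := measure_le_liminf_of_tendsto_away_from_zero hη0 hlim
  obtain ⟨M, hM, hMs⟩ := exists_lintegral_rescaledMeasure_le hV hpos hs₀ hC hγ0 hbγ
  have hwc : Continuous fun z : E => min ‖z‖ 1 ^ γ :=
    (continuous_norm.min continuous_const).rpow_const fun _ => Or.inr hγ0.le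
  have hw0 : (0 : E → ℝ) ≤ fun z : E => min ‖z‖ 1 ^ γ := fun z =>
    Real.rpow_nonneg (le_min (norm_nonneg _) zero_le_one) _
  have hwfin : ∫⁻ z, ENNReal.ofReal (min ‖z‖ 1 ^ γ) ∂η ≠ ⊤ := by
    refine ne_top_of_le_ne_top (ENNReal.ofReal_ne_top (r := M)) ?_
    refine (lintegral_le_liminf_lintegral_of_forall_isOpen_measure_le_liminf_measure hwc hw0
      hopen).trans ?_
    refine liminf_le_of_frequently_le' (Eventually.frequently ?_)
    filter_upwards [hs.eventually_ge_atTop s₀] with n hn using hMs _ hn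
  have hwlim : Tendsto (fun n => ∫⁻ z, ENNReal.ofReal (min ‖z‖ 1 ^ γ) ∂(rescaledMeasure ν (s n)))
      atTop (𝓝 (∫⁻ z, ENNReal.ofReal (min ‖z‖ 1 ^ γ) ∂η)) := by
    simp_rw [lintegral_min_norm_one_rpow _ hγ0]
    refine ENNReal.Tendsto.const_mul ?_ (Or.inr ENNReal.ofReal_ne_top)
    refine tendsto_lintegral_filter_of_dominated_convergence
      (fun u => ENNReal.ofReal (C * u ^ (γ - 1 - b))) ?_ ?_
      (lintegral_Ioo_rpow_lt_top (by linarith)).ne ?_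
    · refine Eventually.of_forall fun n => Measurable.mul ?_ (by fun_prop)
      refine Antitone.measurable fun u v huv => measure_mono fun y hy => lt_of_le_of_lt huv hy
    · filter_upwards [hs.eventually_ge_atTop s₀] with n hn
      filter_upwards [ae_restrict_mem measurableSet_Ioo] with u hu
      exact rescaledMeasure_mul_le hV hpos hs₀ hC hn hu
    · have hcount := Measure.countable_meas_level_set_pos (μ := η) (measurable_norm (α := E))
      have hae : ∀ᵐ u : ℝ, u ∉ {t : ℝ | 0 < η {a | ‖a‖ = t}} :=
        measure_eq_zero_iff_ae_notMem.1 (hcount.measure_zero _)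
      filter_upwards [ae_restrict_mem measurableSet_Ioo, ae_restrict_of_ae hae] with u hu hu'
      refine ENNReal.Tendsto.mul_const ?_ (Or.inr ENNReal.ofReal_ne_top)
      refine hlim _ (measurableSet_lt measurable_const measurable_norm) ?_ ?_
      · intro hcl
        have h1 : (0 : E) ∈ {y : E | u ≤ ‖y‖} :=
          closure_lt_subset_le continuous_const continuous_norm hcl
        simp only [Set.mem_ofPred_eq, norm_zero] at h1
        linarith [hu.1]
      · refine measure_mono_null (frontier_lt_subset_eq continuous_const continuous_norm) ?_
        simp only [not_lt, nonpos_iff_eq_zero] at hu'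
        simpa only [eq_comm] using hu'
  set D : ℝ := 2 * (1 + ‖ξ‖) ^ γ with hD
  have hn := norm_nonneg ξ
  have hD0 : 0 ≤ D := by positivity
  have hDm : ∀ m : Measure E, ∫⁻ z, ENNReal.ofReal (D * min ‖z‖ 1 ^ γ) ∂m =
      ENNReal.ofReal D * ∫⁻ z, ENNReal.ofReal (min ‖z‖ 1 ^ γ) ∂m := by
    intro m
    rw [← lintegral_const_mul _ (by fun_prop)]
    exact lintegral_congr fun z => ENNReal.ofReal_mul hD0
  have hfc : Continuous fun z : E => 1 - Real.cos ⟪ξ, z⟫ := by fun_prop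
  have key := tendsto_lintegral_of_le_of_isOpen_le_liminf hopen (g := fun z => D * min ‖z‖ 1 ^ γ)
    hfc (continuous_const.mul hwc)
    (fun z => sub_nonneg.2 (Real.cos_le_one _)) (fun z => ?_)
    (by rw [hDm]; exact ENNReal.mul_ne_top ENNReal.ofReal_ne_top hwfin)
    (by simp_rw [hDm]; exact ENNReal.Tendsto.const_mul hwlim (Or.inr ENNReal.ofReal_ne_top))
  · have hreal := (ENNReal.tendsto_toReal (a := ∫⁻ z, ENNReal.ofReal (1 - Real.cos ⟪ξ, z⟫) ∂η)
      ?_).comp key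
    · rw [← integral_eq_lintegral_of_nonneg_ae
        (ae_of_all _ fun y => sub_nonneg.2 (Real.cos_le_one _)) hfc.aestronglyMeasurable] at hreal
      refine hreal.congr' ?_
      filter_upwards [hs.eventually_gt_atTop 0] with n hn
      have hVn := hpos _ hn
      simp only [Function.comp_apply]
      rw [lintegral_one_sub_cos_rescaledMeasure hν hV hpos hn, ENNReal.toReal_ofReal]
      exact div_nonneg (levyExponent_nonneg _ _) hVn.le
    · rw [← ofReal_integral_eq_lintegral_ofReal (integrable_one_sub_cos_inner hη _)
        (ae_of_all _ fun y => sub_nonneg.2 (Real.cos_le_one _))]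
      exact ENNReal.ofReal_ne_top
  · refine (one_sub_cos_inner_le ξ z (s := 1 + ‖ξ‖) (by linarith) hγ0 hγ).trans ?_
    change _ ≤ 2 * (1 + ‖ξ‖) ^ γ * min ‖z‖ 1 ^ γ
    rw [mul_assoc, ← Real.mul_rpow (by positivity) (le_min (norm_nonneg _) zero_le_one)]
    have h0 : (0 : ℝ) ≤ min ((1 + ‖ξ‖) * ‖z‖) 1 := le_min (by positivity) zero_le_one
    gcongr
    rw [mul_min_of_nonneg _ _ (by positivity : 0 ≤ 1 + ‖ξ‖)]
    exact min_le_min_left _ (by linarith)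

end Exponent

section Nondegenerate

variable {E : Type*} [NormedAddCommGroup E] [InnerProductSpace ℝ E] [MeasurableSpace E]
  [BorelSpace E]

lemma levyExponent_pos [FiniteDimensional ℝ E] {η : Measure E}
    (hη : ∫⁻ y, ENNReal.ofReal (min 1 (‖y‖ ^ 2)) ∂η < ⊤) {f : E → ℝ}
    (hf : ∀ ξ : E, ∫ x, Complex.exp (Complex.I * (⟪ξ, x⟫ : ℂ)) * (f x : ℂ) =
      Complex.exp (-(levyExponent η ξ : ℝ))) {θ : E} (hθ : θ ≠ 0) : 0 < levyExponent η θ := by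
  refine (levyExponent_nonneg η θ).lt_of_ne fun h0 => ?_
  have hk : ∀ k : ℕ, levyExponent η ((2 : ℝ) ^ k • θ) = 0 := by
    intro k
    induction k with
    | zero => simpa using h0.symm
    | succ k ih =>
      refine le_antisymm ?_ (levyExponent_nonneg _ _)
      rw [pow_succ, mul_two, add_smul]
      refine (levyExponent_add_le hη _ _).trans ?_
      rw [ih]; norm_num
  have hRL := tendsto_integral_exp_inner_smul_cocompact (fun x : E => (f x : ℂ))
  have hw : Tendsto (fun k : ℕ => (-((2 * Real.pi)⁻¹ * (2 : ℝ) ^ k)) • θ) atTop (cocompact E) := by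
    rw [← Metric.cobounded_eq_cocompact, ← tendsto_norm_atTop_iff_cobounded]
    simp_rw [norm_smul, norm_neg, norm_mul, norm_pow, Real.norm_two]
    refine Tendsto.atTop_mul_const (norm_pos_iff.2 hθ) (Tendsto.const_mul_atTop ?_
      (tendsto_pow_atTop_atTop_of_one_lt one_lt_two))
    exact norm_pos_iff.2 (inv_ne_zero (by positivity))
  have h1 : ∀ k : ℕ, ∫ v, Real.fourierChar (-⟪v, (-((2 * Real.pi)⁻¹ * (2 : ℝ) ^ k)) • θ⟫) •
      (f v : ℂ) = 1 := by
    intro k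
    have := hf ((2 : ℝ) ^ k • θ)
    rw [hk k] at this
    simp only [Complex.ofReal_zero, neg_zero, Complex.exp_zero] at this
    rw [← this]
    refine integral_congr_ae (ae_of_all _ fun v => ?_)
    simp only [Circle.smul_def, Real.fourierChar_apply, smul_eq_mul]
    congr 2
    rw [inner_smul_right, inner_smul_left, real_inner_comm]
    have := Real.pi_pos
    simp only [mul_comm Complex.I]
    congr 1
    norm_cast
    simp only [conj_trivial]
    field_simp
  have := hRL.comp hw
  simp only [Function.comp_def, h1] at this
  exact one_ne_zero (tendsto_nhds_unique tendsto_const_nhds this)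

lemma exists_forall_le_levyExponent [FiniteDimensional ℝ E] {ν η : Measure E} {V : ℝ → ℝ}
    (hν : ∫⁻ y, ENNReal.ofReal (min 1 (‖y‖ ^ 2)) ∂ν < ⊤)
    (hpos : ∀ t, 0 < t → 0 < V t) {α M s₀ : ℝ} (hα : 0 < α)
    (hreg : ∀ l : ℝ, 0 < l → Tendsto (fun s => V (l * s) / V s) atTop (𝓝 (l ^ α)))
    (hup : ∀ s, s₀ ≤ s → ∀ ξ : E, ‖ξ‖ ≤ s → levyExponent ν ξ ≤ M * V s)
    (hlim : ∀ ξ, Tendsto (fun s => levyExponent ν (s • ξ) / V s) atTop (𝓝 (levyExponent η ξ)))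
    (hη : ∀ ξ, ξ ≠ 0 → 0 < levyExponent η ξ) :
    ∃ κ : ℝ, 0 < κ ∧ ∃ s₁ : ℝ, 0 < s₁ ∧ ∀ ξ : E, s₁ ≤ ‖ξ‖ → κ * V ‖ξ‖ ≤ levyExponent ν ξ := by
  have key : ∃ κ : ℝ, 0 < κ ∧ ∀ᶠ s : ℝ in atTop, ∀ θ ∈ Metric.sphere (0 : E) 1,
      κ * V s ≤ levyExponent ν (s • θ) := by
    refine IsCompact.induction_on (p := fun S => ∃ κ : ℝ, 0 < κ ∧ ∀ᶠ s : ℝ in atTop, ∀ θ ∈ S,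
      κ * V s ≤ levyExponent ν (s • θ)) (isCompact_sphere (0 : E) 1) ?_ ?_ ?_ ?_
    · exact ⟨1, one_pos, by simp⟩
    · rintro S T hST ⟨κ, hκ, h⟩
      exact ⟨κ, hκ, h.mono fun s hs θ hθ => hs θ (hST hθ)⟩
    · rintro S T ⟨κ, hκ, h⟩ ⟨κ', hκ', h'⟩
      refine ⟨min κ κ', lt_min hκ hκ', ?_⟩
      filter_upwards [h, h', eventually_gt_atTop 0] with s hs hs' hs0 θ hθ
      have hV := (hpos s hs0).le
      rcases hθ with hθ | hθ
      · exact (mul_le_mul_of_nonneg_right (min_le_left _ _) hV).trans (hs θ hθ)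
      · exact (mul_le_mul_of_nonneg_right (min_le_right _ _) hV).trans (hs' θ hθ)
    · intro θ₀ hθ₀
      have hθ0 : θ₀ ≠ 0 := by
        rintro rfl
        simp at hθ₀
      set a := levyExponent η θ₀ with ha
      have ha0 : 0 < a := hη _ hθ0
      obtain ⟨ε, hε, hεa⟩ : ∃ ε : ℝ, 0 < ε ∧ 2 * M * ε ^ α < a / 4 := by
        have h0 : Tendsto (fun ε : ℝ => 2 * M * ε ^ α) (𝓝[>] 0) (𝓝 (2 * M * 0)) := by
          refine Tendsto.const_mul _ ?_
          have := (Real.continuousAt_rpow_const 0 α (Or.inr hα.le)).tendsto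
          rw [Real.zero_rpow hα.ne'] at this
          exact this.mono_left nhdsWithin_le_nhds
        rw [mul_zero] at h0
        have := (h0.eventually (gt_mem_nhds (by positivity : (0 : ℝ) < a / 4))).and
          self_mem_nhdsWithin
        obtain ⟨ε, h1, h2⟩ := this.exists
        exact ⟨ε, h2, h1⟩
      refine ⟨Metric.ball θ₀ ε, mem_nhdsWithin_of_mem_nhds (Metric.ball_mem_nhds _ hε), a / 8,
        by positivity, ?_⟩
      have e1 : ∀ᶠ s in atTop, a / 2 < levyExponent ν (s • θ₀) / V s :=
        (hlim θ₀).eventually (lt_mem_nhds (by linarith))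
      have e2 : ∀ᶠ s in atTop, 2 * M * (V (ε * s) / V s) < a / 4 :=
        ((hreg ε hε).const_mul (2 * M)).eventually (gt_mem_nhds hεa)
      have e3 : ∀ᶠ s : ℝ in atTop, s₀ ≤ ε * s :=
        (tendsto_id.const_mul_atTop hε).eventually_ge_atTop s₀
      filter_upwards [e1, e2, e3, eventually_gt_atTop 0] with s h1 h2 h3 hs θ hθ
      have hV := hpos s hs
      rw [lt_div_iff₀ hV] at h1
      rw [← mul_div_assoc, div_lt_iff₀ hV] at h2
      have h4 := levyExponent_add_le hν (s • θ) (s • (θ₀ - θ))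
      rw [← smul_add, add_sub_cancel] at h4
      have h5 := hup (ε * s) h3 (s • (θ₀ - θ)) (by
        rw [norm_smul, Real.norm_of_nonneg hs.le, ← dist_eq_norm, dist_comm, mul_comm]
        gcongr
        exact (Metric.mem_ball.1 hθ).le)
      linarith
  obtain ⟨κ, hκ, h⟩ := key
  obtain ⟨s₁, hs₁⟩ := eventually_atTop.1 h
  refine ⟨κ, hκ, max s₁ 1, by positivity, fun ξ hξ => ?_⟩
  have hξ0 : 0 < ‖ξ‖ := one_pos.trans_le ((le_max_right _ _).trans hξ)
  have := hs₁ ‖ξ‖ ((le_max_left _ _).trans hξ) (‖ξ‖⁻¹ • ξ) (by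
    simp [norm_smul, hξ0.ne'])
  rwa [smul_inv_smul₀ hξ0.ne'] at this

end Nondegenerate

section Density

variable {E : Type*} [NormedAddCommGroup E] [InnerProductSpace ℝ E] [FiniteDimensional ℝ E]
  [MeasurableSpace E] [BorelSpace E]

lemma integral_exp_mul_le_integral_norm_charFun {q : Measure E} [IsProbabilityMeasure q]
    (hq : Integrable (charFun q)) (x : E) {ρ : ℝ} (hρ : 0 < ρ) :
    (2 * Real.pi / ρ ^ 2) ^ ((Module.finrank ℝ E : ℝ) / 2) *
      ∫ y, Real.exp (-(‖y - x‖ ^ 2 / (2 * ρ ^ 2))) ∂q ≤ ∫ ξ, ‖charFun q ξ‖ := by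
  set b : ℝ := ρ ^ 2 / 2 with hb
  have hb0 : 0 < b := by positivity
  have hbre : 0 < (b : ℂ).re := by simpa using hb0
  have hin : ∀ y : E, ∫ v : E, Complex.exp (-(b : ℂ) * ‖v‖ ^ 2 + Complex.I * ⟪y - x, v⟫) =
      (((2 * Real.pi / ρ ^ 2) ^ ((Module.finrank ℝ E : ℝ) / 2) *
        Real.exp (-(‖y - x‖ ^ 2 / (2 * ρ ^ 2))) : ℝ) : ℂ) := by
    intro y
    rw [GaussianFourier.integral_cexp_neg_mul_sq_norm_add hbre, Complex.ofReal_mul,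
      Complex.ofReal_cpow (by positivity), Complex.ofReal_exp]
    congr 2
    · push_cast [hb]
      field_simp
    · push_cast
      ring
    · push_cast [hb]
      rw [Complex.I_sq]
      field_simp
      norm_num
  have hinteg : Integrable (Function.uncurry fun (y v : E) =>
      Complex.exp (-(b : ℂ) * ‖v‖ ^ 2 + Complex.I * ⟪y - x, v⟫)) (q.prod volume) := by
    have h1 : Integrable (fun v : E => Complex.exp (-(b : ℂ) * ‖v‖ ^ 2 + 0 * ⟪(0 : E), v⟫)) :=
      GaussianFourier.integrable_cexp_neg_mul_sq_norm_add hbre 0 0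
    refine (h1.comp_snd q).mono (by fun_prop) (ae_of_all _ fun z => le_of_eq ?_)
    simp only [Function.uncurry, Complex.norm_exp]
    simp
  have hswap := integral_integral_swap hinteg
  simp_rw [hin, integral_complex_ofReal, integral_const_mul] at hswap
  have hv : ∀ v : E, ‖∫ y, Complex.exp (-(b : ℂ) * ‖v‖ ^ 2 + Complex.I * ⟪y - x, v⟫) ∂q‖ ≤
      ‖charFun q v‖ := by
    intro v
    have : ∀ y : E, Complex.exp (-(b : ℂ) * ‖v‖ ^ 2 + Complex.I * ⟪y - x, v⟫) =
        Complex.exp (-(b : ℂ) * ‖v‖ ^ 2 - ⟪x, v⟫ * Complex.I) *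
          Complex.exp (⟪y, v⟫ * Complex.I) := by
      intro y
      rw [← Complex.exp_add, inner_sub_left]
      push_cast
      ring_nf
    simp_rw [this]
    rw [integral_const_mul, ← charFun_apply, norm_mul, Complex.norm_exp]
    refine mul_le_of_le_one_left (norm_nonneg _) ?_
    rw [Real.exp_le_one_iff]
    have : (-(b : ℂ) * ‖v‖ ^ 2 - ⟪x, v⟫ * Complex.I).re = -(b * ‖v‖ ^ 2) := by
      simp [← Complex.ofReal_pow]
    rw [this]
    have : 0 ≤ b * ‖v‖ ^ 2 := by positivity
    linarith
  have h0 : 0 ≤ (2 * Real.pi / ρ ^ 2) ^ ((Module.finrank ℝ E : ℝ) / 2) *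
      ∫ y, Real.exp (-(‖y - x‖ ^ 2 / (2 * ρ ^ 2))) ∂q :=
    mul_nonneg (by positivity) (integral_nonneg fun y => (Real.exp_pos _).le)
  rw [← Real.norm_of_nonneg h0, ← Complex.norm_real, hswap]
  refine (norm_integral_le_integral_norm _).trans ?_
  exact integral_mono_of_nonneg (ae_of_all _ fun _ => norm_nonneg _) hq.norm (ae_of_all _ hv)

lemma exists_le_smul_volume_of_integral_norm_charFun_le (E : Type*) [NormedAddCommGroup E]
    [InnerProductSpace ℝ E] [FiniteDimensional ℝ E] [MeasurableSpace E] [BorelSpace E] :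
    ∃ C : ℝ, 0 < C ∧ ∀ q : Measure E, IsProbabilityMeasure q → Integrable (charFun q) →
      ∀ A : ℝ, ∫ ξ, ‖charFun q ξ‖ ≤ A → q ≤ ENNReal.ofReal (C * A) • (volume : Measure E) := by
  set n : ℝ := (Module.finrank ℝ E : ℝ) with hn
  have hball0 : volume (Metric.ball (0 : E) 1) ≠ 0 :=
    (Metric.measure_ball_pos volume (0 : E) one_pos).ne'
  have hballt : volume (Metric.ball (0 : E) 1) ≠ ⊤ := measure_ball_lt_top.ne
  set B := (volume (Metric.ball (0 : E) 1)).toReal with hB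
  have hBpos : 0 < B := ENNReal.toReal_pos hball0 hballt
  refine ⟨Real.exp (1 / 2) / ((2 * Real.pi) ^ (n / 2) * B), by positivity,
    fun q hq hinteg A hA => ?_⟩
  have hA0 : 0 ≤ A := (integral_nonneg fun _ => norm_nonneg _).trans hA
  set C := Real.exp (1 / 2) / ((2 * Real.pi) ^ (n / 2) * B) with hC
  have hcb : ∀ x : E, ∀ ρ : ℝ, 0 < ρ → q (Metric.closedBall x ρ) ≤
      (ENNReal.ofReal (C * A) • (volume : Measure E)) (Metric.closedBall x ρ) := by
    intro x ρ hρ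
    have h1 := (integral_exp_mul_le_integral_norm_charFun hinteg x hρ).trans hA
    have hexpint : Integrable (fun y => Real.exp (-(‖y - x‖ ^ 2 / (2 * ρ ^ 2)))) q := by
      refine Integrable.of_bound (by fun_prop) 1 (ae_of_all _ fun y => ?_)
      rw [Real.norm_of_nonneg (Real.exp_pos _).le, Real.exp_le_one_iff]
      have : 0 ≤ ‖y - x‖ ^ 2 / (2 * ρ ^ 2) := by positivity
      linarith
    have h2 : q.real (Metric.closedBall x ρ) * Real.exp (-(1 / 2)) ≤
        ∫ y, Real.exp (-(‖y - x‖ ^ 2 / (2 * ρ ^ 2))) ∂q := by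
      rw [← smul_eq_mul, ← setIntegral_const]
      refine le_trans ?_ (setIntegral_le_integral (s := Metric.closedBall x ρ) hexpint
        (ae_of_all _ fun y => (Real.exp_pos _).le))
      refine setIntegral_mono_on (integrable_const _).integrableOn hexpint.integrableOn
        Metric.isClosed_closedBall.measurableSet fun y hy => ?_
      refine Real.exp_le_exp.2 (neg_le_neg ?_)
      rw [div_le_iff₀ (by positivity)]
      have := mem_closedBall_iff_norm.1 hy
      have := pow_le_pow_left₀ (norm_nonneg _) this 2
      linarith
    rw [Measure.smul_apply, smul_eq_mul, Measure.addHaar_closedBall volume _ hρ.le,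
      ← ENNReal.ofReal_toReal hballt, ← hB, ← ENNReal.ofReal_mul (by positivity),
      ← ENNReal.ofReal_mul (by positivity), ← ENNReal.ofReal_toReal (measure_ne_top q _)]
    refine ENNReal.ofReal_le_ofReal ?_
    change q.real _ ≤ _
    have hK : (2 * Real.pi / ρ ^ 2) ^ (n / 2) = (2 * Real.pi) ^ (n / 2) / ρ ^ Module.finrank ℝ E := by
      rw [Real.div_rpow (by positivity) (by positivity), ← Real.rpow_natCast ρ 2,
        ← Real.rpow_mul hρ.le, ← Real.rpow_natCast, ← hn]
      congr 2
      push_cast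
      ring
    rw [hK] at h1
    have h3 : (2 * Real.pi) ^ (n / 2) / ρ ^ Module.finrank ℝ E *
        (q.real (Metric.closedBall x ρ) * Real.exp (-(1 / 2))) ≤ A :=
      (mul_le_mul_of_nonneg_left h2 (by positivity)).trans h1
    rw [Real.exp_neg] at h3
    have hP : (0 : ℝ) < (2 * Real.pi) ^ (n / 2) := by positivity
    have hR : (0 : ℝ) < ρ ^ Module.finrank ℝ E := by positivity
    have hX := Real.exp_pos (1 / 2)
    have h4 : q.real (Metric.closedBall x ρ) ≤
        A * (Real.exp (1 / 2) * ρ ^ Module.finrank ℝ E / (2 * Real.pi) ^ (n / 2)) := by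
      rw [← div_le_iff₀ (by positivity)]
      refine le_of_eq_of_le ?_ h3
      field_simp
    refine h4.trans (le_of_eq ?_)
    rw [hC]
    field_simp
  have : IsLocallyFiniteMeasure (ENNReal.ofReal (C * A) • (volume : Measure E)) :=
    inferInstanceAs (IsLocallyFiniteMeasure ((C * A).toNNReal • (volume : Measure E)))
  refine Measure.le_iff'.2 fun s => ?_
  refine (Besicovitch.vitaliFamily q).measure_le_of_frequently_le _ Measure.AbsolutelyContinuous.rfl
    s fun x _ => ?_
  refine (Besicovitch.tendsto_filterAt q x).frequently (Eventually.frequently ?_)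
  filter_upwards [self_mem_nhdsWithin] with ρ hρ using hcb x ρ hρ

end Density

section Tail

variable {E : Type*} [NormedAddCommGroup E] [MeasurableSpace E] [BorelSpace E]

lemma exists_lintegral_min_norm_rpow_le {a γ K : ℝ} (hγ : 0 < γ) (hγa : γ < a) :
    ∃ M : ℝ, 0 < M ∧ ∀ q : Measure E, IsProbabilityMeasure q → ∀ R : ℝ, 0 ≤ R →
      (∀ u, 1 ≤ u → u < R → q {x | u < ‖x‖} ≤ ENNReal.ofReal (K * u ^ (-a))) →
      ∫⁻ x, ENNReal.ofReal (min ‖x‖ R ^ γ) ∂q ≤ ENNReal.ofReal M := by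
  have h0 : ∫⁻ u in Set.Ioo (0 : ℝ) 1, ENNReal.ofReal (1 * u ^ (γ - 1)) < ⊤ :=
    lintegral_Ioo_rpow_lt_top (by linarith)
  have h1 : ∫⁻ u in Set.Ici (1 : ℝ), ENNReal.ofReal (K * u ^ (γ - 1 - a)) < ⊤ := by
    have h := (integrableOn_Ioi_rpow_of_lt (a := γ - 1 - a) (by linarith) one_pos).const_mul K
    rw [setLIntegral_congr Ioi_ae_eq_Ici.symm]
    exact h.lintegral_lt_top
  set I := ENNReal.ofReal γ * ((∫⁻ u in Set.Ioo (0 : ℝ) 1, ENNReal.ofReal (1 * u ^ (γ - 1))) +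
    ∫⁻ u in Set.Ici (1 : ℝ), ENNReal.ofReal (K * u ^ (γ - 1 - a))) with hI
  have hIt : I ≠ ⊤ := ENNReal.mul_ne_top ENNReal.ofReal_ne_top (ENNReal.add_ne_top.2 ⟨h0.ne, h1.ne⟩)
  refine ⟨I.toReal + 1, by positivity, fun q hq R hR hu => ?_⟩
  have hIle : I ≤ ENNReal.ofReal (I.toReal + 1) := by
    rw [← ENNReal.ofReal_toReal hIt]
    refine ENNReal.ofReal_le_ofReal ?_
    rw [ENNReal.toReal_ofReal ENNReal.toReal_nonneg]
    linarith
  refine le_trans ?_ hIle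
  rw [lintegral_rpow_eq_lintegral_meas_lt_mul q (f := fun x => min ‖x‖ R)
    (ae_of_all _ fun x => le_min (norm_nonneg _) hR) (by fun_prop) hγ]
  refine mul_le_mul_right ?_ _
  have hsplit : Set.Ioi (0 : ℝ) = Set.Ioo 0 1 ∪ Set.Ici 1 := by
    rw [Set.Ioo_union_Ici_eq_Ioi zero_lt_one]
  rw [hsplit, lintegral_union measurableSet_Ici (by
    rw [Set.disjoint_left]; intro x hx hx'; exact absurd hx.2 (not_lt.2 hx'))]
  refine add_le_add (setLIntegral_mono' measurableSet_Ioo fun u _ => ?_)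
    (setLIntegral_mono' measurableSet_Ici fun u hu1 => ?_)
  · rw [one_mul]
    exact mul_le_of_le_one_left zero_le prob_le_one
  · have hu1' : (1 : ℝ) ≤ u := hu1
    have hu0 : 0 < u := one_pos.trans_le hu1'
    rcases lt_or_ge u R with huR | huR
    · calc _ ≤ ENNReal.ofReal (K * u ^ (-a)) * ENNReal.ofReal (u ^ (γ - 1)) := by
            gcongr
            refine le_trans (measure_mono fun x hx => ?_) (hu u hu1' huR)
            exact lt_of_lt_of_le (Set.mem_ofPred_eq ▸ hx) (min_le_left _ _)
        _ = _ := by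
          rw [← ENNReal.ofReal_mul' (by positivity), mul_assoc, ← Real.rpow_add hu0]
          ring_nf
    · have : {x : E | u < min ‖x‖ R} = ∅ := by
        ext x
        simp only [Set.mem_ofPred_eq, Set.mem_empty_iff_false, iff_false, not_lt]
        exact (min_le_right _ _).trans huR
      rw [this]
      simp

variable [InnerProductSpace ℝ E] [FiniteDimensional ℝ E]

lemma integrable_exp_neg_mul_norm {k : ℝ} (hk : 0 < k) :
    Integrable (fun ξ : E => Real.exp (-(k * ‖ξ‖))) := by
  set N := Module.finrank ℝ E + 1 with hN
  have h1 : Integrable (fun ξ : E => (1 + ‖ξ‖) ^ (-(N : ℝ))) :=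
    integrable_one_add_norm (by rw [hN]; push_cast; linarith)
  refine (h1.const_mul (Real.exp k * N.factorial / k ^ N)).mono' (by fun_prop)
    (ae_of_all _ fun ξ => ?_)
  have hn := norm_nonneg ξ
  have h2 := Real.pow_div_factorial_le_exp (k * (1 + ‖ξ‖)) (by positivity) N
  rw [Real.norm_of_nonneg (Real.exp_pos _).le, Real.rpow_neg (by positivity), Real.rpow_natCast,
    show -(k * ‖ξ‖) = k - k * (1 + ‖ξ‖) by ring, Real.exp_sub, div_eq_mul_inv, mul_div_assoc,
    mul_assoc]
  refine mul_le_mul_of_nonneg_left ?_ (Real.exp_pos _).le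
  have hf : (0 : ℝ) < N.factorial := by positivity
  refine (inv_anti₀ (by positivity) h2).trans (le_of_eq ?_)
  rw [mul_pow]
  field_simp

lemma measure_lt_norm_le_of_norm_one_sub_charFun_le {q : Measure E} [IsProbabilityMeasure q]
    {B R : ℝ} (hR : 0 < R)
    (hB : ∀ ξ : E, ‖ξ‖ ≤ 2 * (Module.finrank ℝ E + 1) / R → ‖1 - charFun q ξ‖ ≤ B) :
    q {x | R < ‖x‖} ≤ ENNReal.ofReal (2 * Module.finrank ℝ E * B) := by
  set n := Module.finrank ℝ E with hn
  set e := stdOrthonormalBasis ℝ E with he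
  set ρ : ℝ := R / (n + 1) with hρ
  have hρ0 : 0 < ρ := by positivity
  have hB0 : 0 ≤ B := (norm_nonneg _).trans (hB 0 (by rw [norm_zero]; positivity))
  have h1 : ∀ i, q {x | ρ < |⟪e i, x⟫|} ≤ ENNReal.ofReal (2 * B) := by
    intro i
    rw [← ENNReal.ofReal_toReal (measure_ne_top q _)]
    refine ENNReal.ofReal_le_ofReal ?_
    refine (measureReal_abs_inner_gt_le_integral_charFun (a := e i) hρ0).trans ?_
    have h2 : ‖∫ t in (-2 * ρ⁻¹)..(2 * ρ⁻¹), 1 - charFun q (t • e i)‖ ≤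
        B * |2 * ρ⁻¹ - -2 * ρ⁻¹| := by
      refine intervalIntegral.norm_integral_le_of_norm_le_const fun t ht => hB _ ?_
      rw [norm_smul, e.orthonormal.1 i, mul_one, Real.norm_eq_abs]
      have h3 : 2 * (n + 1 : ℝ) / R = 2 * ρ⁻¹ := by
        rw [hρ]; field_simp
      rw [h3]
      have h4 : (0 : ℝ) < ρ⁻¹ := by positivity
      rw [Set.uIoc_of_le (by linarith)] at ht
      exact abs_le.2 ⟨by linarith [ht.1], ht.2⟩
    have h5 : |2 * ρ⁻¹ - -2 * ρ⁻¹| = 4 * ρ⁻¹ := by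
      rw [show 2 * ρ⁻¹ - -2 * ρ⁻¹ = 4 * ρ⁻¹ by ring, abs_of_pos (by positivity)]
    rw [h5] at h2
    calc _ ≤ 2⁻¹ * ρ * (B * (4 * ρ⁻¹)) := by gcongr
      _ = 2 * B := by field_simp; ring
  have hsub : {x : E | R < ‖x‖} ⊆ ⋃ i, {x | ρ < |⟪e i, x⟫|} := by
    intro x hx
    by_contra hcon
    simp only [Set.mem_iUnion, Set.mem_ofPred_eq, not_exists, not_lt] at hcon hx
    have h6 : ‖x‖ ≤ n * ρ := by
      calc ‖x‖ = ‖∑ i, ⟪e i, x⟫ • e i‖ := by rw [e.sum_repr']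
        _ ≤ ∑ i, ‖⟪e i, x⟫ • e i‖ := norm_sum_le _ _
        _ ≤ ∑ _i : Fin n, ρ := by
          refine Finset.sum_le_sum fun i _ => ?_
          rw [norm_smul, e.orthonormal.1 i, mul_one]
          exact hcon i
        _ = n * ρ := by simp
    have h7 : (n + 1 : ℝ) * ρ = R := by rw [hρ]; field_simp
    nlinarith
  refine (measure_mono hsub).trans ((measure_iUnion_fintype_le q _).trans ?_)
  refine (Finset.sum_le_sum fun i _ => h1 i).trans (le_of_eq ?_)
  rw [Finset.sum_const, Finset.card_univ, Fintype.card_fin, nsmul_eq_mul, mul_right_comm,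
    ENNReal.ofReal_mul' (Nat.cast_nonneg n), ENNReal.ofReal_natCast, mul_comm]

lemma tendsto_integral_of_le_of_forall_hasCompactSupport {m q : Measure E}
    [IsLocallyFiniteMeasure m] {Q : ℕ → Measure E}
    (hQ : ∀ g : E → ℝ, Continuous g → HasCompactSupport g →
      Tendsto (fun n => ∫ x, g x ∂(Q n)) atTop (𝓝 (∫ x, g x ∂q)))
    (hQm : ∀ᶠ n in atTop, Q n ≤ m) (hqm : q ≤ m) {f : E → ℝ} (hf : Integrable f m) :
    Tendsto (fun n => ∫ x, f x ∂(Q n)) atTop (𝓝 (∫ x, f x ∂q)) := by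
  have key : ∀ g : E → ℝ, Integrable g m → ∀ q' : Measure E, q' ≤ m →
      |∫ x, f x ∂q' - ∫ x, g x ∂q'| ≤ ∫ x, ‖f x - g x‖ ∂m := by
    intro g hg q' hq'
    rw [← integral_sub (hf.mono_measure hq') (hg.mono_measure hq'), ← Real.norm_eq_abs]
    refine (norm_integral_le_integral_norm _).trans ?_
    exact integral_mono_measure hq' (ae_of_all _ fun _ => norm_nonneg _) (hf.sub hg).norm
  rw [Metric.tendsto_atTop']
  intro ε hε
  obtain ⟨g, hgc, hgε, hgcont, hgint⟩ :=
    hf.exists_hasCompactSupport_integral_sub_le (by positivity : 0 < ε / 4)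
  obtain ⟨N, hN⟩ := eventually_atTop.1 (hQm.and
    ((hQ g hgcont hgc).eventually (Metric.ball_mem_nhds _ (by positivity : 0 < ε / 4))))
  refine ⟨N, fun n hn => ?_⟩
  obtain ⟨h1, h2⟩ := hN n hn.le
  have h3 := key g hgint _ h1
  have h4 := key g hgint _ hqm
  rw [Real.dist_eq] at h2
  rw [Real.dist_eq]
  rw [abs_le] at h3 h4
  rw [abs_lt] at h2 ⊢
  constructor <;> linarith

end Tail

section Limit

lemma integrable_and_abs_setIntegral_compl_le {Ω : Type*} [MeasurableSpace Ω] {q : Measure Ω}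
    [IsFiniteMeasure q] {h w : Ω → ℝ}
    {β γ L M ρ : ℝ} (hβ : 0 ≤ β) (hβγ : β ≤ γ) (hL : 0 ≤ L) (hM : 0 ≤ M) (hρ : 0 < ρ)
    (hhm : Measurable h) (hwm : Measurable w) (hw : 0 ≤ w) (hhw : ∀ x, |h x| ≤ L * w x ^ β)
    (hwM : ∫⁻ x, ENNReal.ofReal (w x ^ γ) ∂q ≤ ENNReal.ofReal M) {S : Set Ω}
    (hS : MeasurableSet S) (hSw : ∀ x ∉ S, ρ ≤ w x) :
    Integrable h q ∧ |∫ x in Sᶜ, h x ∂q| ≤ L * ρ ^ (β - γ) * M := by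
  have hw0 : ∀ x, 0 ≤ w x ^ γ := fun x => Real.rpow_nonneg (hw x) _
  have hwint : Integrable (fun x => w x ^ γ) q := by
    refine ⟨(hwm.pow_const γ).aestronglyMeasurable, ?_⟩
    rw [hasFiniteIntegral_iff_ofReal (ae_of_all _ hw0)]
    exact hwM.trans_lt ENNReal.ofReal_lt_top
  have hwM' : ∫ x, w x ^ γ ∂q ≤ M := by
    rw [integral_eq_lintegral_of_nonneg_ae (ae_of_all _ hw0) hwint.1]
    exact ENNReal.toReal_le_of_le_ofReal hM hwM
  have hinteg : Integrable h q := by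
    refine (((integrable_const (1 : ℝ)).add hwint).const_mul L).mono' hhm.aestronglyMeasurable
      (ae_of_all _ fun x => (hhw x).trans (mul_le_mul_of_nonneg_left ?_ hL))
    change w x ^ β ≤ 1 + w x ^ γ
    rcases le_total (w x) 1 with h1 | h1
    · have := Real.rpow_le_one (hw x) h1 hβ
      linarith [hw0 x]
    · have := Real.rpow_le_rpow_of_exponent_le h1 hβγ
      linarith
  refine ⟨hinteg, ?_⟩
  calc |∫ x in Sᶜ, h x ∂q| ≤ ∫ x in Sᶜ, |h x| ∂q := abs_integral_le_integral_abs
    _ ≤ ∫ x in Sᶜ, L * ρ ^ (β - γ) * w x ^ γ ∂q := by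
      refine setIntegral_mono_on hinteg.abs.integrableOn (hwint.const_mul _).integrableOn hS.compl
        fun x hx => (hhw x).trans ?_
      have h1 := hSw x hx
      have h2 : 0 < w x := hρ.trans_le h1
      rw [mul_assoc]
      refine mul_le_mul_of_nonneg_left ?_ hL
      calc w x ^ β = w x ^ (β - γ) * w x ^ γ := by rw [← Real.rpow_add h2]; ring_nf
        _ ≤ ρ ^ (β - γ) * w x ^ γ := mul_le_mul_of_nonneg_right
          (Real.rpow_le_rpow_of_nonpos hρ h1 (by linarith)) (hw0 x)
    _ ≤ ∫ x, L * ρ ^ (β - γ) * w x ^ γ ∂q :=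
      setIntegral_le_integral (hwint.const_mul _) (ae_of_all _ fun x =>
        mul_nonneg (mul_nonneg hL (Real.rpow_nonneg hρ.le _)) (hw0 x))
    _ ≤ L * ρ ^ (β - γ) * M := by
      rw [integral_const_mul]
      exact mul_le_mul_of_nonneg_left hwM' (mul_nonneg hL (Real.rpow_nonneg hρ.le _))

variable {E : Type*} [NormedAddCommGroup E] [MeasurableSpace E] [BorelSpace E]

lemma integrable_indicator_ball_of_forall_abs_le [ProperSpace E] {m : Measure E}
    [IsLocallyFiniteMeasure m] {f : E → ℝ} (hf : Measurable f) {ρ K : ℝ}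
    (hK : ∀ x ∈ Metric.ball (0 : E) ρ, |f x| ≤ K) :
    Integrable ((Metric.ball (0 : E) ρ).indicator f) m := by
  rw [integrable_indicator_iff measurableSet_ball]
  refine Measure.integrableOn_of_bounded (M := K) measure_ball_lt_top.ne
    hf.aestronglyMeasurable ?_
  filter_upwards [ae_restrict_mem measurableSet_ball] with x hx using hK x hx

variable [ProperSpace E] {m q : Measure E} [IsLocallyFiniteMeasure m] [IsFiniteMeasure q]
  {Q : ℕ → Measure E} {R : ℕ → ℝ} {γ M : ℝ}

lemma lintegral_norm_rpow_le_of_tendsto_integral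
    (hQf : ∀ n, IsFiniteMeasure (Q n))
    (hQ : ∀ f : E → ℝ, Integrable f m →
      Tendsto (fun n => ∫ x, f x ∂(Q n)) atTop (𝓝 (∫ x, f x ∂q)))
    (hR : Tendsto R atTop atTop) (hγ : 0 < γ) (hM : 0 ≤ M)
    (hQM : ∀ᶠ n in atTop, ∫⁻ x, ENNReal.ofReal (min ‖x‖ (R n) ^ γ) ∂(Q n) ≤ ENNReal.ofReal M) :
    ∫⁻ x, ENNReal.ofReal (‖x‖ ^ γ) ∂q ≤ ENNReal.ofReal M := by
  have hfm : Measurable fun x : E => ‖x‖ ^ γ := by fun_prop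
  have hball : ∀ k : ℕ, ∫⁻ x in Metric.ball (0 : E) k, ENNReal.ofReal (‖x‖ ^ γ) ∂q ≤
      ENNReal.ofReal M := by
    intro k
    have hbd : ∀ x ∈ Metric.ball (0 : E) k, |‖x‖ ^ γ| ≤ (k : ℝ) ^ γ := by
      intro x hx
      rw [abs_of_nonneg (by positivity)]
      exact Real.rpow_le_rpow (norm_nonneg _) (mem_ball_zero_iff.1 hx).le hγ.le
    have hinteg : ∀ m' : Measure E, IsLocallyFiniteMeasure m' →
        Integrable ((Metric.ball (0 : E) k).indicator fun x : E => ‖x‖ ^ γ) m' := fun m' _ =>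
      integrable_indicator_ball_of_forall_abs_le hfm hbd
    have hof : ∀ m' : Measure E, IsLocallyFiniteMeasure m' →
        ENNReal.ofReal (∫ x, (Metric.ball (0 : E) k).indicator (fun x : E => ‖x‖ ^ γ) x ∂m') =
          ∫⁻ x in Metric.ball (0 : E) k, ENNReal.ofReal (‖x‖ ^ γ) ∂m' := by
      intro m' hm'
      rw [integral_indicator measurableSet_ball, ofReal_integral_eq_lintegral_ofReal
        ((integrable_indicator_iff measurableSet_ball).1 (hinteg m' hm'))
        (ae_of_all _ fun x => by positivity)]
    rw [← hof q inferInstance]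
    refine ENNReal.ofReal_le_ofReal (le_of_tendsto (hQ _ (hinteg m inferInstance)) ?_)
    filter_upwards [hQM, hR.eventually_ge_atTop k] with n hn hRn
    have := hQf n
    rw [← ENNReal.ofReal_le_ofReal_iff hM, hof (Q n) inferInstance]
    refine le_trans ?_ ((setLIntegral_le_lintegral (Metric.ball (0 : E) k) _).trans hn)
    refine setLIntegral_mono' measurableSet_ball fun x hx => le_of_eq ?_
    rw [min_eq_left ((mem_ball_zero_iff.1 hx).le.trans hRn)]
  have hU : (⋃ k : ℕ, Metric.ball (0 : E) k) = Set.univ := Metric.iUnion_ball_nat 0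
  rw [← setLIntegral_univ, ← hU, setLIntegral_iUnion_of_directed]
  · exact iSup_le hball
  · exact (monotone_nat_of_le_succ fun k => Metric.ball_subset_ball (by simp)).directed_le

lemma tendsto_integral_of_uniform_on_balls {β L : ℝ}
    (hQf : ∀ n, IsProbabilityMeasure (Q n))
    (hQ : ∀ f : E → ℝ, Integrable f m →
      Tendsto (fun n => ∫ x, f x ∂(Q n)) atTop (𝓝 (∫ x, f x ∂q)))
    (hR : Tendsto R atTop atTop) (hβ : 0 ≤ β) (hβγ : β < γ) (hM : 0 ≤ M)
    (hL : 0 ≤ L)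
    (hQM : ∀ᶠ n in atTop, ∫⁻ x, ENNReal.ofReal (min ‖x‖ (R n) ^ γ) ∂(Q n) ≤ ENNReal.ofReal M)
    {H : ℕ → E → ℝ} {h : E → ℝ} (hHm : ∀ n, Measurable (H n)) (hhm : Measurable h)
    (hH : ∀ᶠ n in atTop, ∀ x, |H n x| ≤ L * min ‖x‖ (R n) ^ β) (hh : ∀ x, |h x| ≤ L * ‖x‖ ^ β)
    (hHh : ∀ ρ ε : ℝ, 0 < ε → ∀ᶠ n in atTop, ∀ x ∈ Metric.ball (0 : E) ρ, |H n x - h x| ≤ ε) :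
    Tendsto (fun n => ∫ x, H n x ∂(Q n)) atTop (𝓝 (∫ x, h x ∂q)) := by
  have hqM := lintegral_norm_rpow_le_of_tendsto_integral (fun n => inferInstance) hQ hR
    (hβ.trans_lt hβγ) hM hQM
  rw [Metric.tendsto_atTop']
  intro ε hε
  obtain ⟨ρ, hρ, hρε⟩ : ∃ ρ : ℝ, 0 < ρ ∧ L * ρ ^ (β - γ) * M < ε / 5 := by
    have h0 : Tendsto (fun ρ : ℝ => L * ρ ^ (β - γ) * M) atTop (𝓝 (L * 0 * M)) := by
      have := tendsto_rpow_neg_atTop (sub_pos.2 hβγ)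
      rw [neg_sub] at this
      exact (this.const_mul L).mul_const M
    rw [mul_zero, zero_mul] at h0
    obtain ⟨ρ, h1, h2⟩ := ((h0.eventually (gt_mem_nhds (by positivity : 0 < ε / 5))).and
      (eventually_gt_atTop 0)).exists
    exact ⟨ρ, h2, h1⟩
  set S := Metric.ball (0 : E) ρ with hS
  have hSm : MeasurableSet S := measurableSet_ball
  have hSout : ∀ x ∉ S, ρ ≤ ‖x‖ := fun x hx => not_lt.1 fun hlt => hx (mem_ball_zero_iff.2 hlt)
  have hSh : ∀ x ∈ S, |h x| ≤ L * ρ ^ β := fun x hx => (hh x).trans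
    (mul_le_mul_of_nonneg_left (Real.rpow_le_rpow (norm_nonneg _) (mem_ball_zero_iff.1 hx).le hβ) hL)
  have hSind : ∀ m' : Measure E, IsLocallyFiniteMeasure m' → Integrable (S.indicator h) m' :=
    fun m' _ => integrable_indicator_ball_of_forall_abs_le hhm hSh
  obtain ⟨hqint, hqtail⟩ := integrable_and_abs_setIntegral_compl_le hβ hβγ.le hL hM hρ hhm
    measurable_norm (fun x => norm_nonneg x) hh hqM hSm hSout
  have hconv := (hQ _ (hSind m inferInstance)).eventually
    (Metric.ball_mem_nhds _ (by positivity : 0 < ε / 5))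
  have hev := hconv.and (hQM.and (hH.and ((hHh ρ (ε / 5) (by positivity)).and
    (hR.eventually_ge_atTop ρ))))
  obtain ⟨N, hN⟩ := eventually_atTop.1 hev
  refine ⟨N, fun n hn => ?_⟩
  obtain ⟨h1, h2, h3, h4, h5⟩ := hN n hn.le
  have := hQf n
  obtain ⟨hnint, hntail⟩ := integrable_and_abs_setIntegral_compl_le (q := Q n) hβ hβγ.le hL hM hρ
    (hHm n) (measurable_norm.min measurable_const)
    (fun x => le_min (norm_nonneg x) (hρ.le.trans h5)) h3 h2 hSm (fun x hx => le_min (hSout x hx) h5)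
  have hdiff : |∫ x in S, H n x ∂(Q n) - ∫ x in S, h x ∂(Q n)| ≤ ε / 5 := by
    have hi := (integrable_indicator_iff hSm).1 (hSind (Q n) inferInstance)
    rw [← integral_sub hnint.integrableOn hi, ← Real.norm_eq_abs]
    refine (norm_setIntegral_le_of_norm_le_const (measure_lt_top _ _) fun x hx => h4 x hx).trans ?_
    exact mul_le_of_le_one_right (by positivity) measureReal_le_one
  rw [integral_indicator hSm, integral_indicator hSm, Real.dist_eq] at h1
  rw [Real.dist_eq, ← integral_add_compl hSm hnint, ← integral_add_compl hSm hqint]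
  rw [abs_le] at hntail hqtail hdiff
  rw [abs_lt] at h1 ⊢
  constructor <;> linarith

end Limit

section ScaledLaw

variable {E : Type*} [NormedAddCommGroup E] [InnerProductSpace ℝ E] [FiniteDimensional ℝ E]
  [MeasurableSpace E] [BorelSpace E]

lemma integral_norm_charFun_le_of_mul_norm_le {q : Measure E} [IsProbabilityMeasure q]
    {φ : E → ℝ} {k : ℝ} (hk : 0 < k)
    (hq : ∀ ξ, charFun q ξ = Complex.exp (-(φ ξ : ℝ))) (hφ0 : ∀ ξ, 0 ≤ φ ξ)
    (hφ : ∀ ξ, 1 ≤ ‖ξ‖ → k * ‖ξ‖ ≤ φ ξ) :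
    Integrable (charFun q) ∧
      ∫ ξ, ‖charFun q ξ‖ ≤ Real.exp k * ∫ ξ : E, Real.exp (-(k * ‖ξ‖)) := by
  have hbd : ∀ ξ, ‖charFun q ξ‖ ≤ Real.exp k * Real.exp (-(k * ‖ξ‖)) := by
    intro ξ
    rw [hq, Complex.norm_exp, Complex.neg_re, Complex.ofReal_re, ← Real.exp_add]
    refine Real.exp_le_exp.2 ?_
    rcases le_total 1 ‖ξ‖ with h | h
    · linarith [hφ ξ h]
    · nlinarith [hφ0 ξ]
  have hi := (integrable_exp_neg_mul_norm (E := E) hk).const_mul (Real.exp k)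
  refine ⟨hi.mono' measurable_charFun.aestronglyMeasurable (ae_of_all _ hbd), ?_⟩
  rw [← integral_const_mul]
  exact integral_mono_of_nonneg (ae_of_all _ fun _ => norm_nonneg _) hi (ae_of_all _ hbd)

lemma exists_bounds_scaled_law {ψ : E → ℝ} {V : ℝ → ℝ} (hψ0 : ∀ ξ, 0 ≤ ψ ξ)
    (hpos : ∀ t, 0 < t → 0 < V t) {κ s₁ D s₂ C s₃ a γ : ℝ} (hκ : 0 < κ) (hs₁ : 0 < s₁)
    (hlow : ∀ ξ : E, s₁ ≤ ‖ξ‖ → κ * V ‖ξ‖ ≤ ψ ξ) (hD : 0 < D) (hs₂ : 0 < s₂)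
    (hup : ∀ s, s₂ ≤ s → ∀ ξ : E, ‖ξ‖ ≤ s → ψ ξ ≤ D * V s) (hC : 0 < C) (hs₃ : 0 < s₃)
    (hpot : ∀ s, s₃ ≤ s → ∀ l : ℝ, 1 ≤ l → l ^ a * V s ≤ C * V (l * s)) (ha : 1 ≤ a)
    (hγ : 0 < γ) (hγa : γ < a) :
    ∃ A k₀ M c₀ : ℝ, 0 < k₀ ∧ 0 < M ∧ ∀ c t : ℝ, c₀ ≤ c → 0 < t → 1 / 2 ≤ t * V c → t * V c ≤ 2 →
      ∀ q : Measure E, IsProbabilityMeasure q →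
      (∀ ξ, charFun q ξ = Complex.exp (-(t * ψ (c • ξ) : ℝ))) →
      Integrable (charFun q) ∧ ∫ ξ, ‖charFun q ξ‖ ≤ A ∧
        ∫⁻ x, ENNReal.ofReal (min ‖x‖ (k₀ * c) ^ γ) ∂q ≤ ENNReal.ofReal M := by
  set n : ℝ := (Module.finrank ℝ E : ℝ) with hn
  have hn0 : 0 ≤ n := Nat.cast_nonneg _
  set N : ℝ := 2 * (n + 1) with hN
  have hN0 : 0 < N := by positivity
  set k : ℝ := κ / (2 * C) with hk
  have hk0 : 0 < k := by positivity
  set K : ℝ := (2 * n * (2 * D * C) + 1) * N ^ a with hK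
  obtain ⟨M, hM, hMq⟩ := exists_lintegral_min_norm_rpow_le (E := E) (K := K) hγ hγa
  refine ⟨Real.exp k * ∫ ξ : E, Real.exp (-(k * ‖ξ‖)), N / (s₂ + s₃), M, s₁ + s₃,
    by positivity, hM, fun c t hc ht htV htV2 q hq hqc => ?_⟩
  have hc0 : 0 < c := by linarith
  have hVc := hpos c hc0
  have h1 := integral_norm_charFun_le_of_mul_norm_le (φ := fun ξ => t * ψ (c • ξ)) hk0 hqc
    (fun ξ => mul_nonneg ht.le (hψ0 _)) fun ξ hξ => by
      have hcξ : ‖c • ξ‖ = ‖ξ‖ * c := by rw [norm_smul, Real.norm_of_nonneg hc0.le, mul_comm]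
      have h2 := hlow (c • ξ) (by rw [hcξ]; nlinarith)
      have h3 := hpot c (by linarith) ‖ξ‖ hξ
      have h4 : ‖ξ‖ ≤ ‖ξ‖ ^ a := Real.self_le_rpow_of_one_le hξ ha
      rw [hcξ] at h2
      have h5 : ‖ξ‖ * V c ≤ C * V (‖ξ‖ * c) :=
        (mul_le_mul_of_nonneg_right h4 hVc.le).trans h3
      have h6 : κ / C * (‖ξ‖ * V c) ≤ ψ (c • ξ) := by
        refine le_trans ?_ h2
        rw [div_mul_eq_mul_div, div_le_iff₀ hC, mul_assoc, mul_comm _ C]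
        exact mul_le_mul_of_nonneg_left h5 hκ.le
      calc k * ‖ξ‖ = κ / C * ‖ξ‖ * (1 / 2) := by rw [hk]; field_simp
        _ ≤ κ / C * ‖ξ‖ * (t * V c) := by gcongr
        _ = t * (κ / C * (‖ξ‖ * V c)) := by ring
        _ ≤ t * ψ (c • ξ) := by gcongr
  refine ⟨h1.1, h1.2, hMq q hq _ (by positivity) fun u hu1 hu2 => ?_⟩
  have hu0 : 0 < u := one_pos.trans_le hu1
  have hNu : K * u ^ (-a) = (2 * n * (2 * D * C) + 1) * (N / u) ^ a := by
    rw [hK, Real.div_rpow hN0.le hu0.le, Real.rpow_neg hu0.le]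
    ring
  rw [hNu]
  rcases le_total u N with huN | huN
  · refine prob_le_one.trans ?_
    rw [← ENNReal.ofReal_one]
    refine ENNReal.ofReal_le_ofReal ?_
    have h7 : 1 ≤ (N / u) ^ a :=
      Real.one_le_rpow (by rwa [le_div_iff₀ hu0, one_mul]) (by linarith)
    have h8 : 0 ≤ 2 * n * (2 * D * C) := by positivity
    nlinarith
  · set s : ℝ := N * c / u with hs
    have hs0 : 0 < s := by positivity
    have hs23 : s₂ + s₃ ≤ s := by
      rw [hs, le_div_iff₀ hu0]
      rw [div_mul_eq_mul_div, lt_div_iff₀ (by positivity)] at hu2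
      linarith
    have h9 := hpot s (by linarith) (u / N) (by rwa [le_div_iff₀ hN0, one_mul])
    rw [show u / N * s = c by rw [hs]; field_simp] at h9
    have hr0 : 0 < (u / N) ^ a := by positivity
    have h10 : V s ≤ C * V c * (N / u) ^ a := by
      rw [← inv_div, Real.inv_rpow (by positivity), ← div_eq_mul_inv, le_div_iff₀ hr0]
      linarith
    have h11 := measure_lt_norm_le_of_norm_one_sub_charFun_le (q := q) (R := u)
      (B := t * (D * V s)) hu0 fun ξ hξ => by
        have hx : 0 ≤ t * ψ (c • ξ) := mul_nonneg ht.le (hψ0 _)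
        have hle : t * ψ (c • ξ) ≤ t * (D * V s) := by
          refine mul_le_mul_of_nonneg_left (hup s (by linarith) _ ?_) ht.le
          rw [norm_smul, Real.norm_of_nonneg hc0.le, hs, mul_comm, mul_div_right_comm]
          exact mul_le_mul_of_nonneg_right hξ hc0.le
        refine le_trans ?_ hle
        rw [hqc, ← Complex.ofReal_neg, ← Complex.ofReal_exp, ← Complex.ofReal_one,
          ← Complex.ofReal_sub, Complex.norm_real, Real.norm_of_nonneg]
        · linarith [Real.add_one_le_exp (-(t * ψ (c • ξ)))]
        · rw [sub_nonneg, Real.exp_le_one_iff]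
          linarith
    refine h11.trans (ENNReal.ofReal_le_ofReal ?_)
    have h12 : 0 ≤ (N / u) ^ a := by positivity
    have h13 : t * (D * V s) ≤ 2 * D * C * (N / u) ^ a := by
      calc t * (D * V s) ≤ t * (D * (C * V c * (N / u) ^ a)) := by gcongr
        _ = (t * V c) * (D * C * (N / u) ^ a) := by ring
        _ ≤ 2 * (D * C * (N / u) ^ a) := by gcongr
        _ = _ := by ring
    have h14 := mul_le_mul_of_nonneg_left h13 (by positivity : 0 ≤ 2 * n)
    linarith

lemma isLocallyFiniteMeasure_add {Ω : Type*} [TopologicalSpace Ω] [MeasurableSpace Ω]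
    (m q : Measure Ω) [IsLocallyFiniteMeasure m] [IsFiniteMeasure q] :
    IsLocallyFiniteMeasure (m + q) := by
  refine ⟨fun x => ?_⟩
  obtain ⟨s, hs, hms⟩ := m.finiteAt_nhds x
  exact ⟨s, hs, by
    rw [Measure.add_apply]
    exact ENNReal.add_lt_top.2 ⟨hms, measure_lt_top _ _⟩⟩

lemma tendsto_integral_of_tendsto_charFun {q : Measure E} [IsProbabilityMeasure q]
    {Q : ℕ → Measure E} (hQ : ∀ n, IsProbabilityMeasure (Q n)) {A : ℝ}
    (hinteg : ∀ᶠ n in atTop, Integrable (charFun (Q n)) ∧ ∫ ξ, ‖charFun (Q n) ξ‖ ≤ A)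
    (hlim : ∀ ξ, Tendsto (fun n => charFun (Q n) ξ) atTop (𝓝 (charFun q ξ))) :
    ∃ m : Measure E, IsLocallyFiniteMeasure m ∧ ∀ f : E → ℝ, Integrable f m →
      Tendsto (fun n => ∫ x, f x ∂(Q n)) atTop (𝓝 (∫ x, f x ∂q)) := by
  obtain ⟨C, hC, hCq⟩ := exists_le_smul_volume_of_integral_norm_charFun_le E
  have hl : IsLocallyFiniteMeasure (ENNReal.ofReal (C * A) • (volume : Measure E)) :=
    inferInstanceAs (IsLocallyFiniteMeasure ((C * A).toNNReal • (volume : Measure E)))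
  have hl' := isLocallyFiniteMeasure_add (ENNReal.ofReal (C * A) • (volume : Measure E)) q
  refine ⟨_, hl', fun f hf => tendsto_integral_of_le_of_forall_hasCompactSupport ?_ ?_
    (Measure.le_add_left le_rfl) hf⟩
  · intro g hg hgc
    have hweak : Tendsto (β := ProbabilityMeasure E) (fun n => ⟨Q n, hQ n⟩) atTop
        (𝓝 ⟨q, inferInstance⟩) :=
      ProbabilityMeasure.tendsto_iff_tendsto_charFun.2 hlim
    obtain ⟨B, hB⟩ := hgc.exists_bound_of_continuous hg
    exact ProbabilityMeasure.tendsto_iff_forall_integral_tendsto.1 hweak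
      (BoundedContinuousFunction.ofNormedAddCommGroup g hg B hB)
  · filter_upwards [hinteg] with n hn
    exact Measure.le_add_right (hCq _ (hQ n) hn.1 A hn.2)

end ScaledLaw

section HeatContent

variable {E : Type*} [NormedAddCommGroup E] [InnerProductSpace ℝ E]

lemma eventually_abs_rpow_mul_sub_le {w Rβ : E → ℝ} {β : ℝ} (hβ : 0 < β) (hw : w 0 = 0)
    (hRβ : ∀ ε : ℝ, 0 < ε → ∃ δ : ℝ, 0 < δ ∧ ∀ t : ℝ, 0 < t → t < δ →
      ∀ θ : E, ‖θ‖ = 1 → |w (t • θ) / t ^ β - Rβ θ| ≤ ε) (ρ : ℝ) {ε : ℝ} (hε : 0 < ε) :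
    ∀ᶠ c : ℝ in atTop, ∀ x ∈ Metric.ball (0 : E) ρ,
      |c ^ β * w (c⁻¹ • x) - Rβ (‖x‖⁻¹ • x) * ‖x‖ ^ β| ≤ ε := by
  have hρβ : 0 ≤ |ρ| ^ β := by positivity
  obtain ⟨δ, hδ, h⟩ := hRβ (ε / (|ρ| ^ β + 1)) (by positivity)
  filter_upwards [eventually_gt_atTop 0, eventually_gt_atTop (ρ / δ)] with c hc hcρ x hx
  rcases eq_or_ne x 0 with rfl | hx0
  · simp [hw, Real.zero_rpow hβ.ne', hε.le]
  have hn : 0 < ‖x‖ := norm_pos_iff.2 hx0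
  have hxρ : ‖x‖ < ρ := mem_ball_zero_iff.1 hx
  rw [div_lt_iff₀ hδ] at hcρ
  have h1 := h (‖x‖ / c) (by positivity) (by rw [div_lt_iff₀ hc]; linarith) (‖x‖⁻¹ • x)
    (by simp [norm_smul, hn.ne'])
  have h2 : (‖x‖ / c) • ‖x‖⁻¹ • x = c⁻¹ • x := by
    rw [smul_smul]
    congr 1
    field_simp
  rw [h2, Real.div_rpow hn.le hc.le] at h1
  have hnβ : 0 < ‖x‖ ^ β := by positivity
  have hcβ : 0 < c ^ β := by positivity
  have h3 : c ^ β * w (c⁻¹ • x) - Rβ (‖x‖⁻¹ • x) * ‖x‖ ^ β =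
      (w (c⁻¹ • x) / (‖x‖ ^ β / c ^ β) - Rβ (‖x‖⁻¹ • x)) * ‖x‖ ^ β := by
    field_simp
  rw [h3, abs_mul, abs_of_pos hnβ]
  have h4 : ‖x‖ ^ β ≤ |ρ| ^ β :=
    Real.rpow_le_rpow hn.le (hxρ.le.trans (le_abs_self ρ)) hβ.le
  calc _ ≤ ε / (|ρ| ^ β + 1) * ‖x‖ ^ β := by gcongr
    _ ≤ ε / (|ρ| ^ β + 1) * (|ρ| ^ β + 1) := by gcongr; linarith
    _ = ε := by field_simp

lemma rpow_mul_abs_le_mul_min_rpow {w : E → ℝ} {β L W k₀ c : ℝ} (hL : 0 ≤ L)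
    (hW : 0 ≤ W) (hk₀ : 0 < k₀) (hc : 0 < c) (hwL : ∀ x, |w x| ≤ L * ‖x‖ ^ β)
    (hwW : ∀ x, |w x| ≤ W) (x : E) :
    |c ^ β * w (c⁻¹ • x)| ≤ (L + W / k₀ ^ β) * min ‖x‖ (k₀ * c) ^ β := by
  have hcβ : 0 < c ^ β := by positivity
  have hkβ : 0 < k₀ ^ β := by positivity
  rw [abs_mul, abs_of_pos hcβ]
  rcases le_total ‖x‖ (k₀ * c) with h | h
  · rw [min_eq_left h]
    have h1 := hwL (c⁻¹ • x)
    rw [norm_smul, norm_inv, Real.norm_of_nonneg hc.le, Real.mul_rpow (by positivity)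
      (norm_nonneg _), Real.inv_rpow hc.le] at h1
    have h2 : 0 ≤ ‖x‖ ^ β := by positivity
    have h3 : 0 ≤ W / k₀ ^ β := by positivity
    calc c ^ β * |w (c⁻¹ • x)| ≤ c ^ β * (L * ((c ^ β)⁻¹ * ‖x‖ ^ β)) := by gcongr
      _ = L * ‖x‖ ^ β := by field_simp
      _ ≤ (L + W / k₀ ^ β) * ‖x‖ ^ β := by gcongr; linarith
  · rw [min_eq_right h, Real.mul_rpow hk₀.le hc.le]
    calc c ^ β * |w (c⁻¹ • x)| ≤ c ^ β * W := by gcongr; exact hwW _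
      _ = W / k₀ ^ β * (k₀ ^ β * c ^ β) := by field_simp
      _ ≤ (L + W / k₀ ^ β) * (k₀ ^ β * c ^ β) := by gcongr; linarith

variable [MeasurableSpace E] [BorelSpace E] [FiniteDimensional ℝ E]

lemma integral_sub_eq_half_integral_second_difference {p : Measure E} [IsProbabilityMeasure p]
    {φ : E → ℝ} (hφ : ∀ ξ, φ (-ξ) = φ ξ)
    (hp : ∀ ξ, charFun p ξ = Complex.exp (-(φ ξ : ℝ))) {r : E → ℝ} (hr : Integrable r p) :
    ∫ y, r y ∂p - r 0 = 1 / 2 * ∫ y, (r y + r (-y) - 2 * r 0) ∂p := by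
  have hsym : p.map (fun y => -y) = p := by
    have : IsProbabilityMeasure (p.map (fun y => -y)) :=
      Measure.isProbabilityMeasure_map (by fun_prop)
    refine Measure.ext_of_charFun (funext fun ξ => ?_)
    have h1 : (fun y : E => -y) = fun y => (-1 : ℝ) • y := by simp
    rw [h1, charFun_map_smul, hp, hp, neg_one_smul, hφ]
  have hmp : MeasurePreserving (fun y : E => -y) p p := ⟨by fun_prop, hsym⟩
  have hneg : ∫ y, r (-y) ∂p = ∫ y, r y ∂p :=
    hmp.integral_comp (MeasurableEquiv.neg E).measurableEmbedding r
  have hrn : Integrable (fun y => r (-y)) p := hmp.integrable_comp_of_integrable hr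
  have hadd : Integrable (fun y => r y + r (-y)) p := hr.add hrn
  rw [integral_sub hadd (integrable_const _), integral_add hr hrn, hneg, integral_const]
  simp
  ring

lemma withDensity_isProbabilityMeasure_and_charFun {f : E → ℝ} (hf0 : ∀ x, 0 ≤ f x)
    (hf : Integrable f) {φ : E → ℝ} (hφ0 : φ 0 = 0)
    (hF : ∀ ξ : E, ∫ x, Complex.exp (Complex.I * (⟪ξ, x⟫ : ℂ)) * (f x : ℂ) =
      Complex.exp (-(φ ξ : ℝ))) :
    IsProbabilityMeasure (volume.withDensity fun x => ENNReal.ofReal (f x)) ∧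
      ∀ ξ, charFun (volume.withDensity fun x => ENNReal.ofReal (f x)) ξ =
        Complex.exp (-(φ ξ : ℝ)) := by
  constructor
  · constructor
    rw [withDensity_apply _ MeasurableSet.univ, setLIntegral_univ,
      ← ofReal_integral_eq_lintegral_ofReal hf (ae_of_all _ hf0)]
    have h := hF 0
    simp only [inner_zero_left, Complex.ofReal_zero, mul_zero, Complex.exp_zero, one_mul, hφ0,
      neg_zero, integral_complex_ofReal] at h
    have h' : ∫ x, f x = 1 := by exact_mod_cast h
    rw [h', ENNReal.ofReal_one]
  · intro ξ
    rw [charFun_apply, integral_withDensity_eq_integral_toReal_smul₀ hf.1.aemeasurable.ennreal_ofReal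
      (ae_of_all _ fun _ => ENNReal.ofReal_lt_top), ← hF]
    refine integral_congr_ae (ae_of_all _ fun x => ?_)
    simp only [ENNReal.toReal_ofReal (hf0 x), real_inner_comm, Complex.real_smul]
    rw [mul_comm, mul_comm Complex.I]

end HeatContent

/-- Theorem 3 of the paper: asymptotics of the generalized heat content for a
symmetric pure-jump Lévy process whose Lévy measure is multivariate regularly
varying at the origin, with limit measure η:
[V⁻(1/t)]^β (H_g^μ(t) − H_g^μ(0)) → (1/2)∫ R_β(x/‖x‖)‖x‖^β p_η(x) dx. -/
theorem heat_content_regularly_varying_levy_measure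
    (d : ℕ) (hd : 1 ≤ d) (β : ℝ) (hβ1 : 1 ≤ β) (hβ2 : β < 2)
    -- ν is a symmetric Lévy measure
    (ν : Measure (EuclideanSpace ℝ (Fin d)))
    (hν0 : ν {0} = 0)
    (hνlevy : ∫⁻ y, ENNReal.ofReal (min 1 (‖y‖ ^ 2)) ∂ν < ⊤)
    (hνsym : ν.map (fun y => -y) = ν)
    -- the characteristic exponent of the process with triplet (0, 0, ν)
    (ψ : EuclideanSpace ℝ (Fin d) → ℝ)
    (hψ : ∀ ξ, ψ ξ = ∫ y, (1 - Real.cos ⟪ξ, y⟫) ∂ν)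
    -- (p t) are the marginal laws of the process
    (p : ℝ → Measure (EuclideanSpace ℝ (Fin d)))
    (hp : ∀ t, 0 ≤ t → IsProbabilityMeasure (p t))
    (hchar : ∀ t, 0 ≤ t → ∀ ξ,
      ∫ x, Complex.exp (Complex.I * (⟪ξ, x⟫ : ℂ)) ∂(p t)
        = Complex.exp (-(t * ψ ξ : ℝ)))
    -- (a): V(t) = ν({‖y‖ > 1/t}) is regularly varying of index α ∈ (β, 2)
    (α : ℝ) (hαβ : β < α) (hα2 : α < 2)
    (V : ℝ → ℝ)
    (hV : ∀ t : ℝ, V t = (ν {y : EuclideanSpace ℝ (Fin d) | 1 / t < ‖y‖}).toReal)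
    (hVpos : ∀ t : ℝ, 0 < t → 0 < V t)
    (hVreg : ∀ l : ℝ, 0 < l →
      Tendsto (fun s => V (l * s) / V s) atTop (𝓝 (l ^ α)))
    -- the generalized inverse V⁻
    (Vinv : ℝ → ℝ) (hVinv : ∀ u, Vinv u = sInf {x : ℝ | 0 ≤ x ∧ u ≤ V x})
    -- (b): there is a nonzero limit measure η on ℝ^d \ {0}
    (η : Measure (EuclideanSpace ℝ (Fin d)))
    (hη0 : η {0} = 0) (hηne : η ≠ 0)
    (hηlevy : ∫⁻ y, ENNReal.ofReal (min 1 (‖y‖ ^ 2)) ∂η < ⊤)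
    (hηlim : ∀ G : Set (EuclideanSpace ℝ (Fin d)), MeasurableSet G →
      (0 : EuclideanSpace ℝ (Fin d)) ∉ closure G → η (frontier G) = 0 →
      Tendsto (fun s : ℝ => ν (s • G) / ν {y | s < ‖y‖}) (𝓝[>] 0) (𝓝 (η G)))
    -- g bounded Borel, μ a finite Borel measure, r = g ∗ μ̌
    (g : EuclideanSpace ℝ (Fin d) → ℝ) (hgm : Measurable g)
    (Cg : ℝ) (hgbd : ∀ x, |g x| ≤ Cg)
    (μ : Measure (EuclideanSpace ℝ (Fin d))) (hμ : IsFiniteMeasure μ)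
    (r : EuclideanSpace ℝ (Fin d) → ℝ)
    (hr : ∀ x, r x = ∫ y, g (x + y) ∂μ)
    -- uniform directional second-difference limits R_β on the sphere
    (Rβ : EuclideanSpace ℝ (Fin d) → ℝ)
    (hRβ : ∀ ε : ℝ, 0 < ε → ∃ δ : ℝ, 0 < δ ∧ ∀ t : ℝ, 0 < t → t < δ →
      ∀ θ : EuclideanSpace ℝ (Fin d), ‖θ‖ = 1 →
        |(r (t • θ) + r (-(t • θ)) - 2 * r 0) / t ^ β - Rβ θ| ≤ ε)
    (L : ℝ) (hL : 0 < L)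
    (hrH : ∀ x : EuclideanSpace ℝ (Fin d),
      |r x + r (-x) - 2 * r 0| ≤ L * ‖x‖ ^ β)
    -- p_η : the α-stable density determined by η
    (pη : EuclideanSpace ℝ (Fin d) → ℝ)
    (hpη0 : ∀ x, 0 ≤ pη x) (hpηint : Integrable pη)
    (hpηfourier : ∀ ξ : EuclideanSpace ℝ (Fin d),
      ∫ x, Complex.exp (Complex.I * (⟪ξ, x⟫ : ℂ)) * (pη x : ℂ)
        = Complex.exp (-(∫ y, (1 - Real.cos ⟪ξ, y⟫) ∂η : ℝ))) :
    Tendsto (fun t : ℝ => (Vinv (1 / t)) ^ β * ((∫ y, r y ∂(p t)) - r 0))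
      (𝓝[>] 0)
      (𝓝 ((1 / 2) * ∫ x, Rβ (‖x‖⁻¹ • x) * ‖x‖ ^ β * pη x)) := by
  have : Nonempty (Fin d) := ⟨⟨0, hd⟩⟩
  have hβ0 : 0 < β := one_pos.trans_le hβ1
  have hα0 : 0 < α := hβ0.trans hαβ
  -- rewriting the hypotheses on the Lévy measure
  have hV' : ∀ t : ℝ, 0 < t →
      ν {y : EuclideanSpace ℝ (Fin d) | t⁻¹ < ‖y‖} = ENNReal.ofReal (V t) := by
    intro t ht
    have h1 := hVpos t ht
    rw [hV t, one_div] at h1 ⊢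
    rw [ENNReal.ofReal_toReal]
    intro htop
    rw [htop] at h1
    simp at h1
  have hmono : ∀ s t : ℝ, 0 < s → s ≤ t → V s ≤ V t := by
    intro s t hs hst
    have ht := hs.trans_le hst
    rw [← ENNReal.ofReal_le_ofReal_iff (hVpos t ht).le, ← hV' s hs, ← hV' t ht]
    exact measure_mono fun y hy => (inv_anti₀ hs hst).trans_lt hy
  have hreg2 := hVreg 2 two_pos
  have htop := tendsto_atTop_of_tendsto_div hVpos hmono hα0 hreg2
  have hψν : ∀ ξ, ψ ξ = levyExponent ν ξ := hψ
  have hψ0 : ∀ ξ, 0 ≤ ψ ξ := fun ξ => by rw [hψν]; exact levyExponent_nonneg _ _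
  -- Potter bounds
  obtain ⟨a, hβa, haα⟩ := exists_between hαβ
  obtain ⟨γ, hβγ, hγa⟩ := exists_between hβa
  obtain ⟨b, hαb, hb2⟩ := exists_between hα2
  obtain ⟨C, -, s₂, hs₂, hup⟩ := exists_forall_le_mul_rpow_of_tendsto_div hVpos hmono hα0 hreg2 hαb
  obtain ⟨C', hC', s₃, hs₃, hpot⟩ := exists_forall_mul_rpow_le_of_tendsto_div hVpos hmono
    (hβ0.trans hβa) hreg2 haα
  obtain ⟨M, hM, hMs⟩ := exists_lintegral_rescaledMeasure_le hV' hVpos hs₂ hup two_pos hb2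
  have hψup : ∀ s, s₂ ≤ s → ∀ ξ : EuclideanSpace ℝ (Fin d), ‖ξ‖ ≤ s →
      levyExponent ν ξ ≤ 2 * M * V s := fun s hs ξ hξ =>
    levyExponent_le_of_lintegral_le hνlevy hV' hVpos two_pos le_rfl hM.le (hs₂.trans_le hs)
      (hMs s hs) hξ
  have hψlim := fun ξ => tendsto_levyExponent_div hη0 hνlevy hηlevy hηlim hV' hVpos hs₂ hup two_pos
    le_rfl hb2 ξ
  have hηpos := fun (θ : EuclideanSpace ℝ (Fin d)) (hθ : θ ≠ 0) =>
    levyExponent_pos hηlevy hpηfourier hθ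
  obtain ⟨κ, hκ, s₁, hs₁, hψlow⟩ := exists_forall_le_levyExponent hνlevy hVpos hα0 hVreg hψup
    hψlim hηpos
  have hψfun : ψ = levyExponent ν := funext hψν
  obtain ⟨A, k₀, M', c₀, hk₀, hM', hbounds⟩ := exists_bounds_scaled_law hψ0 hVpos hκ hs₁
    (by rwa [hψfun]) (by positivity : 0 < 2 * M) hs₂ (by rwa [hψfun]) hC' hs₃ hpot
    (hβ1.trans hβa.le) (hβ0.trans hβγ) hγa
  -- the limit law
  obtain ⟨hqprob, hqchar⟩ := withDensity_isProbabilityMeasure_and_charFun hpη0 hpηint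
    (φ := levyExponent η) (by simp [levyExponent]) hpηfourier
  set q : Measure (EuclideanSpace ℝ (Fin d)) :=
    volume.withDensity fun x => ENNReal.ofReal (pη x) with hq
  -- the second difference of `r`
  have hrm : Measurable r := by
    have h1 : StronglyMeasurable (Function.uncurry fun x y : EuclideanSpace ℝ (Fin d) =>
        g (x + y)) := (hgm.comp measurable_add).stronglyMeasurable
    have h2 : r = fun x => ∫ y, g (x + y) ∂μ := funext hr
    rw [h2]
    exact h1.integral_prod_right.measurable
  have hrbd : ∀ x, |r x| ≤ Cg * μ.real Set.univ := fun x => by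
    rw [hr, ← Real.norm_eq_abs]
    exact norm_integral_le_of_norm_le_const (ae_of_all _ fun y => hgbd _)
  set B : ℝ := Cg * μ.real Set.univ with hB
  have hB0 : 0 ≤ B := (abs_nonneg _).trans (hrbd 0)
  set w : EuclideanSpace ℝ (Fin d) → ℝ := fun x => r x + r (-x) - 2 * r 0 with hw
  have hwm : Measurable w := by
    rw [hw]
    fun_prop
  have hwW : ∀ x, |w x| ≤ 4 * B := fun x => by
    have h1 := abs_le.1 (hrbd x)
    have h2 := abs_le.1 (hrbd (-x))
    have h3 := abs_le.1 (hrbd 0)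
    rw [abs_le]
    constructor <;> linarith
  have hw0 : w 0 = 0 := by
    simp only [hw, neg_zero]
    ring
  have hunif := fun (ρ ε : ℝ) (hε : 0 < ε) => eventually_abs_rpow_mul_sub_le hβ0 hw0 hRβ ρ hε
  set h : EuclideanSpace ℝ (Fin d) → ℝ := fun x => Rβ (‖x‖⁻¹ • x) * ‖x‖ ^ β with hh
  -- passing to sequences
  have hcinf := tendsto_generalizedInverse_inv hVinv hmono htop
  have htVc := tendsto_mul_comp_generalizedInverse hVinv hVpos hmono htop hVreg
  refine tendsto_of_seq_tendsto fun t ht => ?_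
  have htpos : ∀ᶠ n in atTop, 0 < t n := ht self_mem_nhdsWithin
  obtain ⟨N, hN⟩ := eventually_atTop.1
    (htpos.and ((hcinf.comp ht).eventually_gt_atTop 0))
  rw [← tendsto_add_atTop_iff_nat N]
  replace ht := (tendsto_add_atTop_iff_nat N).2 ht
  set τ : ℕ → ℝ := fun n => t (n + N) with hτ
  have hτ0 : ∀ n, 0 < τ n := fun n => (hN _ (Nat.le_add_left _ _)).1
  set c : ℕ → ℝ := fun n => Vinv (1 / τ n) with hc
  have hc0 : ∀ n, 0 < c n := fun n => (hN _ (Nat.le_add_left _ _)).2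
  have hclim : Tendsto c atTop atTop := hcinf.comp ht
  have hτV : Tendsto (fun n => τ n * V (c n)) atTop (𝓝 1) := htVc.comp ht
  have hpprob : ∀ n, IsProbabilityMeasure (p (τ n)) := fun n => hp _ (hτ0 n).le
  have hpchar : ∀ n ξ, charFun (p (τ n)) ξ = Complex.exp (-(τ n * ψ ξ : ℝ)) := by
    intro n ξ
    rw [charFun_apply, ← hchar _ (hτ0 n).le]
    refine integral_congr_ae (ae_of_all _ fun x => ?_)
    simp only [real_inner_comm, mul_comm]
  set Q : ℕ → Measure (EuclideanSpace ℝ (Fin d)) :=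
    fun n => (p (τ n)).map (fun y => c n • y) with hQ
  have hQprob : ∀ n, IsProbabilityMeasure (Q n) := fun n =>
    Measure.isProbabilityMeasure_map (by fun_prop)
  have hQchar : ∀ n ξ, charFun (Q n) ξ = Complex.exp (-(τ n * ψ (c n • ξ) : ℝ)) := by
    intro n ξ
    rw [hQ, charFun_map_smul, hpchar]
  have hQbounds : ∀ᶠ n in atTop, Integrable (charFun (Q n)) ∧ ∫ ξ, ‖charFun (Q n) ξ‖ ≤ A ∧
      ∫⁻ x, ENNReal.ofReal (min ‖x‖ (k₀ * c n) ^ γ) ∂(Q n) ≤ ENNReal.ofReal M' := by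
    filter_upwards [hclim.eventually_ge_atTop c₀,
      hτV.eventually (lt_mem_nhds (by norm_num : (1 / 2 : ℝ) < 1)),
      hτV.eventually (gt_mem_nhds (by norm_num : (1 : ℝ) < 2))] with n h1 h2 h3
    exact hbounds (c n) (τ n) h1 (hτ0 n) h2.le h3.le (Q n) (hQprob n) (hQchar n)
  have hQlim : ∀ ξ, Tendsto (fun n => charFun (Q n) ξ) atTop (𝓝 (charFun q ξ)) := by
    intro ξ
    simp_rw [hQchar, hqchar]
    have h1 : Tendsto (fun n => τ n * ψ (c n • ξ)) atTop (𝓝 (levyExponent η ξ)) := by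
      have h2 := hτV.mul ((hψlim ξ).comp hclim)
      rw [one_mul] at h2
      refine h2.congr fun n => ?_
      have h3 := hVpos _ (hc0 n)
      simp only [Function.comp_apply, hψν]
      field_simp
    exact (Complex.continuous_exp.tendsto _).comp
      ((Complex.continuous_ofReal.tendsto _).comp h1).neg
  obtain ⟨m, hm, hset⟩ := tendsto_integral_of_tendsto_charFun hQprob
    (hQbounds.mono fun n hn => ⟨hn.1, hn.2.1⟩) hQlim
  -- the rescaled second differences
  set H : ℕ → EuclideanSpace ℝ (Fin d) → ℝ := fun n x => c n ^ β * w ((c n)⁻¹ • x) with hH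
  have hHm : ∀ n, Measurable (H n) := fun n =>
    (hwm.comp (measurable_const_smul (c n)⁻¹)).const_mul _
  have hHh : ∀ ρ ε : ℝ, 0 < ε → ∀ᶠ n in atTop,
      ∀ x ∈ Metric.ball (0 : EuclideanSpace ℝ (Fin d)) ρ, |H n x - h x| ≤ ε := fun ρ ε hε =>
    hclim.eventually (hunif ρ ε hε)
  have hHpt : ∀ x, Tendsto (fun n => H n x) atTop (𝓝 (h x)) := by
    intro x
    rw [Metric.tendsto_nhds]
    intro ε hε
    filter_upwards [hHh (‖x‖ + 1) (ε / 2) (by positivity)] with n hn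
    rw [Real.dist_eq]
    linarith [hn x (by simp)]
  have hhm : Measurable h := measurable_of_tendsto_metrizable hHm (tendsto_pi_nhds.2 hHpt)
  have hHL : ∀ n x, |H n x| ≤ L * ‖x‖ ^ β := by
    intro n x
    have h1 := hrH ((c n)⁻¹ • x)
    have h2 : 0 < c n ^ β := Real.rpow_pos_of_pos (hc0 n) _
    rw [norm_smul, norm_inv, Real.norm_of_nonneg (hc0 n).le,
      Real.mul_rpow (inv_nonneg.2 (hc0 n).le) (norm_nonneg _), Real.inv_rpow (hc0 n).le] at h1
    simp only [hH, abs_mul, abs_of_pos h2]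
    calc c n ^ β * |w ((c n)⁻¹ • x)| ≤ c n ^ β * (L * ((c n ^ β)⁻¹ * ‖x‖ ^ β)) :=
          mul_le_mul_of_nonneg_left h1 h2.le
      _ = L * ‖x‖ ^ β := by field_simp
  have hhL : ∀ x, |h x| ≤ L * ‖x‖ ^ β := fun x =>
    le_of_tendsto (hHpt x).abs (Eventually.of_forall fun n => hHL n x)
  have hL' : 0 ≤ 4 * B / k₀ ^ β := by positivity
  have hmain := tendsto_integral_of_uniform_on_balls (L := L + 4 * B / k₀ ^ β) hQprob hset
    (hclim.const_mul_atTop hk₀) hβ0.le hβγ hM'.le (by positivity)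
    (hQbounds.mono fun n hn => hn.2.2) hHm hhm
    (Eventually.of_forall fun n x => rpow_mul_abs_le_mul_min_rpow hL.le (by positivity) hk₀
      (hc0 n) hrH hwW x)
    (fun x => (hhL x).trans (mul_le_mul_of_nonneg_right (by linarith) (by positivity))) hHh
  have hlimit : ∫ x, h x ∂q = ∫ x, Rβ (‖x‖⁻¹ • x) * ‖x‖ ^ β * pη x := by
    rw [hq, integral_withDensity_eq_integral_toReal_smul₀ hpηint.1.aemeasurable.ennreal_ofReal
      (ae_of_all _ fun _ => ENNReal.ofReal_lt_top)]
    refine integral_congr_ae (ae_of_all _ fun x => ?_)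
    simp only [ENNReal.toReal_ofReal (hpη0 x), smul_eq_mul, hh]
    ring
  rw [← hlimit]
  refine (hmain.const_mul (1 / 2)).congr fun n => ?_
  have hprob := hpprob n
  have hrint : Integrable r (p (τ n)) :=
    Integrable.of_bound hrm.aestronglyMeasurable B (ae_of_all _ hrbd)
  have hhalf := integral_sub_eq_half_integral_second_difference
    (φ := fun ξ => τ n * ψ ξ) (fun ξ => by simp only [hψν, levyExponent_neg]) (hpchar n) hrint
  have hmap : ∫ x, H n x ∂(Q n) = c n ^ β * ∫ y, w y ∂(p (τ n)) := by
    rw [hQ, integral_map (by fun_prop) (hHm n).aestronglyMeasurable, ← integral_const_mul]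
    refine integral_congr_ae (ae_of_all _ fun y => ?_)
    simp only [hH, inv_smul_smul₀ (hc0 n).ne']
  change 1 / 2 * ∫ x, H n x ∂(Q n) = c n ^ β * (∫ y, r y ∂(p (τ n)) - r 0)
  rw [hhalf, hmap]
  ring
end

section
/- Let d ≥ 1 and let ν be a symmetric Lévy measure on ℝ^d with ψ(ξ) = ∫ (1 − cos⟨ξ,y⟩) ν(dy). Assume: (a) V(t) := ν({y : ‖y‖ > 1/t}) is regularly varying at infinity of index α ∈ (0, 2); (b) there is a Borel measure η on ℝ^d \ {0} with ∫ min(1, ‖y‖²) η(dy) < ∞ such that for every Borel set G ⊂ ℝ^d whose closure does not contain 0 and with η(∂G) = 0, lim_{s→0+} ν(sG)/ν({y : ‖y‖ > s}) = η(G). Then for every ξ ∈ ℝ^d, lim_{t→0+} t · ψ(V^−(1/t) ξ) = ∫_{ℝ^d} (1 − cos⟨ξ,y⟩) η(dy); in particular the rescaled laws of V^−(1/t)·X_t converge weakly, as t → 0+, to the symmetric α-stable law whose characteristic function is e^{−∫(1−cos⟨ξ,y⟩)η(dy)}. -/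
open MeasureTheory Filter
open scoped Topology RealInnerProductSpace ENNReal Pointwise

/-- A positive, monotone, regularly varying function of positive index tends to infinity. -/
theorem tendsto_atTop_of_regularlyVarying {V : ℝ → ℝ} {α : ℝ} (hα : 0 < α)
    (hmono : MonotoneOn V (Set.Ioi 0)) (hpos : ∀ t, 0 < t → 0 < V t)
    (hreg : ∀ l : ℝ, 0 < l → Tendsto (fun s => V (l * s) / V s) atTop (𝓝 (l ^ α))) :
    Tendsto V atTop atTop := by
  obtain ⟨q, hq1, hq2⟩ := exists_between (Real.one_lt_rpow (one_lt_two) hα)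
  obtain ⟨s, hs⟩ := eventually_atTop.1
    (((hreg 2 two_pos).eventually (lt_mem_nhds hq2)).and (eventually_gt_atTop 0))
  have hs0 : 0 < s := (hs s le_rfl).2
  have hgrow : ∀ n : ℕ, q ^ n * V s ≤ V (2 ^ n * s) := by
    intro n
    induction n with
    | zero => simp
    | succ n ih =>
      have h2 : s ≤ 2 ^ n * s := le_mul_of_one_le_left hs0.le (one_le_pow₀ one_le_two)
      have h3 := (lt_div_iff₀ (hpos _ (hs0.trans_le h2))).1 (hs _ h2).1
      calc q ^ (n + 1) * V s = q * (q ^ n * V s) := by ring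
        _ ≤ q * V (2 ^ n * s) := by gcongr
        _ ≤ V (2 * (2 ^ n * s)) := h3.le
        _ = V (2 ^ (n + 1) * s) := by ring_nf
  refine tendsto_atTop.2 fun b => ?_
  obtain ⟨n, hn⟩ := ((tendsto_pow_atTop_atTop_of_one_lt hq1).eventually
    (eventually_ge_atTop (b / V s))).exists
  have hb : b ≤ V (2 ^ n * s) := ((div_le_iff₀ (hpos s hs0)).1 hn).trans (hgrow n)
  have h0 : 0 < 2 ^ n * s := by positivity
  filter_upwards [eventually_ge_atTop (2 ^ n * s)] with x hx
  exact hb.trans (hmono h0 (h0.trans_le hx) hx)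

/-- A Potter-type upper bound for monotone regularly varying functions. -/
theorem exists_potter_bound {V : ℝ → ℝ} {α β : ℝ} (hα : 0 < α) (hαβ : α < β)
    (hmono : MonotoneOn V (Set.Ioi 0)) (hpos : ∀ t, 0 < t → 0 < V t)
    (hreg : ∀ l : ℝ, 0 < l → Tendsto (fun s => V (l * s) / V s) atTop (𝓝 (l ^ α))) :
    ∃ C : ℝ, ∀ᶠ s in atTop, ∀ l : ℝ, 0 < l → V (l * s) ≤ C * (1 + l ^ β) * V s := by
  have h2αβ : (2 : ℝ) ^ α < 2 ^ β := Real.rpow_lt_rpow_of_exponent_lt one_lt_two hαβ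
  have h2β : (1 : ℝ) ≤ 2 ^ β := Real.one_le_rpow one_le_two (hα.trans hαβ).le
  obtain ⟨s₀, hs₀⟩ := eventually_atTop.1
    (((hreg 2 two_pos).eventually (gt_mem_nhds h2αβ)).and (eventually_gt_atTop 0))
  refine ⟨2 ^ β, ?_⟩
  filter_upwards [eventually_ge_atTop s₀] with s hs l hl
  have hs0 : 0 < s := (hs₀ s hs).2
  have hVs := hpos s hs0
  have hgrow : ∀ n : ℕ, V (2 ^ n * s) ≤ ((2 : ℝ) ^ β) ^ n * V s := by
    intro n
    induction n with
    | zero => simp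
    | succ n ih =>
      have h2 : s ≤ 2 ^ n * s := le_mul_of_one_le_left hs0.le (one_le_pow₀ one_le_two)
      have h3 := (div_lt_iff₀ (hpos _ (hs0.trans_le h2))).1 (hs₀ _ (hs.trans h2)).1
      calc V (2 ^ (n + 1) * s) = V (2 * (2 ^ n * s)) := by ring_nf
        _ ≤ 2 ^ β * V (2 ^ n * s) := h3.le
        _ ≤ 2 ^ β * (((2 : ℝ) ^ β) ^ n * V s) := by gcongr
        _ = ((2 : ℝ) ^ β) ^ (n + 1) * V s := by ring
  have hlβ : 0 < l ^ β := Real.rpow_pos_of_pos hl β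
  rcases le_total l 1 with h1 | h1
  · have h4 : V (l * s) ≤ V s :=
      hmono (mul_pos hl hs0) hs0 (mul_le_of_le_one_left hs0.le h1)
    refine h4.trans (le_mul_of_one_le_left hVs.le ?_)
    nlinarith
  · obtain ⟨n, hn1, hn2⟩ := exists_nat_pow_near h1 one_lt_two
    have hpow : ((2 : ℝ) ^ β) ^ n ≤ l ^ β := by
      rw [← Real.rpow_natCast, ← Real.rpow_mul two_pos.le, mul_comm, Real.rpow_mul two_pos.le,
        Real.rpow_natCast]
      exact Real.rpow_le_rpow (by positivity) hn1 (hα.trans hαβ).le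
    calc V (l * s) ≤ V (2 ^ (n + 1) * s) :=
          hmono (mul_pos hl hs0) (Set.mem_Ioi.2 (by positivity)) (by gcongr)
      _ ≤ ((2 : ℝ) ^ β) ^ (n + 1) * V s := hgrow _
      _ = 2 ^ β * ((2 : ℝ) ^ β) ^ n * V s := by ring
      _ ≤ 2 ^ β * (1 + l ^ β) * V s := by gcongr; linarith

/-- The generalized inverse of a function monotone on `(0, ∞)` tends to infinity. -/
theorem tendsto_sInf_superlevel_atTop {V : ℝ → ℝ}
    (hmono : MonotoneOn V (Set.Ioi 0)) (htop : Tendsto V atTop atTop) :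
    Tendsto (fun u => sInf {x : ℝ | 0 ≤ x ∧ u ≤ V x}) atTop atTop := by
  refine tendsto_atTop.2 fun M => ?_
  filter_upwards [eventually_gt_atTop (V 0), eventually_gt_atTop (V (max M 1))] with u hu0 huM
  obtain ⟨x, hx⟩ := ((eventually_ge_atTop 0).and (htop.eventually (eventually_ge_atTop u))).exists
  refine le_csInf ⟨x, hx⟩ fun y ⟨hy0, hy⟩ => ?_
  by_contra! h
  have hy1 : 0 < y := hy0.lt_of_ne (by rintro rfl; linarith)
  have h3 := hmono hy1 (show 0 < max M 1 from by positivity) (h.le.trans (le_max_left _ _))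
  linarith

/-- A monotone regularly varying function composed with its generalized inverse is asymptotic
to the identity. -/
theorem tendsto_div_apply_sInf_superlevel {V : ℝ → ℝ} {α : ℝ} (hα : 0 < α)
    (hmono : MonotoneOn V (Set.Ioi 0)) (hpos : ∀ t, 0 < t → 0 < V t)
    (hreg : ∀ l : ℝ, 0 < l → Tendsto (fun s => V (l * s) / V s) atTop (𝓝 (l ^ α))) :
    Tendsto (fun u => u / V (sInf {x : ℝ | 0 ≤ x ∧ u ≤ V x})) atTop (𝓝 1) := by
  have htop := tendsto_atTop_of_regularlyVarying hα hmono hpos hreg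
  have hinv := tendsto_sInf_superlevel_atTop hmono htop
  have hne : ∀ u, {x : ℝ | 0 ≤ x ∧ u ≤ V x}.Nonempty := fun u =>
    ((eventually_ge_atTop 0).and (htop.eventually (eventually_ge_atTop u))).exists
  have hbdd : ∀ u, BddBelow {x : ℝ | 0 ≤ x ∧ u ≤ V x} := fun u => ⟨0, fun x hx => hx.1⟩
  have hcont : Tendsto (fun l : ℝ => l ^ α) (𝓝 1) (𝓝 1) := by
    simpa using (Real.continuousAt_rpow_const 1 α (Or.inl one_ne_zero)).tendsto
  refine tendsto_order.2 ⟨fun a ha => ?_, fun a ha => ?_⟩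
  · obtain ⟨l, hla, hl0, hl1⟩ := (((hcont.mono_left nhdsWithin_le_nhds).eventually
      (lt_mem_nhds ha)).and (Ioo_mem_nhdsLT zero_lt_one)).exists
    filter_upwards [hinv.eventually ((hreg l hl0).eventually (lt_mem_nhds hla)),
      hinv.eventually (eventually_gt_atTop 0)] with u h1 h2
    refine h1.trans_le (div_le_div_of_nonneg_right ?_ (hpos _ h2).le)
    by_contra! h
    have := csInf_le (hbdd u) ⟨(mul_pos hl0 h2).le, h.le⟩
    nlinarith
  · obtain ⟨l, hla, hl1⟩ := (((hcont.mono_left nhdsWithin_le_nhds).eventually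
      (gt_mem_nhds ha)).and (self_mem_nhdsWithin (s := Set.Ioi (1 : ℝ)))).exists
    have hl0 : 0 < l := zero_lt_one.trans hl1
    filter_upwards [hinv.eventually ((hreg l hl0).eventually (gt_mem_nhds hla)),
      hinv.eventually (eventually_gt_atTop 0)] with u h1 h2
    refine lt_of_le_of_lt (div_le_div_of_nonneg_right ?_ (hpos _ h2).le) h1
    obtain ⟨x, ⟨hx0, hxu⟩, hx⟩ := exists_lt_of_csInf_lt (hne u) (lt_mul_of_one_lt_left h2 hl1)
    have hx1 : 0 < x := h2.trans_le (csInf_le (hbdd u) ⟨hx0, hxu⟩)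
    exact hxu.trans (hmono hx1 (mul_pos hl0 h2) hx.le)

/-- A Lévy measure is finite outside every ball around the origin. -/
theorem levyMeasure_lt_norm_lt_top {E : Type*} [NormedAddCommGroup E] [MeasurableSpace E]
    [OpensMeasurableSpace E] {μ : Measure E}
    (hμ : ∫⁻ y, ENNReal.ofReal (min 1 (‖y‖ ^ 2)) ∂μ < ⊤) {δ : ℝ} (hδ : 0 < δ) :
    μ {y | δ < ‖y‖} < ⊤ := by
  have hε : ENNReal.ofReal (min 1 (δ ^ 2)) ≠ 0 := by
    simp only [ne_eq, ENNReal.ofReal_eq_zero, not_le]; positivity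
  refine (measure_mono fun y (hy : δ < ‖y‖) => ?_).trans_lt
    ((meas_ge_le_lintegral_div (f := fun y => ENNReal.ofReal (min 1 (‖y‖ ^ 2)))
      (by fun_prop) hε ENNReal.ofReal_ne_top).trans_lt (ENNReal.div_lt_top hμ.ne hε))
  change ENNReal.ofReal _ ≤ ENNReal.ofReal _
  gcongr

/-- A bounded function with quadratic decay at the origin is integrable for a Lévy measure. -/
theorem lintegral_levyMeasure_lt_top {E : Type*} [NormedAddCommGroup E] [MeasurableSpace E]
    [OpensMeasurableSpace E] {μ : Measure E}
    (hμ : ∫⁻ y, ENNReal.ofReal (min 1 (‖y‖ ^ 2)) ∂μ < ⊤) {f : E → ℝ} {M K : ℝ}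
    (hfM : ∀ y, f y ≤ M) (hfK : ∀ y, f y ≤ K * ‖y‖ ^ 2) :
    ∫⁻ y, ENNReal.ofReal (f y) ∂μ < ⊤ := by
  have hle : ∀ y, ENNReal.ofReal (f y) ≤
      ENNReal.ofReal (max M K) * ENNReal.ofReal (min 1 (‖y‖ ^ 2)) := fun y => by
    rw [← ENNReal.ofReal_mul' (by positivity)]
    refine ENNReal.ofReal_le_ofReal ?_
    rcases min_cases 1 (‖y‖ ^ 2) with ⟨h, _⟩ | ⟨h, _⟩ <;> rw [h]
    · simpa using Or.inl (hfM y)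
    · exact (hfK y).trans (by gcongr; exact le_max_right _ _)
  refine (lintegral_mono hle).trans_lt ?_
  rw [lintegral_const_mul' _ _ ENNReal.ofReal_ne_top]
  exact ENNReal.mul_lt_top ENNReal.ofReal_lt_top hμ

/-- If `ν` is regularly varying at the origin with limit measure `η`, integrals of bounded
continuous functions with quadratic decay at the origin against the normalized rescalings of `ν`
converge to the integral against `η`. -/
theorem tendsto_lintegral_rescaled {E : Type*} [NormedAddCommGroup E] [NormedSpace ℝ E]
    [MeasurableSpace E] [BorelSpace E] {ν η : Measure E}
    (hν : ∫⁻ y, ENNReal.ofReal (min 1 (‖y‖ ^ 2)) ∂ν < ⊤)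
    (hη : ∫⁻ y, ENNReal.ofReal (min 1 (‖y‖ ^ 2)) ∂η < ⊤)
    {V : ℝ → ℝ} (hV : ∀ t : ℝ, V t = (ν {y | 1 / t < ‖y‖}).toReal)
    {β C : ℝ} (hβ : β < 2)
    (hpot : ∀ᶠ s in atTop, ∀ l : ℝ, 0 < l → V (l * s) ≤ C * (1 + l ^ β) * V s)
    (hpos : ∀ t, 0 < t → 0 < V t)
    (hlim : ∀ G : Set E, MeasurableSet G → (0 : E) ∉ closure G → η (frontier G) = 0 →
      Tendsto (fun s : ℝ => ν (s • G) / ν {y | s < ‖y‖}) (𝓝[>] 0) (𝓝 (η G)))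
    {f : E → ℝ} (hf : Continuous f) (hf0 : ∀ y, 0 ≤ f y) {M K : ℝ} (hK : 0 < K)
    (hfM : ∀ y, f y ≤ M) (hfK : ∀ y, f y ≤ K * ‖y‖ ^ 2) :
    Tendsto (fun r : ℝ => (∫⁻ y, ENNReal.ofReal (f (r • y)) ∂ν) / ENNReal.ofReal (V r)) atTop
      (𝓝 (∫⁻ y, ENNReal.ofReal (f y) ∂η)) := by
  have hVν : ∀ t, 0 < t → ENNReal.ofReal (V t) = ν {y | 1 / t < ‖y‖} := fun t ht => by
    rw [hV, ENNReal.ofReal_toReal (levyMeasure_lt_norm_lt_top hν (by positivity)).ne]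
  have hnorm : ∀ {a : ℝ}, 0 < a → ∀ {y}, a ≤ f y → √(a / K) ≤ ‖y‖ := fun {a} ha {y} h =>
    Real.sqrt_le_iff.2 ⟨norm_nonneg y, by
      rw [div_le_iff₀ hK, mul_comm]; exact h.trans (hfK y)⟩
  have hlayer : ∀ r, 0 < r →
      (∫⁻ y, ENNReal.ofReal (f (r • y)) ∂ν) / ENNReal.ofReal (V r) =
        ∫⁻ a in Set.Ioi 0, ν {y | a < f (r • y)} / ENNReal.ofReal (V r) := fun r hr => by
    simp only [div_eq_mul_inv]
    rw [lintegral_mul_const' _ _ (by simpa using hpos r hr),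
      lintegral_eq_lintegral_meas_lt ν (Eventually.of_forall fun y => hf0 _)
        (hf.comp (continuous_const_smul r)).aemeasurable]
  rw [lintegral_eq_lintegral_meas_lt η (Eventually.of_forall hf0) hf.aemeasurable]
  refine Tendsto.congr' (f₁ := fun r => ∫⁻ a in Set.Ioi 0,
    ν {y | a < f (r • y)} / ENNReal.ofReal (V r))
    ((eventually_gt_atTop 0).mono fun r hr => (hlayer r hr).symm) ?_
  refine tendsto_lintegral_filter_of_dominated_convergence
    ((Set.Iio M).indicator fun a => ENNReal.ofReal (C * (1 + √(K / a) ^ β))) ?_ ?_ ?_ ?_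
  · refine Eventually.of_forall fun r => Antitone.measurable fun a b hab => ?_
    exact ENNReal.div_le_div_right (measure_mono fun y hy => hab.trans_lt hy) _
  · filter_upwards [hpot, eventually_gt_atTop 0] with r hr hr0
    filter_upwards [ae_restrict_mem measurableSet_Ioi] with a ha
    have ha0 : 0 < a := ha
    by_cases haM : a < M
    · rw [Set.indicator_of_mem (Set.mem_Iio.2 haM)]
      refine ENNReal.div_le_of_le_mul ?_
      rw [← ENNReal.ofReal_mul' (hpos r hr0).le]
      have hl : 0 < √(K / a) := Real.sqrt_pos.2 (by positivity)
      refine le_trans ?_ (ENNReal.ofReal_le_ofReal (hr _ hl))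
      rw [hVν _ (by positivity)]
      refine measure_mono fun y (hy : a < f (r • y)) => ?_
      have h1 := hy.trans_le (hfK (r • y))
      rw [norm_smul, Real.norm_of_nonneg hr0.le, ← div_lt_iff₀' hK] at h1
      have h3 : √(a / K) < r * ‖y‖ := (Real.sqrt_lt' (by
        by_contra! h
        have h4 : r * ‖y‖ = 0 := h.antisymm (by positivity)
        rw [h4] at h1
        exact absurd h1 (by norm_num; positivity))).2 h1
      change 1 / (√(K / a) * r) < ‖y‖
      rw [div_lt_iff₀ (by positivity), ← inv_div a K, Real.sqrt_inv, mul_comm, mul_assoc,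
        ← div_eq_inv_mul, lt_div_iff₀ (by positivity)]
      linarith
    · rw [Set.indicator_of_notMem (by simpa using haM)]
      have : {y | a < f (r • y)} = ∅ :=
        Set.eq_empty_of_forall_notMem fun y hy => haM (lt_of_lt_of_le hy (hfM _))
      simp [this]
  · rw [setLIntegral_indicator measurableSet_Iio, Set.inter_comm, Set.Ioi_inter_Iio]
    refine ne_of_lt ?_
    have hint : IntegrableOn (fun a : ℝ => C * (1 + K ^ (β / 2) * a ^ (-(β / 2))))
        (Set.Ioo 0 M) := by
      rcases le_or_gt M 0 with hM | hM
      · simp [Set.Ioo_eq_empty (not_lt.2 hM)]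
      refine Integrable.const_mul (Integrable.add (integrable_const _) (Integrable.const_mul ?_ _)) _
      exact (intervalIntegral.integrableOn_Ioo_rpow_iff hM).2 (by linarith)
    refine lt_of_eq_of_lt (setLIntegral_congr_fun measurableSet_Ioo fun a ha => ?_)
      (Integrable.lintegral_lt_top hint)
    have ha0 : 0 < a := ha.1
    have hrw : √(K / a) ^ β = K ^ (β / 2) * a ^ (-(β / 2)) := by
      rw [Real.sqrt_eq_rpow, ← Real.rpow_mul (by positivity), Real.div_rpow hK.le ha0.le,
        Real.rpow_neg ha0.le, div_eq_mul_inv, one_div_mul_eq_div]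
    simp only [hrw]
  · have hae := ae_restrict_of_ae (s := Set.Ioi (0 : ℝ)) (meas_le_ae_eq_meas_lt η volume f)
    filter_upwards [hae, ae_restrict_mem measurableSet_Ioi] with a hae ha
    have ha0 : 0 < a := ha
    have hδ : 0 < √(a / K) := Real.sqrt_pos.2 (by positivity)
    have hfin : η {y | a < f y} ≠ ⊤ :=
      (measure_mono fun y (hy : a < f y) =>
        (half_lt_self hδ).trans_le (hnorm ha0 hy.le)).trans_lt
          (levyMeasure_lt_norm_lt_top hη (half_pos hδ)) |>.ne
    have hfr : η (frontier {y | a < f y}) = 0 := by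
      refine measure_mono_null (t := {y | a ≤ f y} \ {y | a < f y}) (fun y hy => ?_) ?_
      · have : a = f y := frontier_lt_subset_eq continuous_const hf hy
        simp [this]
      · have hsub : {y | a < f y} ⊆ {y | a ≤ f y} := fun y (hy : a < f y) => hy.le
        rw [measure_sdiff hsub
          (measurableSet_lt measurable_const hf.measurable).nullMeasurableSet hfin, hae, tsub_self]
    have h0 : (0 : E) ∉ closure {y | a < f y} := fun h => by
      have h1 : a ≤ f 0 := closure_lt_subset_le continuous_const hf h
      have h2 := hnorm ha0 h1
      simp only [norm_zero] at h2
      linarith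
    refine ((hlim _ (measurableSet_lt measurable_const hf.measurable) h0 hfr).comp
      tendsto_inv_atTop_nhdsGT_zero).congr' ?_
    filter_upwards [eventually_gt_atTop 0] with r hr
    have hset : r⁻¹ • {y | a < f y} = {y | a < f (r • y)} := by
      ext y
      rw [Set.mem_inv_smul_set_iff₀ hr.ne']
      rfl
    simp only [Function.comp_apply, hset, hVν r hr, one_div]

/-- Weak convergence along a countably generated filter follows from pointwise convergence of
characteristic functions. -/
theorem tendsto_integral_of_tendsto_charFun_s9 {E ι : Type*} [NormedAddCommGroup E]
    [InnerProductSpace ℝ E] [FiniteDimensional ℝ E] [MeasurableSpace E] [BorelSpace E]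
    {l : Filter ι} [l.IsCountablyGenerated] {μ : ι → ProbabilityMeasure E}
    {μ₀ : ProbabilityMeasure E}
    (h : ∀ ξ : E, Tendsto (fun i => charFun (μ i : Measure E) ξ) l (𝓝 (charFun (μ₀ : Measure E) ξ)))
    (f : BoundedContinuousFunction E ℝ) :
    Tendsto (fun i => ∫ x, f x ∂(μ i : Measure E)) l (𝓝 (∫ x, f x ∂(μ₀ : Measure E))) := by
  refine ProbabilityMeasure.tendsto_iff_forall_integral_tendsto.1 ?_ f
  exact tendsto_of_seq_tendsto fun u hu =>
    ProbabilityMeasure.tendsto_of_tendsto_charFun fun ξ => (h ξ).comp hu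

/-- A step in the proof of Theorem 3: if the symmetric Lévy measure ν is
regularly varying at the origin with limit measure η, then
t·ψ(V⁻(1/t)ξ) → ∫(1 − cos⟨ξ,y⟩) η(dy) for every ξ, and the laws of the rescaled
variables V⁻(1/t)·X_t converge weakly to the corresponding symmetric α-stable law. -/
theorem rescaled_laws_converge_to_stable
    (d : ℕ) (hd : 1 ≤ d)
    -- ν is a symmetric Lévy measure
    (ν : Measure (EuclideanSpace ℝ (Fin d)))
    (hν0 : ν {0} = 0)
    (hνlevy : ∫⁻ y, ENNReal.ofReal (min 1 (‖y‖ ^ 2)) ∂ν < ⊤)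
    (hνsym : ν.map (fun y => -y) = ν)
    -- the characteristic exponent of the process with triplet (0, 0, ν)
    (ψ : EuclideanSpace ℝ (Fin d) → ℝ)
    (hψ : ∀ ξ, ψ ξ = ∫ y, (1 - Real.cos ⟪ξ, y⟫) ∂ν)
    -- (p t) are the marginal laws of the process
    (p : ℝ → Measure (EuclideanSpace ℝ (Fin d)))
    (hp : ∀ t, 0 ≤ t → IsProbabilityMeasure (p t))
    (hchar : ∀ t, 0 ≤ t → ∀ ξ,
      ∫ x, Complex.exp (Complex.I * (⟪ξ, x⟫ : ℂ)) ∂(p t)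
        = Complex.exp (-(t * ψ ξ : ℝ)))
    -- (a): V(t) = ν({‖y‖ > 1/t}) is regularly varying of index α ∈ (0, 2)
    (α : ℝ) (hα0 : 0 < α) (hα2 : α < 2)
    (V : ℝ → ℝ)
    (hV : ∀ t : ℝ, V t = (ν {y : EuclideanSpace ℝ (Fin d) | 1 / t < ‖y‖}).toReal)
    (hVpos : ∀ t : ℝ, 0 < t → 0 < V t)
    (hVreg : ∀ l : ℝ, 0 < l →
      Tendsto (fun s => V (l * s) / V s) atTop (𝓝 (l ^ α)))
    -- the generalized inverse V⁻
    (Vinv : ℝ → ℝ) (hVinv : ∀ u, Vinv u = sInf {x : ℝ | 0 ≤ x ∧ u ≤ V x})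
    -- (b): the limit measure η on ℝ^d \ {0}
    (η : Measure (EuclideanSpace ℝ (Fin d)))
    (hη0 : η {0} = 0)
    (hηlevy : ∫⁻ y, ENNReal.ofReal (min 1 (‖y‖ ^ 2)) ∂η < ⊤)
    (hηlim : ∀ G : Set (EuclideanSpace ℝ (Fin d)), MeasurableSet G →
      (0 : EuclideanSpace ℝ (Fin d)) ∉ closure G → η (frontier G) = 0 →
      Tendsto (fun s : ℝ => ν (s • G) / ν {y | s < ‖y‖}) (𝓝[>] 0) (𝓝 (η G)))
    -- the symmetric α-stable law with Lévy measure η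
    (pη : Measure (EuclideanSpace ℝ (Fin d))) (hpη : IsProbabilityMeasure pη)
    (hpηchar : ∀ ξ : EuclideanSpace ℝ (Fin d),
      ∫ x, Complex.exp (Complex.I * (⟪ξ, x⟫ : ℂ)) ∂pη
        = Complex.exp (-(∫ y, (1 - Real.cos ⟪ξ, y⟫) ∂η : ℝ))) :
    (∀ ξ : EuclideanSpace ℝ (Fin d),
      Tendsto (fun t : ℝ => t * ψ (Vinv (1 / t) • ξ)) (𝓝[>] 0)
        (𝓝 (∫ y, (1 - Real.cos ⟪ξ, y⟫) ∂η))) ∧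
      ∀ f : BoundedContinuousFunction (EuclideanSpace ℝ (Fin d)) ℝ,
        Tendsto (fun t : ℝ =>
            ∫ x, f x ∂((p t).map (fun x => Vinv (1 / t) • x)))
          (𝓝[>] 0) (𝓝 (∫ x, f x ∂pη)) := by
  have hfin : ∀ {δ : ℝ}, 0 < δ → ν {y | δ < ‖y‖} < ⊤ := levyMeasure_lt_norm_lt_top hνlevy
  have hmono : MonotoneOn V (Set.Ioi 0) := fun s (hs : 0 < s) t (ht : 0 < t) hst => by
    rw [hV, hV]
    refine ENNReal.toReal_mono (hfin (by positivity)).ne (measure_mono fun y hy => ?_)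
    exact lt_of_le_of_lt (one_div_le_one_div_of_le hs hst) hy
  obtain ⟨β, hαβ, hβ2⟩ := exists_between hα2
  obtain ⟨C, hpot⟩ := exists_potter_bound hα0 hαβ hmono hVpos hVreg
  have hinvt : Tendsto (fun t : ℝ => 1 / t) (𝓝[>] 0) atTop := by
    simpa using tendsto_inv_nhdsGT_zero (𝕜 := ℝ)
  have hr : Tendsto (fun t => Vinv (1 / t)) (𝓝[>] 0) atTop := by
    obtain rfl : Vinv = _ := funext hVinv
    exact (tendsto_sInf_superlevel_atTop hmono
      (tendsto_atTop_of_regularlyVarying hα0 hmono hVpos hVreg)).comp hinvt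
  have hratio : Tendsto (fun t => t * V (Vinv (1 / t))) (𝓝[>] 0) (𝓝 1) := by
    obtain rfl : Vinv = _ := funext hVinv
    have h := ((tendsto_div_apply_sInf_superlevel hα0 hmono hVpos hVreg).comp hinvt).inv₀
      one_ne_zero
    rw [inv_one] at h
    refine h.congr fun t => ?_
    simp [mul_comm]
  have hexp : ∀ ξ : EuclideanSpace ℝ (Fin d),
      Tendsto (fun t : ℝ => t * ψ (Vinv (1 / t) • ξ)) (𝓝[>] 0)
        (𝓝 (∫ y, (1 - Real.cos ⟪ξ, y⟫) ∂η)) := by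
    intro ξ
    have hf0 : ∀ y, 0 ≤ 1 - Real.cos ⟪ξ, y⟫ := fun y => sub_nonneg.2 (Real.cos_le_one _)
    have hfM : ∀ y, 1 - Real.cos ⟪ξ, y⟫ ≤ 2 := fun y => by
      linarith [Real.neg_one_le_cos ⟪ξ, y⟫]
    have hfK : ∀ y, 1 - Real.cos ⟪ξ, y⟫ ≤ (‖ξ‖ ^ 2 / 2 + 1) * ‖y‖ ^ 2 := fun y => by
      have h1 := Real.one_sub_sq_div_two_le_cos (x := ⟪ξ, y⟫)
      have h2 : ⟪ξ, y⟫ ^ 2 ≤ (‖ξ‖ * ‖y‖) ^ 2 := sq_le_sq.2 (by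
        rw [abs_of_nonneg (by positivity : 0 ≤ ‖ξ‖ * ‖y‖)]; exact abs_real_inner_le_norm ξ y)
      nlinarith [sq_nonneg ‖y‖]
    have hf : Continuous fun y => 1 - Real.cos ⟪ξ, y⟫ := by fun_prop
    have hlim := tendsto_lintegral_rescaled hνlevy hηlevy hV hβ2 hpot hVpos hηlim hf hf0
      (by positivity) hfM hfK
    have hmain := hratio.mul ((ENNReal.tendsto_toReal
      (lintegral_levyMeasure_lt_top hηlevy hfM hfK).ne).comp (hlim.comp hr))
    rw [one_mul, ← integral_eq_lintegral_of_nonneg_ae (Eventually.of_forall hf0)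
      hf.aestronglyMeasurable] at hmain
    refine hmain.congr' ?_
    filter_upwards [hr.eventually (eventually_gt_atTop 0)] with t ht
    have hVt := hVpos _ ht
    have hψt : ψ (Vinv (1 / t) • ξ) =
        (∫⁻ y, ENNReal.ofReal (1 - Real.cos ⟪ξ, Vinv (1 / t) • y⟫) ∂ν).toReal := by
      rw [hψ, ← integral_eq_lintegral_of_nonneg_ae (Eventually.of_forall fun y => hf0 _)
        (hf.comp (continuous_const_smul _)).aestronglyMeasurable]
      simp only [real_inner_smul_left, real_inner_smul_right]
    simp only [Function.comp_apply, ENNReal.toReal_div, ENNReal.toReal_ofReal hVt.le, hψt]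
    field_simp
  refine ⟨hexp, fun f => ?_⟩
  have hprob : ∀ t, IsProbabilityMeasure ((p |t|).map fun x => Vinv (1 / t) • x) := fun t =>
    have := hp |t| (abs_nonneg t)
    Measure.isProbabilityMeasure_map (by fun_prop)
  have hchar_inner : ∀ (μ : Measure (EuclideanSpace ℝ (Fin d))) ξ,
      charFun μ ξ = ∫ x, Complex.exp (Complex.I * (⟪ξ, x⟫ : ℂ)) ∂μ := fun μ ξ => by
    simp only [charFun_apply, real_inner_comm, mul_comm]
  refine (tendsto_integral_of_tendsto_charFun_s9 (l := 𝓝[>] (0 : ℝ))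
    (μ := fun t => ⟨_, hprob t⟩) (μ₀ := ⟨pη, hpη⟩) (fun ξ => ?_) f).congr' ?_
  · have hcexp := (Complex.continuous_exp.tendsto _).comp
      ((Complex.continuous_ofReal.tendsto _).comp (hexp ξ).neg)
    simp only [ProbabilityMeasure.coe_mk]
    rw [hchar_inner pη, hpηchar, ← Complex.ofReal_neg]
    refine hcexp.congr' ?_
    filter_upwards [self_mem_nhdsWithin] with t (ht : 0 < t)
    rw [charFun_map_smul, hchar_inner, abs_of_pos ht, hchar t ht.le, ← Complex.ofReal_neg]
    rfl
  · filter_upwards [self_mem_nhdsWithin] with t (ht : 0 < t)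
    simp only [ProbabilityMeasure.coe_mk, abs_of_pos ht]
end

section
/- Let d ≥ 1 and let ν be a Lévy measure on ℝ^d such that V(t) := ν({y : ‖y‖ > 1/t}) is regularly varying at infinity of index α ∈ (0, 2). Define h(s) = ν({y : ‖y‖ > s}) + s^{−2} ∫_{‖y‖≤s} ‖y‖² ν(dy) for s > 0. Then there exist s₀ ∈ (0,1] and constants c, C > 0 such that c · V(1/s) ≤ h(s) ≤ C · V(1/s) for all 0 < s < s₀. -/
open MeasureTheory Filter
open scoped Topology ENNReal

/-- A measure integrating `min 1 ‖y‖²` is finite on the complement of each ball around `0`. -/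
theorem measure_lt_norm_lt_top {E : Type*} [NormedAddCommGroup E] [MeasurableSpace E]
    [BorelSpace E] {ν : Measure E}
    (hν : ∫⁻ y, ENNReal.ofReal (min 1 (‖y‖ ^ 2)) ∂ν < ⊤) {s : ℝ} (hs : 0 < s) :
    ν {y : E | s < ‖y‖} < ⊤ := by
  have hm : 0 < min 1 (s ^ 2) := by positivity
  have hε : ENNReal.ofReal (min 1 (s ^ 2)) ≠ 0 := by
    simpa only [ne_eq, ENNReal.ofReal_eq_zero, not_le] using hm
  have hmeas : Measurable fun y : E => ENNReal.ofReal (min 1 (‖y‖ ^ 2)) := by fun_prop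
  calc ν {y : E | s < ‖y‖}
      ≤ ν {y : E | ENNReal.ofReal (min 1 (s ^ 2)) ≤ ENNReal.ofReal (min 1 (‖y‖ ^ 2))} := by
        refine measure_mono fun y (hy : s < ‖y‖) => ENNReal.ofReal_le_ofReal ?_
        gcongr
    _ ≤ (∫⁻ y, ENNReal.ofReal (min 1 (‖y‖ ^ 2)) ∂ν) / ENNReal.ofReal (min 1 (s ^ 2)) :=
        meas_ge_le_lintegral_div hmeas.aemeasurable hε ENNReal.ofReal_ne_top
    _ < ⊤ := ENNReal.div_lt_top hν.ne hε

/-- If the tails of `ν` grow at most like `r ^ k` along the dyadic radii `s / 2 ^ k`, with `r < 4`,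
then the truncated second moment at `s` is at most a multiple of `s²` times the tail at `s`. -/
theorem setIntegral_norm_sq_le_of_dyadic_tail {E : Type*} [NormedAddCommGroup E]
    [MeasurableSpace E] [BorelSpace E] {ν : Measure E} {s r T : ℝ} (hs : 0 < s) (hr0 : 0 < r)
    (hr4 : r < 4) (hT : 0 ≤ T)
    (htail : ∀ k : ℕ, ν {y : E | s * (1 / 2) ^ (k + 1) < ‖y‖} ≤ ENNReal.ofReal (r ^ (k + 1) * T)) :
    ∫ y in {y : E | ‖y‖ ≤ s}, ‖y‖ ^ 2 ∂ν ≤ s ^ 2 * (r * (1 - r / 4)⁻¹ * T) := by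
  have hr : r / 4 < 1 := by linarith
  have hgeom : HasSum (fun k : ℕ => s ^ 2 * (r * T) * (r / 4) ^ k)
      (s ^ 2 * (r * T) * (1 - r / 4)⁻¹) :=
    (hasSum_geometric_of_lt_one (by positivity) hr).mul_left _
  have hball : MeasurableSet {y : E | ‖y‖ ≤ s} := measurableSet_le measurable_norm measurable_const
  have hshell : ∀ k : ℕ, MeasurableSet {y : E | s * (1 / 2) ^ (k + 1) < ‖y‖} := fun k =>
    measurableSet_lt measurable_const measurable_norm
  have hpt : ∀ y ∈ {y : E | ‖y‖ ≤ s}, ENNReal.ofReal (‖y‖ ^ 2) ≤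
      ∑' k : ℕ, {y : E | s * (1 / 2) ^ (k + 1) < ‖y‖}.indicator
        (fun _ => ENNReal.ofReal (s ^ 2 * (1 / 4) ^ k)) y := by
    intro y (hy : ‖y‖ ≤ s)
    rcases (norm_nonneg y).eq_or_lt with h0 | h0
    · simp [← h0]
    obtain ⟨k, hk1, hk2⟩ := exists_nat_pow_near_of_lt_one (div_pos h0 hs)
      ((div_le_one hs).2 hy) (by norm_num : (0 : ℝ) < 1 / 2) (by norm_num)
    rw [lt_div_iff₀' hs] at hk1
    rw [div_le_iff₀' hs] at hk2
    refine le_trans ?_ (ENNReal.le_tsum k)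
    rw [Set.indicator_of_mem (show y ∈ {y : E | s * (1 / 2) ^ (k + 1) < ‖y‖} from hk1)]
    refine ENNReal.ofReal_le_ofReal ?_
    calc ‖y‖ ^ 2 ≤ (s * (1 / 2) ^ k) ^ 2 := by gcongr
      _ = s ^ 2 * (1 / 4) ^ k := by rw [mul_pow, pow_right_comm]; norm_num
  have hlint : ∫⁻ y in {y : E | ‖y‖ ≤ s}, ENNReal.ofReal (‖y‖ ^ 2) ∂ν ≤
      ENNReal.ofReal (s ^ 2 * (r * T) * (1 - r / 4)⁻¹) := by
    calc ∫⁻ y in {y : E | ‖y‖ ≤ s}, ENNReal.ofReal (‖y‖ ^ 2) ∂ν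
        ≤ ∫⁻ y in {y : E | ‖y‖ ≤ s}, ∑' k : ℕ, {y : E | s * (1 / 2) ^ (k + 1) < ‖y‖}.indicator
            (fun _ => ENNReal.ofReal (s ^ 2 * (1 / 4) ^ k)) y ∂ν :=
          setLIntegral_mono' hball hpt
      _ ≤ ∫⁻ y, ∑' k : ℕ, {y : E | s * (1 / 2) ^ (k + 1) < ‖y‖}.indicator
            (fun _ => ENNReal.ofReal (s ^ 2 * (1 / 4) ^ k)) y ∂ν :=
          setLIntegral_le_lintegral _ _
      _ = ∑' k : ℕ, ENNReal.ofReal (s ^ 2 * (1 / 4) ^ k) *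
            ν {y : E | s * (1 / 2) ^ (k + 1) < ‖y‖} := by
          rw [lintegral_tsum fun k => (measurable_const.indicator (hshell k)).aemeasurable]
          simp only [lintegral_indicator_const (hshell _)]
      _ ≤ ∑' k : ℕ, ENNReal.ofReal (s ^ 2 * (r * T) * (r / 4) ^ k) := by
          refine ENNReal.tsum_le_tsum fun k => ?_
          calc ENNReal.ofReal (s ^ 2 * (1 / 4) ^ k) * ν {y : E | s * (1 / 2) ^ (k + 1) < ‖y‖}
              ≤ ENNReal.ofReal (s ^ 2 * (1 / 4) ^ k) * ENNReal.ofReal (r ^ (k + 1) * T) := by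
                gcongr
                exact htail k
            _ = ENNReal.ofReal (s ^ 2 * (r * T) * (r / 4) ^ k) := by
                rw [← ENNReal.ofReal_mul (by positivity)]
                congr 1
                rw [div_pow, div_pow]
                ring
      _ = ENNReal.ofReal (s ^ 2 * (r * T) * (1 - r / 4)⁻¹) := by
          rw [← ENNReal.ofReal_tsum_of_nonneg (fun k => by positivity) hgeom.summable,
            hgeom.tsum_eq]
  rw [integral_eq_lintegral_of_nonneg_ae (ae_of_all _ fun y => by positivity)
    (by fun_prop : Measurable fun y : E => ‖y‖ ^ 2).aestronglyMeasurable]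
  have hnn : 0 ≤ s ^ 2 * (r * T) * (1 - r / 4)⁻¹ := hgeom.nonneg fun k => by positivity
  calc _ ≤ s ^ 2 * (r * T) * (1 - r / 4)⁻¹ := ENNReal.toReal_le_of_le_ofReal hnn hlint
    _ = s ^ 2 * (r * (1 - r / 4)⁻¹ * T) := by ring

/-- The final estimate in the proof of Theorem 3: if V(t) = ν({‖y‖ > 1/t}) is
regularly varying at infinity of index α ∈ (0,2), then the Pruitt function
h(s) = ν({‖y‖ > s}) + s⁻² ∫_{‖y‖≤s} ‖y‖² ν(dy) satisfies h(s) ≍ V(1/s) for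
small s > 0. -/
theorem pruitt_function_comparable_to_tail
    (d : ℕ) (hd : 1 ≤ d)
    -- ν is a Lévy measure
    (ν : Measure (EuclideanSpace ℝ (Fin d)))
    (hν0 : ν {0} = 0)
    (hνlevy : ∫⁻ y, ENNReal.ofReal (min 1 (‖y‖ ^ 2)) ∂ν < ⊤)
    -- V(t) = ν({‖y‖ > 1/t}) is regularly varying of index α ∈ (0, 2)
    (α : ℝ) (hα0 : 0 < α) (hα2 : α < 2)
    (V : ℝ → ℝ)
    (hV : ∀ t : ℝ, V t = (ν {y : EuclideanSpace ℝ (Fin d) | 1 / t < ‖y‖}).toReal)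
    (hVpos : ∀ t : ℝ, 0 < t → 0 < V t)
    (hVreg : ∀ l : ℝ, 0 < l →
      Tendsto (fun s => V (l * s) / V s) atTop (𝓝 (l ^ α)))
    -- the Pruitt-type function h
    (h : ℝ → ℝ)
    (hh : ∀ s : ℝ, h s = (ν {y : EuclideanSpace ℝ (Fin d) | s < ‖y‖}).toReal
      + s⁻¹ ^ 2 * ∫ y in {y : EuclideanSpace ℝ (Fin d) | ‖y‖ ≤ s}, ‖y‖ ^ 2 ∂ν) :
    ∃ s₀ : ℝ, 0 < s₀ ∧ s₀ ≤ 1 ∧ ∃ c > (0 : ℝ), ∃ C > (0 : ℝ),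
      ∀ s : ℝ, 0 < s → s < s₀ →
        c * V (1 / s) ≤ h s ∧ h s ≤ C * V (1 / s) := by
  have hpow : (2 : ℝ) ^ α < 4 := by
    calc (2 : ℝ) ^ α < 2 ^ (2 : ℝ) := Real.rpow_lt_rpow_of_exponent_lt (by norm_num) hα2
      _ = 4 := by norm_num
  obtain ⟨r, hr1, hr4⟩ := exists_between hpow
  have hr0 : 0 < r := (by positivity : (0 : ℝ) < 2 ^ α).trans hr1
  obtain ⟨t₀, ht₀⟩ := eventually_atTop.1 ((hVreg 2 two_pos).eventually_lt_const hr1)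
  have ht1 : 0 < max t₀ 1 := by positivity
  have hc : 0 < (1 - r / 4)⁻¹ := inv_pos.2 (by linarith)
  refine ⟨1 / max t₀ 1, by positivity, (div_le_one ht1).2 (le_max_right _ _), 1, one_pos,
    1 + r * (1 - r / 4)⁻¹, by positivity, fun s hs hs₀ => ?_⟩
  have hts : max t₀ 1 ≤ 1 / s := by
    rw [le_div_comm₀ ht1 hs]
    exact hs₀.le
  have hgrowth : ∀ k : ℕ, V (2 ^ k * (1 / s)) ≤ r ^ k * V (1 / s) := by
    intro k
    induction k with
    | zero => simp
    | succ k ih =>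
      have hpos : 0 < 2 ^ k * (1 / s) := by positivity
      have hle : t₀ ≤ 2 ^ k * (1 / s) :=
        ((le_max_left _ _).trans hts).trans
          (le_mul_of_one_le_left (by positivity) (one_le_pow₀ one_le_two))
      have hlt := (div_lt_iff₀ (hVpos _ hpos)).1 (ht₀ _ hle)
      calc V (2 ^ (k + 1) * (1 / s)) = V (2 * (2 ^ k * (1 / s))) := by rw [pow_succ']; ring_nf
        _ ≤ r * V (2 ^ k * (1 / s)) := hlt.le
        _ ≤ r * (r ^ k * V (1 / s)) := by gcongr
        _ = r ^ (k + 1) * V (1 / s) := by ring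
  have hVs : V (1 / s) = (ν {y : EuclideanSpace ℝ (Fin d) | s < ‖y‖}).toReal := by
    rw [hV, one_div_one_div]
  have hint : ∫ y in {y : EuclideanSpace ℝ (Fin d) | ‖y‖ ≤ s}, ‖y‖ ^ 2 ∂ν ≤
      s ^ 2 * (r * (1 - r / 4)⁻¹ * V (1 / s)) := by
    refine setIntegral_norm_sq_le_of_dyadic_tail hs hr0 hr4 (hVpos _ (by positivity)).le
      fun k => ?_
    rw [ENNReal.le_ofReal_iff_toReal_le (measure_lt_norm_lt_top hνlevy (by positivity)).ne
      (mul_nonneg (by positivity) (hVpos _ (by positivity)).le)]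
    have hk := hgrowth (k + 1)
    rw [hV (2 ^ (k + 1) * (1 / s))] at hk
    have hrad : 1 / (2 ^ (k + 1) * (1 / s)) = s * (1 / 2) ^ (k + 1) := by
      rw [div_pow, one_pow]
      field_simp
    rwa [hrad] at hk
  rw [hh, ← hVs]
  constructor
  · have : 0 ≤ ∫ y in {y : EuclideanSpace ℝ (Fin d) | ‖y‖ ≤ s}, ‖y‖ ^ 2 ∂ν :=
      integral_nonneg fun y => by positivity
    rw [one_mul]
    exact le_add_of_nonneg_right (by positivity)
  · calc V (1 / s) + s⁻¹ ^ 2 * ∫ y in {y : EuclideanSpace ℝ (Fin d) | ‖y‖ ≤ s}, ‖y‖ ^ 2 ∂ν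
        ≤ V (1 / s) + s⁻¹ ^ 2 * (s ^ 2 * (r * (1 - r / 4)⁻¹ * V (1 / s))) := by gcongr
      _ = (1 + r * (1 - r / 4)⁻¹) * V (1 / s) := by
        rw [← mul_assoc (s⁻¹ ^ 2), ← mul_pow, inv_mul_cancel₀ hs.ne']
        ring
end

section
/- Let d ≥ 1, α ∈ (0, 2], and let p : ℝ^d → [0,∞) be an integrable function satisfying ∫_{ℝ^d} e^{i⟨ξ,x⟩} p(x) dx = e^{−‖ξ‖^α} for all ξ ∈ ℝ^d (so p is the density of the standard isotropic α-stable law). Then for every β with 0 < β < α, ∫_{ℝ^d} ‖x‖^β p(x) dx = 2^β Γ((d+β)/2) Γ(1 − β/α) / (Γ(d/2) Γ(1 − β/2)). -/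
open MeasureTheory Filter
open scoped Topology RealInnerProductSpace ENNReal

lemma lintegral_Ioo_deriv_one_sub_exp_neg_mul_rpow {a r t : ℝ} (ha : 0 < a) (hr : 0 ≤ r)
    (ht : 0 < t) :
    ∫⁻ u in Set.Ioo 0 t, ENNReal.ofReal (r * (a * u ^ (a - 1)) * Real.exp (-r * u ^ a))
      = ENNReal.ofReal (1 - Real.exp (-r * t ^ a)) := by
  have hc : ContinuousOn (fun u : ℝ => -Real.exp (-r * u ^ a)) (Set.Icc 0 t) := by
    have := Real.continuous_rpow_const ha.le
    fun_prop
  have hd : ∀ u ∈ Set.Ioo 0 t, HasDerivAt (fun u : ℝ => -Real.exp (-r * u ^ a))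
      (r * (a * u ^ (a - 1)) * Real.exp (-r * u ^ a)) u := by
    intro u hu
    have := (((Real.hasDerivAt_rpow_const (p := a) (Or.inl hu.1.ne')).const_mul (-r)).exp).neg
    exact this.congr_deriv (by ring)
  have hn : ∀ u ∈ Set.Ioo 0 t, 0 ≤ r * (a * u ^ (a - 1)) * Real.exp (-r * u ^ a) := by
    intro u hu
    have := hu.1
    positivity
  have hi := intervalIntegral.integrableOn_deriv_of_nonneg hc hd hn
  have hv := intervalIntegral.integral_eq_sub_of_hasDerivAt_of_le ht.le hc hd
    ((intervalIntegrable_iff_integrableOn_Ioc_of_le ht.le).2 hi)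
  rw [← ofReal_integral_eq_lintegral_ofReal (hi.mono_set Set.Ioo_subset_Ioc_self)
    ((ae_restrict_iff' measurableSet_Ioo).2 (ae_of_all _ hn)), ← integral_Ioc_eq_integral_Ioo,
    ← intervalIntegral.integral_of_le ht.le, hv]
  simp [Real.zero_rpow ha.ne']
  congr 1
  ring

lemma lintegral_Ioi_rpow_neg_one_sub {s u : ℝ} (hs : 0 < s) (hu : 0 < u) :
    ∫⁻ t in Set.Ioi u, ENNReal.ofReal (t ^ (-1 - s)) = ENNReal.ofReal (u ^ (-s) / s) := by
  rw [← ofReal_integral_eq_lintegral_ofReal (integrableOn_Ioi_rpow_of_lt (by linarith) hu)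
    ((ae_restrict_iff' measurableSet_Ioi).2 (ae_of_all _ fun t ht =>
      Real.rpow_nonneg (hu.trans ht).le _)), integral_Ioi_rpow_of_lt (by linarith) hu]
  congr 1
  rw [show -1 - s + 1 = -s by ring, neg_div_neg_eq]

/-- A Lévy–Khintchine representation of the power `r ^ (s / a)`. -/
lemma lintegral_one_sub_exp_neg_mul_rpow_mul_rpow {a s r : ℝ} (hs : 0 < s) (hsa : s < a)
    (hr : 0 ≤ r) :
    ∫⁻ t in Set.Ioi (0 : ℝ), ENNReal.ofReal ((1 - Real.exp (-r * t ^ a)) * t ^ (-1 - s))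
      = ENNReal.ofReal (Real.Gamma (1 - s / a) / s * r ^ (s / a)) := by
  have ha : 0 < a := hs.trans hsa
  rcases hr.eq_or_lt with rfl | hr'
  · simp [Real.zero_rpow (div_pos hs ha).ne']
  set h : ℝ → ℝ≥0∞ := fun u =>
    ENNReal.ofReal (r * (a * u ^ (a - 1)) * Real.exp (-r * u ^ a))
  set k : ℝ → ℝ≥0∞ := fun t => ENNReal.ofReal (t ^ (-1 - s))
  have hhm : Measurable h := by fun_prop
  have hkm : Measurable k := by fun_prop
  calc
    _ = ∫⁻ t in Set.Ioi (0 : ℝ), ∫⁻ u in Set.Ioi (0 : ℝ),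
          {z : ℝ × ℝ | z.2 < z.1}.indicator (fun z => h z.2 * k z.1) (t, u) := by
      refine setLIntegral_congr_fun measurableSet_Ioi fun t ht => ?_
      have ht : 0 < t := ht
      have : ∀ u, {z : ℝ × ℝ | z.2 < z.1}.indicator (fun z => h z.2 * k z.1) (t, u)
          = (Set.Iio t).indicator (fun u => h u * k t) u := fun u => rfl
      simp_rw [this]
      rw [lintegral_indicator measurableSet_Iio, Measure.restrict_restrict measurableSet_Iio,
        Set.inter_comm, Set.Ioi_inter_Iio, lintegral_mul_const _ hhm,
        lintegral_Ioo_deriv_one_sub_exp_neg_mul_rpow ha hr ht, ← ENNReal.ofReal_mul]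
      rw [sub_nonneg, Real.exp_le_one_iff]
      have := mul_nonneg hr (Real.rpow_nonneg ht.le a)
      linarith
    _ = ∫⁻ u in Set.Ioi (0 : ℝ), ∫⁻ t in Set.Ioi (0 : ℝ),
          {z : ℝ × ℝ | z.2 < z.1}.indicator (fun z => h z.2 * k z.1) (t, u) := by
      refine lintegral_lintegral_swap (Measurable.aemeasurable ?_)
      exact Measurable.indicator (by fun_prop) (measurableSet_lt measurable_snd measurable_fst)
    _ = ∫⁻ u in Set.Ioi (0 : ℝ),
          ENNReal.ofReal (r * a / s * (u ^ (a - 1 - s) * Real.exp (-r * u ^ a))) := by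
      refine setLIntegral_congr_fun measurableSet_Ioi fun u hu => ?_
      have hu : 0 < u := hu
      have : ∀ t, {z : ℝ × ℝ | z.2 < z.1}.indicator (fun z => h z.2 * k z.1) (t, u)
          = (Set.Ioi u).indicator (fun t => h u * k t) t := fun t => rfl
      simp_rw [this]
      rw [lintegral_indicator measurableSet_Ioi, Measure.restrict_restrict measurableSet_Ioi,
        Set.inter_eq_left.2 (Set.Ioi_subset_Ioi hu.le), lintegral_const_mul _ hkm,
        lintegral_Ioi_rpow_neg_one_sub hs hu, ← ENNReal.ofReal_mul (by positivity),
        Real.rpow_sub hu (a - 1) s, Real.rpow_neg hu.le]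
      congr 1
      ring
    _ = _ := by
      have hi := (integrableOn_rpow_mul_exp_neg_mul_rpow (p := a) (s := a - 1 - s) (by linarith)
        ha hr').const_mul (r * a / s)
      rw [← ofReal_integral_eq_lintegral_ofReal hi
        ((ae_restrict_iff' measurableSet_Ioi).2 (ae_of_all _ fun u hu => ?_)),
        integral_const_mul, integral_rpow_mul_exp_neg_mul_rpow ha (by linarith) hr']
      · congr 1
        rw [show a - 1 - s + 1 = a - s by ring, show (a - s) / a = 1 - s / a by field_simp,
          show -(a - s) / a = s / a - 1 by field_simp; ring, Real.rpow_sub hr', Real.rpow_one]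
        field_simp
      · have : 0 < u := hu
        simp only [Pi.zero_apply]
        positivity

/-- The moment of order `s / a` of `r` expressed through its Laplace transform. -/
lemma lintegral_laplace_mul_rpow {X : Type*} [MeasurableSpace X] {μ : Measure X} [SFinite μ]
    {a s : ℝ} (hs : 0 < s) (hsa : s < a) {r q : X → ℝ} (hr : ∀ x, 0 ≤ r x) (hrm : Measurable r)
    (hq : ∀ x, 0 ≤ q x) (hqi : Integrable q μ) :
    ∫⁻ t in Set.Ioi (0 : ℝ), ENNReal.ofReal
        (((∫ x, q x ∂μ) - ∫ x, Real.exp (-r x * t ^ a) * q x ∂μ) * t ^ (-1 - s))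
      = ENNReal.ofReal (Real.Gamma (1 - s / a) / s)
        * ∫⁻ x, ENNReal.ofReal (r x ^ (s / a) * q x) ∂μ := by
  have hexp : ∀ x, ∀ t : ℝ, 0 < t → Real.exp (-r x * t ^ a) ≤ 1 := by
    intro x t ht
    rw [Real.exp_le_one_iff]
    have := mul_nonneg (hr x) (Real.rpow_nonneg ht.le a)
    linarith
  have hqm := hqi.1.aemeasurable
  have hc : 0 ≤ Real.Gamma (1 - s / a) / s := by
    have : s / a < 1 := (div_lt_one (hs.trans hsa)).2 hsa
    exact div_nonneg (Real.Gamma_nonneg_of_nonneg (by linarith)) hs.le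
  calc
    _ = ∫⁻ t in Set.Ioi (0 : ℝ), ∫⁻ x, ENNReal.ofReal
          ((1 - Real.exp (-r x * t ^ a)) * t ^ (-1 - s)) * ENNReal.ofReal (q x) ∂μ := by
      refine setLIntegral_congr_fun measurableSet_Ioi fun t ht => ?_
      have ht : 0 < t := ht
      have hi : Integrable (fun x => Real.exp (-r x * t ^ a) * q x) μ := by
        refine hqi.bdd_mul (c := 1) (by fun_prop) (ae_of_all _ fun x => ?_)
        rw [Real.norm_of_nonneg (Real.exp_pos _).le]
        exact hexp x t ht
      rw [← integral_sub hqi hi, ← integral_mul_const, ofReal_integral_eq_lintegral_ofReal]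
      · refine lintegral_congr fun x => ?_
        rw [← ENNReal.ofReal_mul]
        · congr 1
          ring
        · exact mul_nonneg (sub_nonneg.2 (hexp x t ht)) (by positivity)
      · exact (hqi.sub hi).mul_const _
      · refine ae_of_all _ fun x => mul_nonneg ?_ (by positivity)
        have := mul_nonneg (sub_nonneg.2 (hexp x t ht)) (hq x)
        linarith
    _ = ∫⁻ x, (∫⁻ t in Set.Ioi (0 : ℝ), ENNReal.ofReal
          ((1 - Real.exp (-r x * t ^ a)) * t ^ (-1 - s)) * ENNReal.ofReal (q x)) ∂μ := by
      refine lintegral_lintegral_swap ?_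
      have hq2 : AEMeasurable (fun z : ℝ × X => q z.2)
          ((volume.restrict (Set.Ioi 0)).prod μ) := hqm.comp_snd
      refine AEMeasurable.mul (Measurable.aemeasurable ?_) hq2.ennreal_ofReal
      fun_prop
    _ = ∫⁻ x, ENNReal.ofReal (Real.Gamma (1 - s / a) / s)
          * ENNReal.ofReal (r x ^ (s / a) * q x) ∂μ := by
      refine lintegral_congr fun x => ?_
      rw [lintegral_mul_const _ (by fun_prop),
        lintegral_one_sub_exp_neg_mul_rpow_mul_rpow hs hsa (hr x),
        ← ENNReal.ofReal_mul (mul_nonneg hc (Real.rpow_nonneg (hr x) _)),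
        ← ENNReal.ofReal_mul hc, mul_assoc]
    _ = _ := lintegral_const_mul'' _
      (((hrm.pow_const _).aemeasurable.mul hqm).ennreal_ofReal)

section Gaussian

variable {V : Type*} [NormedAddCommGroup V] [InnerProductSpace ℝ V] [FiniteDimensional ℝ V]
  [MeasurableSpace V] [BorelSpace V]

lemma integral_norm_rpow_mul_exp_neg_mul_sq [Nontrivial V] {b β : ℝ} (hb : 0 < b) (hβ : 0 ≤ β) :
    ∫ v : V, ‖v‖ ^ β * Real.exp (-b * ‖v‖ ^ 2)
      = Module.finrank ℝ V * (volume : Measure V).real (Metric.ball 0 1)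
        * (b ^ (-(Module.finrank ℝ V + β) / 2) * (1 / 2)
          * Real.Gamma ((Module.finrank ℝ V + β) / 2)) := by
  have hd : (1 : ℝ) ≤ Module.finrank ℝ V := by
    exact_mod_cast Module.finrank_pos (R := ℝ) (M := V)
  rw [integral_fun_norm_addHaar volume (fun y : ℝ => y ^ β * Real.exp (-b * y ^ 2)),
    nsmul_eq_mul, smul_eq_mul, ← mul_assoc]
  congr 1
  have := integral_rpow_mul_exp_neg_mul_rpow (p := 2) (q := Module.finrank ℝ V + β - 1) (b := b)
    two_pos (by linarith) hb
  rw [sub_add_cancel] at this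
  rw [← this]
  refine setIntegral_congr_fun measurableSet_Ioi fun y hy => ?_
  have hy : 0 < y := hy
  simp only [smul_eq_mul]
  rw [← mul_assoc, Real.rpow_two, ← Real.rpow_natCast y (_ - 1), ← Real.rpow_add hy,
    Nat.cast_sub Module.finrank_pos, Nat.cast_one,
    show (Module.finrank ℝ V : ℝ) - 1 + β = Module.finrank ℝ V + β - 1 by ring]

lemma integrable_norm_rpow_mul_exp_neg_mul_sq [Nontrivial V] {b β : ℝ} (hb : 0 < b)
    (hβ : 0 ≤ β) : Integrable fun v : V => ‖v‖ ^ β * Real.exp (-b * ‖v‖ ^ 2) := by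
  have hd : (1 : ℝ) ≤ Module.finrank ℝ V := by
    exact_mod_cast Module.finrank_pos (R := ℝ) (M := V)
  rw [integrable_fun_norm_addHaar volume (f := fun y : ℝ => y ^ β * Real.exp (-b * y ^ 2))]
  have := integrableOn_rpow_mul_exp_neg_mul_rpow (p := 2) (s := Module.finrank ℝ V + β - 1)
    (b := b) (by linarith) two_pos hb
  refine this.congr_fun (fun y hy => ?_) measurableSet_Ioi
  have hy : 0 < y := hy
  simp only [smul_eq_mul]
  rw [← mul_assoc, Real.rpow_two, ← Real.rpow_natCast y (_ - 1), ← Real.rpow_add hy,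
    Nat.cast_sub Module.finrank_pos, Nat.cast_one,
    show (Module.finrank ℝ V : ℝ) - 1 + β = Module.finrank ℝ V + β - 1 by ring]

lemma integrable_exp_neg_mul_sq_norm {b : ℝ} (hb : 0 < b) :
    Integrable fun v : V => Real.exp (-b * ‖v‖ ^ 2) := by
  have := (GaussianFourier.integrable_cexp_neg_mul_sq_norm_add (b := (b : ℂ)) (V := V)
    (by simpa using hb) 0 0).re
  refine this.congr (ae_of_all _ fun v => ?_)
  simp only [zero_mul, add_zero]
  rw [show (-(b : ℂ) * (‖v‖ : ℂ) ^ 2) = ((-b * ‖v‖ ^ 2 : ℝ) : ℂ) by push_cast; ring]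
  exact Complex.exp_ofReal_re _

/-- Parseval's identity between `p` and a Gaussian. -/
lemma integral_exp_neg_mul_sq_norm_mul {p : V → ℝ} (hp : Integrable p) {φ : V → ℝ}
    (hφ : ∀ ξ : V, ∫ x, Complex.exp (Complex.I * (⟪ξ, x⟫ : ℂ)) * (p x : ℂ) = (φ ξ : ℂ)) (c : ℝ) :
    (∫ v : V, Real.exp (-(1 / 4) * ‖v‖ ^ 2)) * ∫ x, Real.exp (-‖x‖ ^ 2 * c ^ 2) * p x
      = ∫ v : V, φ (c • v) * Real.exp (-(1 / 4) * ‖v‖ ^ 2) := by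
  set Z := ∫ v : V, Real.exp (-(1 / 4) * ‖v‖ ^ 2) with hZ
  have hG := integrable_exp_neg_mul_sq_norm (V := V) (b := 1 / 4) (by norm_num)
  have hgauss : ∀ x : V, ∫ v : V, (Real.exp (-(1 / 4) * ‖v‖ ^ 2) : ℂ)
      * Complex.exp (Complex.I * (⟪c • v, x⟫ : ℂ)) = ((Z * Real.exp (-‖x‖ ^ 2 * c ^ 2) : ℝ) : ℂ) := by
    intro x
    have h1 := GaussianFourier.integral_cexp_neg_mul_sq_norm_add (b := 1 / 4) (V := V)
      (by norm_num) (Complex.I * c) x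
    have h0 := GaussianFourier.integral_cexp_neg_mul_sq_norm_add (b := 1 / 4) (V := V)
      (by norm_num) 0 0
    have hZ' : (Z : ℂ) = (Real.pi / (1 / 4) : ℂ) ^ (Module.finrank ℝ V / 2 : ℂ) := by
      rw [hZ, ← integral_complex_ofReal]
      simpa using h0
    rw [Complex.ofReal_mul, hZ']
    convert h1 using 1
    · refine integral_congr_ae (ae_of_all _ fun v => ?_)
      simp only
      rw [Complex.ofReal_exp, ← Complex.exp_add, real_inner_smul_left, real_inner_comm]
      congr 1
      push_cast
      ring
    · rw [Complex.ofReal_exp]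
      congr 2
      push_cast
      rw [mul_pow, Complex.I_sq]
      ring
  have hsw : ∫ x : V, ∫ v : V, (Real.exp (-(1 / 4) * ‖v‖ ^ 2) : ℂ)
        * Complex.exp (Complex.I * (⟪c • v, x⟫ : ℂ)) * (p x : ℂ)
      = ∫ v : V, ∫ x : V, (Real.exp (-(1 / 4) * ‖v‖ ^ 2) : ℂ)
        * Complex.exp (Complex.I * (⟪c • v, x⟫ : ℂ)) * (p x : ℂ) := by
    refine integral_integral_swap ?_
    have h := (hp.ofReal (𝕜 := ℂ)).mul_prod (hG.ofReal (𝕜 := ℂ))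
    have h2 := h.bdd_mul (c := 1)
      (f := fun z : V × V => Complex.exp (Complex.I * (⟪c • z.2, z.1⟫ : ℂ)))
      (Continuous.aestronglyMeasurable (by fun_prop)) (ae_of_all _ fun z => by
        rw [mul_comm, Complex.norm_exp_ofReal_mul_I])
    refine h2.congr (ae_of_all _ fun z => ?_)
    simp only [Function.uncurry]
    change _ * ((p z.1 : ℂ) * (Real.exp _ : ℂ)) = _
    ring
  simp_rw [integral_mul_const, hgauss, mul_assoc, integral_const_mul, hφ] at hsw
  simp_rw [← Complex.ofReal_mul, integral_complex_ofReal, Complex.ofReal_inj, mul_assoc,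
    integral_const_mul] at hsw
  simpa only [mul_comm] using hsw

end Gaussian

/-- The β-moment of the standard isotropic α-stable density (a variant of
Sato, Eq. (25.6)): if ∫ e^{i⟨ξ,x⟩} p(x) dx = e^{−‖ξ‖^α}, then for 0 < β < α,
∫ ‖x‖^β p(x) dx = 2^β Γ((d+β)/2) Γ(1−β/α) / (Γ(d/2) Γ(1−β/2)). -/
theorem isotropic_stable_moment
    (d : ℕ) (hd : 1 ≤ d) (α : ℝ) (hα0 : 0 < α) (hα2 : α ≤ 2)
    (p : EuclideanSpace ℝ (Fin d) → ℝ)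
    (hp0 : ∀ x, 0 ≤ p x) (hpint : Integrable p)
    (hpfourier : ∀ ξ : EuclideanSpace ℝ (Fin d),
      ∫ x, Complex.exp (Complex.I * (⟪ξ, x⟫ : ℂ)) * (p x : ℂ)
        = Complex.exp (-(‖ξ‖ ^ α : ℝ))) :
    ∀ β : ℝ, 0 < β → β < α →
      ∫ x, ‖x‖ ^ β * p x
        = 2 ^ β * Real.Gamma ((d + β) / 2) * Real.Gamma (1 - β / α)
          / (Real.Gamma ((d : ℝ) / 2) * Real.Gamma (1 - β / 2)) := by
  intro β hβ0 hβα
  have hdpos : (0 : ℝ) < d := by exact_mod_cast hd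
  have : Nonempty (Fin d) := ⟨⟨0, hd⟩⟩
  have hfin : Module.finrank ℝ (EuclideanSpace ℝ (Fin d)) = d := by simp
  set G : EuclideanSpace ℝ (Fin d) → ℝ := fun v => Real.exp (-(1 / 4) * ‖v‖ ^ 2)
  have hG : Integrable G := integrable_exp_neg_mul_sq_norm (by norm_num)
  have hG0 : ∀ v, 0 < G v := fun v => Real.exp_pos _
  set Z := ∫ v, G v with hZ
  have hmom : ∀ γ : ℝ, 0 ≤ γ → _ := fun γ hγ =>
    integral_norm_rpow_mul_exp_neg_mul_sq (V := EuclideanSpace ℝ (Fin d)) (b := 1 / 4)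
      (by norm_num) hγ
  rw [hfin] at hmom
  have hZpos : 0 < Z := by
    rw [hZ, GaussianFourier.integral_rexp_neg_mul_sq_norm (by norm_num)]
    positivity
  have hGmom : ∫ v, ‖v‖ ^ β * G v
      = Z * (2 ^ β * Real.Gamma ((d + β) / 2) / Real.Gamma ((d : ℝ) / 2)) := by
    have h0 := hmom 0 le_rfl
    simp only [Real.rpow_zero, one_mul, add_zero] at h0
    rw [hmom β hβ0.le, hZ, h0]
    have hΓ : Real.Gamma ((d : ℝ) / 2) ≠ 0 := (Real.Gamma_pos_of_pos (by positivity)).ne'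
    have h2 : (1 / 4 : ℝ) ^ (-(d + β) / 2) = (1 / 4 : ℝ) ^ (-(d : ℝ) / 2) * 2 ^ β := by
      rw [show -(d + β) / 2 = -(d : ℝ) / 2 + -(β / 2) by ring, Real.rpow_add (by norm_num)]
      congr 1
      rw [one_div, Real.inv_rpow (by norm_num), ← Real.rpow_neg (by norm_num), neg_neg,
        show (4 : ℝ) = 2 ^ (2 : ℝ) by norm_num, ← Real.rpow_mul (by norm_num)]
      congr 1
      ring
    rw [h2]
    field_simp
  have hφ : ∀ ξ : EuclideanSpace ℝ (Fin d),
      ∫ x, Complex.exp (Complex.I * (⟪ξ, x⟫ : ℂ)) * (p x : ℂ)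
        = ((Real.exp (-‖ξ‖ ^ α) : ℝ) : ℂ) := by
    intro ξ
    rw [hpfourier, Complex.ofReal_exp, Complex.ofReal_neg]
  have hp1 : ∫ x, p x = 1 := by
    have := hφ 0
    simp only [inner_zero_left, Complex.ofReal_zero, mul_zero, Complex.exp_zero, one_mul,
      norm_zero, Real.zero_rpow hα0.ne', neg_zero, Real.exp_zero, integral_complex_ofReal] at this
    exact_mod_cast this
  have hlap : ∀ t : ℝ, 0 < t → Z * ∫ x, Real.exp (-‖x‖ ^ 2 * t ^ (1 : ℝ)) * p x
      = ∫ v, Real.exp (-‖v‖ ^ α * t ^ (α / 2)) * G v := by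
    intro t ht
    have h := integral_exp_neg_mul_sq_norm_mul hpint hφ √t
    rw [Real.sq_sqrt ht.le] at h
    rw [Real.rpow_one, h]
    refine integral_congr_ae (ae_of_all _ fun v => ?_)
    simp only
    rw [norm_smul, Real.norm_of_nonneg (Real.sqrt_nonneg t),
      Real.mul_rpow (Real.sqrt_nonneg t) (norm_nonneg v), Real.sqrt_eq_rpow, ← Real.rpow_mul ht.le]
    congr 2
    rw [show 1 / 2 * α = α / 2 by ring]
    ring
  have hP := lintegral_laplace_mul_rpow (μ := volume) (s := β / 2) (a := 1) (by linarith)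
    (by linarith) (r := fun x : EuclideanSpace ℝ (Fin d) => ‖x‖ ^ 2) (fun x => by positivity)
    (by fun_prop) hp0 hpint
  have hQ := lintegral_laplace_mul_rpow (μ := volume) (s := β / 2) (a := α / 2) (by linarith)
    (by linarith) (r := fun x : EuclideanSpace ℝ (Fin d) => ‖x‖ ^ α) (fun x => by positivity)
    (by fun_prop) (fun v => (hG0 v).le) hG
  have hPQ : ENNReal.ofReal Z * ∫⁻ t in Set.Ioi (0 : ℝ), ENNReal.ofReal
        (((∫ x, p x) - ∫ x, Real.exp (-‖x‖ ^ 2 * t ^ (1 : ℝ)) * p x) * t ^ (-1 - β / 2))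
      = ∫⁻ t in Set.Ioi (0 : ℝ), ENNReal.ofReal
        (((∫ v, G v) - ∫ v, Real.exp (-‖v‖ ^ α * t ^ (α / 2)) * G v) * t ^ (-1 - β / 2)) := by
    rw [← lintegral_const_mul' _ _ ENNReal.ofReal_ne_top]
    refine setLIntegral_congr_fun measurableSet_Ioi fun t ht => ?_
    rw [← hlap t ht, hp1, ← ENNReal.ofReal_mul hZpos.le]
    congr 1
    ring
  rw [hP, hQ] at hPQ
  have hx1 : ∀ x : EuclideanSpace ℝ (Fin d), (‖x‖ ^ 2) ^ (β / 2 / 1) = ‖x‖ ^ β := fun x => by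
    rw [← Real.rpow_natCast, ← Real.rpow_mul (norm_nonneg x)]
    congr 1
    push_cast
    ring
  have hx2 : ∀ x : EuclideanSpace ℝ (Fin d), (‖x‖ ^ α) ^ (β / 2 / (α / 2)) = ‖x‖ ^ β := fun x => by
    rw [← Real.rpow_mul (norm_nonneg x)]
    congr 1
    field_simp
  simp_rw [hx1, hx2] at hPQ
  rw [div_one, show β / 2 / (α / 2) = β / α by field_simp] at hPQ
  have hA : 0 < Real.Gamma (1 - β / 2) := Real.Gamma_pos_of_pos (by linarith)
  have hB : 0 < Real.Gamma (1 - β / α) :=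
    Real.Gamma_pos_of_pos (by linarith [(div_lt_one hα0).2 hβα])
  have hΓd : 0 < Real.Gamma ((d : ℝ) / 2) := Real.Gamma_pos_of_pos (by positivity)
  have hGi : Integrable fun v => ‖v‖ ^ β * G v :=
    integrable_norm_rpow_mul_exp_neg_mul_sq (by norm_num) hβ0.le
  have hR := integral_eq_lintegral_of_nonneg_ae (μ := volume)
    (ae_of_all _ fun v => mul_nonneg (Real.rpow_nonneg (norm_nonneg v) β) (hG0 v).le) hGi.1
  have hL := integral_eq_lintegral_of_nonneg_ae (μ := volume)
    (ae_of_all _ fun x => mul_nonneg (Real.rpow_nonneg (norm_nonneg x) β) (hp0 x))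
    ((Measurable.aestronglyMeasurable (by fun_prop)).mul hpint.1)
  have := congrArg ENNReal.toReal hPQ
  rw [ENNReal.toReal_mul, ENNReal.toReal_mul, ENNReal.toReal_mul, ← hR, ← hL, hGmom,
    ENNReal.toReal_ofReal hZpos.le, ENNReal.toReal_ofReal (by positivity),
    ENNReal.toReal_ofReal (by positivity)] at this
  generalize Real.Gamma (1 - β / 2) = A at *
  generalize Real.Gamma (1 - β / α) = B at *
  field_simp at this ⊢
  linarith
end
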